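/- Let ρ : ℂ → [-∞,∞) be a subharmonic function that is bounded from below. Then the Hartogs domain G_{ℂ,ρ} is an L²_h-domain of holomorphy if and only if ρ is not constant. -/

import Mathlib

open MeasureTheory Filter Metric Set

/-- `elog x` is `log x` with value `-∞` for `x ≤ 0`, as an extended real. -/
noncomputable def elog (x : ℝ) : EReal := if x ≤ 0 then ⊥ else ((Real.log x : ℝ) : EReal)

/-- The sub-mean value inequality over circles of closed discs contained in `Ω`, phrased via
continuous real-valued majorants of the (extended-real-valued) function on the circle. -/
def SubmeanOn (u : ℂ → EReal) (Ω : Set ℂ) : Prop :=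
  ∀ c : ℂ, ∀ r : ℝ, 0 < r → Metric.closedBall c r ⊆ Ω →
    ∀ φ : ℝ → ℝ, Continuous φ →
      (∀ θ : ℝ, u (c + r * Complex.exp (θ * Complex.I)) ≤ ((φ θ : ℝ) : EReal)) →
      u c ≤ (((2 * Real.pi)⁻¹ * ∫ θ in (0:ℝ)..(2 * Real.pi), φ θ : ℝ) : EReal)

/-- `u : Ω → [-∞, ∞)` is subharmonic on the open set `Ω ⊆ ℂ`: upper semicontinuous,
nowhere `+∞`, not identically `-∞` on any connected component, sub-mean value inequality. -/
def SubharmonicOn (u : ℂ → EReal) (Ω : Set ℂ) : Prop :=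
  IsOpen Ω ∧ UpperSemicontinuousOn u Ω ∧
  (∀ z ∈ Ω, u z ≠ ⊤) ∧
  (∀ z ∈ Ω, ∃ w ∈ connectedComponentIn Ω z, u w ≠ ⊥) ∧
  SubmeanOn u Ω

/-- A set `E ⊆ ℂ` is polar if some subharmonic function on an open set containing `E`
equals `-∞` on `E`. -/
def PolarSet (E : Set ℂ) : Prop :=
  ∃ Ω : Set ℂ, E ⊆ Ω ∧ ∃ u : ℂ → EReal, SubharmonicOn u Ω ∧ ∀ z ∈ E, u z = ⊥

/-- The space of square-integrable holomorphic functions on `D`. -/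
def L2h {E : Type*} [NormedAddCommGroup E] [NormedSpace ℂ E] [MeasureSpace E]
    (D : Set E) : Set (E → ℂ) :=
  {f | DifferentiableOn ℂ f D ∧ IntegrableOn (fun z => ‖f z‖ ^ 2) D volume}

/-- `D` is an `L²ₕ`-domain of holomorphy. -/
def IsL2hDomainOfHolomorphy {E : Type*} [NormedAddCommGroup E] [NormedSpace ℂ E]
    [MeasureSpace E] (D : Set E) : Prop :=
  ¬ ∃ D₀ D₁ : Set E, IsOpen D₀ ∧ IsConnected D₀ ∧ IsOpen D₁ ∧ IsConnected D₁ ∧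
      D₀ ⊆ D₁ ∩ D ∧ ¬ (D₁ ⊆ D) ∧
      ∀ f ∈ L2h D, ∃ g : E → ℂ, DifferentiableOn ℂ g D₁ ∧ Set.EqOn g f D₀

/-- The Hartogs domain `G_{D,ρ} = {(z₁,z₂) : z₁ ∈ D, |z₂| < e^{-ρ(z₁)}}`. -/
def hartogs (D : Set ℂ) (ρ : ℂ → EReal) : Set (ℂ × ℂ) :=
  {p | p.1 ∈ D ∧ elog ‖p.2‖ < - ρ p.1}

/-- `S(D)`: boundary points near which the complement of `D` is polar. -/
def polarS (D : Set ℂ) : Set ℂ :=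
  {z ∈ frontier D | ∃ U : Set ℂ, IsOpen U ∧ z ∈ U ∧ PolarSet (U \ D)}

/-- `fj` is the family of coefficients of a Hartogs expansion of `f` on `G_{D,ρ}`. -/
def HartogsExpansion (D : Set ℂ) (ρ : ℂ → EReal) (f : ℂ × ℂ → ℂ) (fj : ℕ → ℂ → ℂ) : Prop :=
  (∀ j, DifferentiableOn ℂ (fj j) D) ∧
  ∀ p ∈ hartogs D ρ, HasSum (fun j => fj j p.1 * p.2 ^ j) (f p)

/-- `ρ_f(z) = limsup_j (1/j) log |f_j(z)|` for coefficients `fj`. -/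
noncomputable def coeffGrowth (fj : ℕ → ℂ → ℂ) (z : ℂ) : EReal :=
  Filter.limsup (fun (j : ℕ) => ((((j : ℝ)⁻¹ : ℝ)) : EReal) * elog ‖fj j z‖) Filter.atTop

/-- The upper semicontinuous regularization `g*`. -/
noncomputable def uscReg (g : ℂ → EReal) (z : ℂ) : EReal := Filter.limsup g (nhds z)

/-- `ρ̃ = sup_{f ∈ L²ₕ(G_{D,ρ})} (ρ_f)*`. -/
noncomputable def rhoTilde (D : Set ℂ) (ρ : ℂ → EReal) (z : ℂ) : EReal :=
  ⨆ fj ∈ {fj : ℕ → ℂ → ℂ | ∃ f ∈ L2h (hartogs D ρ), HartogsExpansion D ρ f fj},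
    uscReg (coeffGrowth fj) z

/-- `D̂ = D ∪ {z ∈ S(D) : limsup_{D ∋ w → z} ρ(w) < ∞}`. -/
def DHat (D : Set ℂ) (ρ : ℂ → EReal) : Set ℂ :=
  D ∪ {z ∈ polarS D | Filter.limsup ρ (nhdsWithin z D) < ⊤}

open Classical in
/-- `ρ̂`, extending `ρ` to `D̂` by boundary limsups. -/
noncomputable def rhoHat (D : Set ℂ) (ρ : ℂ → EReal) (z : ℂ) : EReal :=
  if z ∈ D then ρ z else Filter.limsup ρ (nhdsWithin z D)

/-- `u` is plurisubharmonic on an open `Ω ⊆ ℂⁿ`. -/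
def PlurisubharmonicOn {n : ℕ} (u : (Fin n → ℂ) → EReal) (Ω : Set (Fin n → ℂ)) : Prop :=
  IsOpen Ω ∧ UpperSemicontinuousOn u Ω ∧
  (∀ z ∈ Ω, u z ≠ ⊤) ∧
  (∀ z ∈ Ω, ∃ w ∈ connectedComponentIn Ω z, u w ≠ ⊥) ∧
  ∀ a b : Fin n → ℂ, SubmeanOn (fun lam => u (a + lam • b)) {lam : ℂ | a + lam • b ∈ Ω}

/-- A set `E ⊆ ℂⁿ` is pluripolar. -/
def PluripolarSet {n : ℕ} (E : Set (Fin n → ℂ)) : Prop :=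
  ∃ Ω : Set (Fin n → ℂ), E ⊆ Ω ∧
    ∃ u : (Fin n → ℂ) → EReal, PlurisubharmonicOn u Ω ∧ ∀ z ∈ E, u z = ⊥

/-- `D ⊆ ℂⁿ` is pseudoconvex: it admits a plurisubharmonic exhaustion function. -/
def IsPseudoconvex {n : ℕ} (D : Set (Fin n → ℂ)) : Prop :=
  ∃ u : (Fin n → ℂ) → EReal, PlurisubharmonicOn u D ∧
    ∀ c : ℝ, IsCompact {z | z ∈ D ∧ u z ≤ (c : EReal)}

/-- `L²ₕ(D)` is infinite dimensional: arbitrarily many elements that are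
linearly independent as functions on `D`. -/
def L2hInfiniteDim {E : Type*} [NormedAddCommGroup E] [NormedSpace ℂ E] [MeasureSpace E]
    (D : Set E) : Prop :=
  ∀ N : ℕ, ∃ fs : Fin N → E → ℂ, (∀ i, fs i ∈ L2h D) ∧
    ∀ c : Fin N → ℂ, (∀ z ∈ D, ∑ i, c i * fs i z = 0) → c = 0

open scoped ContDiff Topology

noncomputable section Wirtinger

open ComplexConjugate

/-- The Wirtinger derivative `∂f/∂z`. -/
def dz (f : ℂ → ℂ) (z : ℂ) : ℂ := (fderiv ℝ f z 1 - Complex.I * fderiv ℝ f z Complex.I) / 2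

/-- The Wirtinger derivative `∂f/∂z̄`. -/
def dzb (f : ℂ → ℂ) (z : ℂ) : ℂ := (fderiv ℝ f z 1 + Complex.I * fderiv ℝ f z Complex.I) / 2

variable {f g : ℂ → ℂ} {z : ℂ}

lemma dz_add (hf : DifferentiableAt ℝ f z) (hg : DifferentiableAt ℝ g z) :
    dz (fun z => f z + g z) z = dz f z + dz g z := by
  unfold dz; rw [fderiv_fun_add hf hg]; simp; ring

lemma dzb_add (hf : DifferentiableAt ℝ f z) (hg : DifferentiableAt ℝ g z) :
    dzb (fun z => f z + g z) z = dzb f z + dzb g z := by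
  unfold dzb; rw [fderiv_fun_add hf hg]; simp; ring

lemma dz_mul (hf : DifferentiableAt ℝ f z) (hg : DifferentiableAt ℝ g z) :
    dz (fun z => f z * g z) z = dz f z * g z + f z * dz g z := by
  unfold dz; rw [fderiv_fun_mul hf hg]; simp; ring

lemma dzb_mul (hf : DifferentiableAt ℝ f z) (hg : DifferentiableAt ℝ g z) :
    dzb (fun z => f z * g z) z = dzb f z * g z + f z * dzb g z := by
  unfold dzb; rw [fderiv_fun_mul hf hg]; simp; ring

lemma dz_const (c : ℂ) : dz (fun _ => c) z = 0 := by simp [dz]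

lemma dzb_const (c : ℂ) : dzb (fun _ => c) z = 0 := by simp [dzb]

lemma dz_const_mul (c : ℂ) (hf : DifferentiableAt ℝ f z) :
    dz (fun z => c * f z) z = c * dz f z := by
  rw [dz_mul (by fun_prop) hf, dz_const]; ring

lemma dzb_const_mul (c : ℂ) (hf : DifferentiableAt ℝ f z) :
    dzb (fun z => c * f z) z = c * dzb f z := by
  rw [dzb_mul (by fun_prop) hf, dzb_const]; ring

lemma fderiv_conj_comp (hf : DifferentiableAt ℝ f z) (v : ℂ) :
    fderiv ℝ (fun z => conj (f z)) z v = conj (fderiv ℝ f z v) := by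
  have h := ((Complex.conjCLE : ℂ →L[ℝ] ℂ).hasFDerivAt (x := f z)).comp z hf.hasFDerivAt
  have h2 : HasFDerivAt (fun z => conj (f z)) _ z := h
  rw [h2.fderiv]; simp

lemma dz_conj (hf : DifferentiableAt ℝ f z) :
    dz (fun z => conj (f z)) z = conj (dzb f z) := by
  unfold dz dzb; simp only [fderiv_conj_comp hf]; simp [Complex.conj_ofNat]; ring

lemma dzb_conj (hf : DifferentiableAt ℝ f z) :
    dzb (fun z => conj (f z)) z = conj (dz f z) := by
  unfold dz dzb; simp only [fderiv_conj_comp hf]; simp [Complex.conj_ofNat]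

lemma dz_ofReal_conj {φ : ℂ → ℝ} (hφ : DifferentiableAt ℝ (fun z => (φ z : ℂ)) z) :
    conj (dz (fun z => (φ z : ℂ)) z) = dzb (fun z => (φ z : ℂ)) z := by
  rw [← dzb_conj hφ]; simp

lemma fderiv_cexp_comp (hf : DifferentiableAt ℝ f z) (v : ℂ) :
    fderiv ℝ (fun z => Complex.exp (f z)) z v = Complex.exp (f z) * fderiv ℝ f z v := by
  rw [hf.hasFDerivAt.cexp.fderiv]; simp

lemma dz_cexp (hf : DifferentiableAt ℝ f z) :
    dz (fun z => Complex.exp (f z)) z = Complex.exp (f z) * dz f z := by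
  unfold dz; simp only [fderiv_cexp_comp hf]; ring

lemma dzb_cexp (hf : DifferentiableAt ℝ f z) :
    dzb (fun z => Complex.exp (f z)) z = Complex.exp (f z) * dzb f z := by
  unfold dzb; simp only [fderiv_cexp_comp hf]; ring

lemma dz_id : dz (fun z => z) z = 1 := by
  have : fderiv ℝ (fun z : ℂ => z) z = ContinuousLinearMap.id ℝ ℂ := fderiv_fun_id
  simp [dz, this]

lemma dzb_id : dzb (fun z => z) z = 0 := by
  have : fderiv ℝ (fun z : ℂ => z) z = ContinuousLinearMap.id ℝ ℂ := fderiv_fun_id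
  simp [dzb, this]

lemma holomorphic_of_dzb (hf : DifferentiableAt ℝ f z) (h : dzb f z = 0) :
    DifferentiableAt ℂ f z := by
  rw [differentiableAt_complex_iff_differentiableAt_real]
  refine ⟨hf, ?_⟩
  unfold dzb at h
  have h1 : fderiv ℝ f z 1 + Complex.I * fderiv ℝ f z Complex.I = 0 := by simpa using h
  have : Complex.I * (fderiv ℝ f z 1 + Complex.I * fderiv ℝ f z Complex.I) = 0 := by rw [h1]; simp
  rw [mul_add, ← mul_assoc, Complex.I_mul_I] at this
  simp only [smul_eq_mul]
  linear_combination -this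

lemma contDiff_dz (hf : ContDiff ℝ ∞ f) : ContDiff ℝ ∞ (dz f) := by
  have h := hf.fderiv_right (m := ∞) (by simp)
  have h1 : ContDiff ℝ ∞ (fun z => fderiv ℝ f z 1) := h.clm_apply contDiff_const
  have h2 : ContDiff ℝ ∞ (fun z => fderiv ℝ f z Complex.I) := h.clm_apply contDiff_const
  unfold dz
  exact (h1.sub (contDiff_const.mul h2)).div_const _

lemma contDiff_dzb (hf : ContDiff ℝ ∞ f) : ContDiff ℝ ∞ (dzb f) := by
  have h := hf.fderiv_right (m := ∞) (by simp)
  have h1 : ContDiff ℝ ∞ (fun z => fderiv ℝ f z 1) := h.clm_apply contDiff_const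
  have h2 : ContDiff ℝ ∞ (fun z => fderiv ℝ f z Complex.I) := h.clm_apply contDiff_const
  unfold dzb
  exact (h1.add (contDiff_const.mul h2)).div_const _

lemma dz_hasCompactSupport (hf : HasCompactSupport f) : HasCompactSupport (dz f) := by
  have h := hf.fderiv (𝕜 := ℝ)
  refine h.mono ?_
  intro z hz hz'
  apply hz
  simp only [dz]
  rw [hz']; simp

lemma dzb_hasCompactSupport (hf : HasCompactSupport f) : HasCompactSupport (dzb f) := by
  have h := hf.fderiv (𝕜 := ℝ)
  refine h.mono ?_
  intro z hz hz'
  apply hz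
  simp only [dzb]
  rw [hz']; simp

lemma integral_fderiv_apply_eq_zero (hf : ContDiff ℝ ∞ f) (hc : HasCompactSupport f) (v : ℂ) :
    ∫ z, fderiv ℝ f z v = 0 := by
  have hd : ContDiff ℝ ∞ (fun z => fderiv ℝ f z v) :=
    (hf.fderiv_right (m := ∞) (by simp)).clm_apply contDiff_const
  have hdc : HasCompactSupport (fun z => fderiv ℝ f z v) := by
    refine (hc.fderiv (𝕜 := ℝ)).mono ?_
    intro z hz hz'
    apply hz
    simp only
    rw [hz']; simp
  have := integral_mul_fderiv_eq_neg_fderiv_mul_of_integrable (μ := volume) (f := fun _ : ℂ => (1 : ℂ))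
    (g := f) (v := v) (by simp)
    (by simpa using hd.continuous.integrable_of_hasCompactSupport hdc)
    (by simpa using hf.continuous.integrable_of_hasCompactSupport hc)
    (by intros; fun_prop) (by intro x _; exact hf.differentiable (by simp) x)
  simpa using this

lemma integral_dz (hf : ContDiff ℝ ∞ f) (hc : HasCompactSupport f) : ∫ z, dz f z = 0 := by
  have hi : ∀ v, Integrable (fun z => fderiv ℝ f z v) := by
    intro v
    have hd : ContDiff ℝ ∞ (fun z => fderiv ℝ f z v) :=
      (hf.fderiv_right (m := ∞) (by simp)).clm_apply contDiff_const
    refine hd.continuous.integrable_of_hasCompactSupport ((hc.fderiv (𝕜 := ℝ)).mono ?_)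
    intro z hz hz'
    apply hz
    simp only
    rw [hz']; simp
  unfold dz
  rw [integral_div, integral_sub (hi _) ((hi _).const_mul _), integral_const_mul,
    integral_fderiv_apply_eq_zero hf hc, integral_fderiv_apply_eq_zero hf hc]
  simp

lemma integral_dzb (hf : ContDiff ℝ ∞ f) (hc : HasCompactSupport f) : ∫ z, dzb f z = 0 := by
  have h1 : dzb f = fun z => conj (dz (fun z => conj (f z)) z) := by
    ext z
    rw [dz_conj (hf.differentiable (by simp) z)]; simp
  have h2 := integral_dz (f := fun z => conj (f z)) (Complex.conjCLE.contDiff.comp hf)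
    (hc.comp_left (g := conj) (by simp))
  rw [h1, integral_conj, h2]
  simp

lemma dz_dzb_comm (hf : ContDiff ℝ ∞ f) (z : ℂ) : dz (dzb f) z = dzb (dz f) z := by
  have h := hf.fderiv_right (m := ∞) (by simp)
  have h1 : ∀ v, DifferentiableAt ℝ (fun z => fderiv ℝ f z v) z := fun v =>
    (h.clm_apply contDiff_const).differentiable (by simp) z
  have h2 : ∀ v u, fderiv ℝ (fun z => fderiv ℝ f z v) z u = fderiv ℝ (fderiv ℝ f) z u v := by
    intro v u
    have := (h.differentiable (by simp) z).hasFDerivAt.clm_apply (hasFDerivAt_const v z)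
    rw [this.fderiv]; simp
  have hs : IsSymmSndFDerivAt ℝ f z :=
    hf.contDiffAt.isSymmSndFDerivAt (by
      simp only [minSmoothness_of_isRCLikeNormedField]
      exact WithTop.coe_le_coe.2 (le_top : (2 : ℕ∞) ≤ ⊤))
  have e1 : ∀ u, fderiv ℝ (dzb f) z u = (fderiv ℝ (fderiv ℝ f) z u 1 +
      Complex.I * fderiv ℝ (fderiv ℝ f) z u Complex.I) / 2 := by
    intro u
    have : HasFDerivAt (dzb f) _ z :=
      ((h1 1).hasFDerivAt.add ((h1 Complex.I).hasFDerivAt.const_mul Complex.I)).mul_const (2⁻¹ : ℂ)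
    rw [this.fderiv]; simp [h2]; ring
  have e2 : ∀ u, fderiv ℝ (dz f) z u = (fderiv ℝ (fderiv ℝ f) z u 1 -
      Complex.I * fderiv ℝ (fderiv ℝ f) z u Complex.I) / 2 := by
    intro u
    have : HasFDerivAt (dz f) _ z :=
      ((h1 1).hasFDerivAt.sub ((h1 Complex.I).hasFDerivAt.const_mul Complex.I)).mul_const (2⁻¹ : ℂ)
    rw [this.fderiv]; simp [h2]; ring
  unfold dz dzb at *
  rw [e1, e1, e2, e2, hs.eq 1 Complex.I]
  ring

end Wirtinger

noncomputable section Energy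

open ComplexConjugate

/-- The operator `∂²/∂z∂z̄` (a quarter of the Laplacian) on real functions. -/
def ddb (φ : ℂ → ℝ) (z : ℂ) : ℝ := (dz (dzb (fun z => (φ z : ℂ))) z).re

lemma ofReal_contDiff {φ : ℂ → ℝ} (hφ : ContDiff ℝ ∞ φ) : ContDiff ℝ ∞ (fun z => (φ z : ℂ)) :=
  Complex.ofRealCLM.contDiff.comp hφ

lemma ofReal_ddb {φ : ℂ → ℝ} (hφ : ContDiff ℝ ∞ φ) (z : ℂ) :
    (ddb φ z : ℂ) = dz (dzb (fun z => (φ z : ℂ))) z := by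
  have h := ofReal_contDiff hφ
  have hd : ∀ {f : ℂ → ℂ}, ContDiff ℝ ∞ f → DifferentiableAt ℝ f z :=
    fun hf => hf.differentiable (by simp) z
  apply Complex.conj_eq_iff_re.1
  have e : dzb (fun z => (φ z : ℂ)) = fun z => conj (dz (fun z => (φ z : ℂ)) z) := by
    ext z
    rw [dz_ofReal_conj (h.differentiable (by simp) z)]
  conv_lhs => rw [e, dz_conj (hd (contDiff_dz h))]
  rw [dz_dzb_comm h]; simp

lemma continuous_ddb {φ : ℂ → ℝ} (hφ : ContDiff ℝ ∞ φ) : Continuous (ddb φ) :=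
  Complex.continuous_re.comp (contDiff_dz (contDiff_dzb (ofReal_contDiff hφ))).continuous

lemma energy_identity {β : ℂ → ℂ} {w φ : ℂ → ℝ} (hβ : ContDiff ℝ ∞ β) (hw : ContDiff ℝ ∞ w)
    (hφ : ContDiff ℝ ∞ φ) (z : ℂ) :
    dz (fun z => w z * conj (β z) * dzb β z * Complex.exp (φ z)) z
      - dzb (fun z => w z * conj (β z) * (dz β z + β z * dz (fun z => (φ z : ℂ)) z) *
        Complex.exp (φ z)) z
      + dz (fun z => β z * conj (β z) * Complex.exp (φ z) * dzb (fun z => (w z : ℂ)) z) z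
    = w z * Complex.exp (φ z) * (dzb β z * conj (dzb β z)
        - (dz β z + β z * dz (fun z => (φ z : ℂ)) z) *
          conj (dz β z + β z * dz (fun z => (φ z : ℂ)) z))
      + Complex.exp (φ z) * (conj (β z) * dz (fun z => (w z : ℂ)) z * dzb β z
        + conj (conj (β z) * dz (fun z => (w z : ℂ)) z * dzb β z))
      + β z * conj (β z) * Complex.exp (φ z) * (ddb w z - w z * ddb φ z) := by
  have hW := ofReal_contDiff hw
  have hF := ofReal_contDiff hφ
  have hd : ∀ {f : ℂ → ℂ}, ContDiff ℝ ∞ f → DifferentiableAt ℝ f z :=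
    fun hf => hf.differentiable (by simp) z
  have hcβ : ContDiff ℝ ∞ (fun z => conj (β z)) := Complex.conjCLE.contDiff.comp hβ
  have hE : ContDiff ℝ ∞ (fun z => Complex.exp (φ z)) := hF.cexp
  have d1 := hd hβ
  have d2 := hd hcβ
  have d3 := hd hW
  have d4 := hd hF
  have d5 := hd hE
  have d6 := hd (contDiff_dzb hβ)
  have d7 := hd (contDiff_dz hβ)
  have d8 := hd (contDiff_dz hF)
  have d9 := hd (contDiff_dzb hW)
  rw [ofReal_ddb hw, ofReal_ddb hφ]
  rw [dz_mul (by fun_prop) d5, dz_mul (by fun_prop) d6, dz_mul d3 d2, dz_cexp d4,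
    dzb_mul (by fun_prop) d5, dzb_mul (by fun_prop) (by fun_prop), dzb_mul d3 d2, dzb_cexp d4,
    dzb_add d7 (by fun_prop), dzb_mul d1 d8,
    dz_mul (by fun_prop) d9, dz_mul (by fun_prop) d5, dz_mul d1 d2, dz_cexp d4,
    dz_conj d1, dzb_conj d1, ← dz_dzb_comm hβ, ← dz_dzb_comm hF]
  simp only [map_mul, map_add, Complex.conj_conj, dz_ofReal_conj d3, dz_ofReal_conj d4]
  ring

lemma energy_integral {β : ℂ → ℂ} {w φ : ℂ → ℝ} (hβ : ContDiff ℝ ∞ β) (hc : HasCompactSupport β)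
    (hw : ContDiff ℝ ∞ w) (hφ : ContDiff ℝ ∞ φ) (hw0 : ∀ z, 0 ≤ w z) :
    ∫ z, ‖β z‖ ^ 2 * Real.exp (φ z) * (w z * ddb φ z - ddb w z) ≤
      ∫ z, (w z * Real.exp (φ z) * ‖dzb β z‖ ^ 2 +
        2 * (Real.exp (φ z) * ‖β z‖ * ‖dz (fun z => (w z : ℂ)) z‖ * ‖dzb β z‖)) := by
  have hW := ofReal_contDiff hw
  have hF := ofReal_contDiff hφ
  have hcβ : ContDiff ℝ ∞ (fun z => conj (β z)) := Complex.conjCLE.contDiff.comp hβ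
  have hE : ContDiff ℝ ∞ (fun z => Complex.exp (φ z)) := hF.cexp
  have hb := contDiff_dzb hβ
  have hcc : HasCompactSupport (fun z => conj (β z)) := hc.comp_left (g := conj) (by simp)
  set A := fun z => w z * conj (β z) * dzb β z * Complex.exp (φ z) with hA
  set B := fun z => w z * conj (β z) * (dz β z + β z * dz (fun z => (φ z : ℂ)) z) *
        Complex.exp (φ z) with hB
  set C := fun z => β z * conj (β z) * Complex.exp (φ z) * dzb (fun z => (w z : ℂ)) z with hC
  have sA : ContDiff ℝ ∞ A := ((hW.mul hcβ).mul hb).mul hE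
  have sB : ContDiff ℝ ∞ B :=
    ((hW.mul hcβ).mul ((contDiff_dz hβ).add (hβ.mul (contDiff_dz hF)))).mul hE
  have sC : ContDiff ℝ ∞ C := ((hβ.mul hcβ).mul hE).mul (contDiff_dzb hW)
  have cA : HasCompactSupport A := (hcc.mul_left.mul_right).mul_right
  have cB : HasCompactSupport B := (hcc.mul_left.mul_right).mul_right
  have cC : HasCompactSupport C := (hc.mul_right.mul_right).mul_right
  have i1 := integral_dz sA cA
  have i2 := integral_dzb sB cB
  have i3 := integral_dz sC cC
  have j1 := (contDiff_dz sA).continuous.integrable_of_hasCompactSupport (μ := volume)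
    (dz_hasCompactSupport cA)
  have j2 := (contDiff_dzb sB).continuous.integrable_of_hasCompactSupport (μ := volume)
    (dzb_hasCompactSupport cB)
  have j3 := (contDiff_dz sC).continuous.integrable_of_hasCompactSupport (μ := volume)
    (dz_hasCompactSupport cC)
  have hz : ∫ z, (dz A z - dzb B z + dz C z) = 0 := by
    have j : Integrable (fun z => dz A z - dzb B z) volume := j1.sub j2
    rw [integral_add j j3, integral_sub j1 j2, i1, i2, i3]; simp
  have hz2 : ∫ z, (dz A z - dzb B z + dz C z).re = 0 := by
    have j : Integrable (fun z => dz A z - dzb B z + dz C z) volume := (j1.sub j2).add j3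
    have := integral_re (𝕜 := ℂ) j
    simp only [RCLike.re_eq_complex_re] at this
    rw [this, hz]; simp
  have hpt : ∀ z, (dz A z - dzb B z + dz C z).re ≤
      (w z * Real.exp (φ z) * ‖dzb β z‖ ^ 2 +
        2 * (Real.exp (φ z) * ‖β z‖ * ‖dz (fun z => (w z : ℂ)) z‖ * ‖dzb β z‖))
      - ‖β z‖ ^ 2 * Real.exp (φ z) * (w z * ddb φ z - ddb w z) := by
    intro z
    rw [hA, hB, hC, energy_identity hβ hw hφ z]
    set D := dz β z + β z * dz (fun z => (φ z : ℂ)) z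
    set X := conj (β z) * dz (fun z => (w z : ℂ)) z * dzb β z with hX
    have hX2 : X.re ≤ ‖β z‖ * ‖dz (fun z => (w z : ℂ)) z‖ * ‖dzb β z‖ := by
      refine (Complex.re_le_norm X).trans ?_
      simp [hX]
    rw [Complex.mul_conj, Complex.mul_conj, Complex.mul_conj, Complex.add_conj,
      ← Complex.ofReal_exp]
    norm_cast
    simp only [Complex.normSq_eq_norm_sq]
    have e0 := (Real.exp_pos (φ z)).le
    have t1 := mul_nonneg (mul_nonneg (hw0 z) e0) (sq_nonneg ‖D‖)
    have t2 := mul_le_mul_of_nonneg_left hX2 e0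
    nlinarith
  have c1 : Continuous fun z => ‖β z‖ ^ 2 * Real.exp (φ z) * (w z * ddb φ z - ddb w z) := by
    have := continuous_ddb hw
    have := continuous_ddb hφ
    have := hw.continuous
    have := hφ.continuous
    have := hβ.continuous
    fun_prop
  have c2 : Continuous fun z => (w z * Real.exp (φ z) * ‖dzb β z‖ ^ 2 +
        2 * (Real.exp (φ z) * ‖β z‖ * ‖dz (fun z => (w z : ℂ)) z‖ * ‖dzb β z‖)) := by
    have := (contDiff_dz hW).continuous
    have := hb.continuous
    have := hw.continuous
    have := hφ.continuous
    have := hβ.continuous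
    fun_prop
  have k1 := c1.integrable_of_hasCompactSupport (μ := volume) (by
    apply HasCompactSupport.mul_right; apply HasCompactSupport.mul_right
    exact hc.comp_left (g := fun x : ℂ => ‖x‖ ^ 2) (by simp))
  have k2 := c2.integrable_of_hasCompactSupport (μ := volume) (by
    apply HasCompactSupport.add
    · apply HasCompactSupport.mul_left
      exact (dzb_hasCompactSupport hc).comp_left (g := fun x : ℂ => ‖x‖ ^ 2) (by simp)
    · apply HasCompactSupport.mul_left; apply HasCompactSupport.mul_left
      exact (dzb_hasCompactSupport hc).comp_left (g := fun x : ℂ => ‖x‖) (by simp))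
  rw [← sub_nonneg, ← integral_sub k2 k1, ← hz2]
  refine integral_mono ?_ (k2.sub k1) hpt
  exact ((j1.sub j2).add j3).re

end Energy

noncomputable section PointEstimate

open ComplexConjugate

lemma fderiv_comp_norm_sq {F : ℝ → ℝ} {F' : ℝ} {z : ℂ} (h : HasDerivAt F F' (‖z‖ ^ 2)) (v : ℂ) :
    fderiv ℝ (fun z : ℂ => ((F (‖z‖ ^ 2) : ℝ) : ℂ)) z v = (F' * (2 * (conj z * v).re) : ℝ) := by
  have h1 : HasFDerivAt (fun z : ℂ => ‖z‖ ^ 2) _ z := (hasFDerivAt_id z).norm_sq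
  have h2 : HasFDerivAt (fun z : ℂ => ((F (‖z‖ ^ 2) : ℝ) : ℂ)) _ z :=
    (Complex.ofRealCLM.hasFDerivAt).comp z (h.comp_hasFDerivAt z h1)
  rw [h2.fderiv]
  simp [Complex.inner]
  ring_nf

lemma dzb_comp_norm_sq {F : ℝ → ℝ} {F' : ℝ} {z : ℂ} (h : HasDerivAt F F' (‖z‖ ^ 2)) :
    dzb (fun z : ℂ => ((F (‖z‖ ^ 2) : ℝ) : ℂ)) z = F' * z := by
  unfold dzb
  rw [fderiv_comp_norm_sq h, fderiv_comp_norm_sq h]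
  apply Complex.ext <;> simp <;> ring

lemma dz_comp_norm_sq {F : ℝ → ℝ} {F' : ℝ} {z : ℂ} (h : HasDerivAt F F' (‖z‖ ^ 2)) :
    dz (fun z : ℂ => ((F (‖z‖ ^ 2) : ℝ) : ℂ)) z = F' * conj z := by
  unfold dz
  rw [fderiv_comp_norm_sq h, fderiv_comp_norm_sq h]
  apply Complex.ext <;> simp <;> ring

lemma ddb_comp_norm_sq {F F' F'' : ℝ → ℝ} (h : ∀ t, 0 ≤ t → HasDerivAt F (F' t) t)
    (h' : ∀ t, 0 ≤ t → HasDerivAt F' (F'' t) t) (z : ℂ) :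
    ddb (fun z => F (‖z‖ ^ 2)) z = F' (‖z‖ ^ 2) + ‖z‖ ^ 2 * F'' (‖z‖ ^ 2) := by
  unfold ddb
  have : dzb (fun z : ℂ => ((F (‖z‖ ^ 2) : ℝ) : ℂ)) = fun z => ((F' (‖z‖ ^ 2) : ℝ) : ℂ) * z := by
    ext z; exact dzb_comp_norm_sq (h _ (by positivity))
  rw [this]
  have hd : DifferentiableAt ℝ (fun z : ℂ => ((F' (‖z‖ ^ 2) : ℝ) : ℂ)) z := by
    have h1 : HasFDerivAt (fun z : ℂ => ‖z‖ ^ 2) _ z := (hasFDerivAt_id z).norm_sq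
    exact ((Complex.ofRealCLM.hasFDerivAt).comp z
      ((h' _ (by positivity)).comp_hasFDerivAt z h1)).differentiableAt
  rw [dz_mul hd (by fun_prop), dz_comp_norm_sq (h' _ (by positivity)), dz_id]
  rw [mul_assoc, mul_comm (conj z), Complex.mul_conj, Complex.normSq_eq_norm_sq]
  norm_cast
  simp; ring

lemma ddb_add {φ ψ : ℂ → ℝ} (hφ : ContDiff ℝ ∞ φ) (hψ : ContDiff ℝ ∞ ψ) (z : ℂ) :
    ddb (fun z => φ z + ψ z) z = ddb φ z + ddb ψ z := by
  have h1 := ofReal_contDiff hφ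
  have h2 := ofReal_contDiff hψ
  unfold ddb
  have : dzb (fun z => ((φ z + ψ z : ℝ) : ℂ)) =
      fun z => dzb (fun z => (φ z : ℂ)) z + dzb (fun z => (ψ z : ℂ)) z := by
    ext z
    push_cast
    exact dzb_add (h1.differentiable (by simp) z) (h2.differentiable (by simp) z)
  rw [this, dz_add ((contDiff_dzb h1).differentiable (by simp) z)
    ((contDiff_dzb h2).differentiable (by simp) z)]
  simp

lemma ddb_const_mul {φ : ℂ → ℝ} (hφ : ContDiff ℝ ∞ φ) (c : ℝ) (z : ℂ) :
    ddb (fun z => c * φ z) z = c * ddb φ z := by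
  have h1 := ofReal_contDiff hφ
  unfold ddb
  have : dzb (fun z => ((c * φ z : ℝ) : ℂ)) =
      fun z => (c : ℂ) * dzb (fun z => (φ z : ℂ)) z := by
    ext z
    push_cast
    exact dzb_const_mul _ (h1.differentiable (by simp) z)
  rw [this, dz_const_mul _ ((contDiff_dzb h1).differentiable (by simp) z)]
  simp

lemma contDiff_log_norm_sq_add {a : ℝ} (ha : 0 < a) :
    ContDiff ℝ ∞ (fun z : ℂ => Real.log (‖z‖ ^ 2 + a)) :=
  ((contDiff_norm_sq ℝ).add contDiff_const).log (fun z => by positivity)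

lemma ddb_log_norm_sq_add {a : ℝ} (ha : 0 < a) (z : ℂ) :
    ddb (fun z : ℂ => Real.log (‖z‖ ^ 2 + a)) z = a / (‖z‖ ^ 2 + a) ^ 2 := by
  have h1 : ∀ t : ℝ, 0 ≤ t → HasDerivAt (fun t => Real.log (t + a)) ((fun t => (t + a)⁻¹) t) t := by
    intro t ht
    have := ((hasDerivAt_id t).add_const a).log (by simp; positivity)
    simpa using this
  have h2 : ∀ t : ℝ, 0 ≤ t →
      HasDerivAt (fun t : ℝ => (t + a)⁻¹) ((fun t => - ((t + a) ^ 2)⁻¹) t) t := by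
    intro t ht
    have := ((hasDerivAt_id t).add_const a).inv (by simp; positivity)
    simp only [id] at this
    exact this.congr_deriv (by rw [neg_div, one_div])
  rw [ddb_comp_norm_sq h1 h2]
  field_simp
  ring

lemma point_estimate_algebra {a s x b p e w q : ℝ} (ha0 : 0 < a) (hs_def : s = x ^ 2 + a)
    (ha1 : a ≤ 1)
    (hs : 0 < s) (hb : 0 ≤ b) (hp : 0 ≤ p) (_hx : 0 ≤ x) (he : 0 < e) (h1 : 1 ≤ w)
    (h2 : w ≤ 1 + 1 / s) (hφ0 : 0 ≤ q) :
    a / s ^ 2 * (b ^ 2 * e) - 2 * ((2 + x ^ 2) ^ 3 * p ^ 2 * e) ≤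
      b ^ 2 * (e * (1 + s) ^ 2) * (w * (q + 2 * ((1 + a) / (1 + s) ^ 2)) -
        ((1 + a) / (1 + s) ^ 2 - a / s ^ 2)) -
      (w * (e * (1 + s) ^ 2) * (x * p) ^ 2 +
        2 * (e * (1 + s) ^ 2 * b * (x / (s * (1 + s))) * (x * p))) := by
  have hxs : x ^ 2 ≤ s := by linarith
  have hsx : 1 + s ≤ 2 + x ^ 2 := by linarith
  have f1 : (0 : ℝ) ≤ a / s ^ 2 := by positivity
  have f2 : (1 : ℝ) / (1 + s) ^ 2 ≤ (1 + a) / (1 + s) ^ 2 := by gcongr; linarith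
  have k1 : a / s ^ 2 + 1 / (1 + s) ^ 2 ≤ w * (q + 2 * ((1 + a) / (1 + s) ^ 2)) -
      ((1 + a) / (1 + s) ^ 2 - a / s ^ 2) := by
    have : 0 ≤ w * q := mul_nonneg (by linarith) hφ0
    have : 0 ≤ (w - 1) * (2 * ((1 + a) / (1 + s) ^ 2)) :=
      mul_nonneg (by linarith) (by positivity)
    nlinarith
  have k1' := mul_le_mul_of_nonneg_left k1
    (show 0 ≤ b ^ 2 * (e * (1 + s) ^ 2) by positivity)
  have k2 : w * (e * (1 + s) ^ 2) * (x * p) ^ 2 ≤ e * p ^ 2 * (1 + s) ^ 3 := by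
    calc w * (e * (1 + s) ^ 2) * (x * p) ^ 2
        ≤ (1 + 1 / s) * (e * (1 + s) ^ 2) * (x * p) ^ 2 := by gcongr
      _ = e * p ^ 2 * (1 + s) ^ 3 * (x ^ 2 / s) := by field_simp; ring
      _ ≤ e * p ^ 2 * (1 + s) ^ 3 * 1 := by
          gcongr
          rw [div_le_one hs]; exact hxs
      _ = _ := by ring
  have k3 : 2 * (e * (1 + s) ^ 2 * b * (x / (s * (1 + s))) * (x * p)) ≤
      b ^ 2 * e + e * p ^ 2 * (1 + s) ^ 2 := by
    have g1 : x ^ 2 / s ≤ 1 := by rw [div_le_one hs]; exact hxs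
    calc 2 * (e * (1 + s) ^ 2 * b * (x / (s * (1 + s))) * (x * p))
        = 2 * e * b * p * (1 + s) * (x ^ 2 / s) := by field_simp
      _ ≤ 2 * e * b * p * (1 + s) * 1 := by gcongr
      _ ≤ _ := by nlinarith [mul_nonneg he.le (sq_nonneg (b - p * (1 + s)))]
  have k4 : e * p ^ 2 * (1 + s) ^ 2 ≤ e * p ^ 2 * (1 + s) ^ 3 := by
    gcongr
    · linarith
    · norm_num
  have k5 : e * p ^ 2 * (1 + s) ^ 3 ≤ e * p ^ 2 * (2 + x ^ 2) ^ 3 := by gcongr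
  have k6 : b ^ 2 * (e * (1 + s) ^ 2) * (a / s ^ 2 + 1 / (1 + s) ^ 2) =
      a / s ^ 2 * (b ^ 2 * e) * (1 + s) ^ 2 + b ^ 2 * e := by field_simp
  have k7 : a / s ^ 2 * (b ^ 2 * e) * 1 ≤ a / s ^ 2 * (b ^ 2 * e) * (1 + s) ^ 2 := by
    gcongr
    nlinarith
  linarith

set_option maxHeartbeats 1000000 in
lemma point_estimate_aux {φ : ℂ → ℝ} {β Ψ : ℂ → ℂ} (hφ : ContDiff ℝ ∞ φ) (hsub : ∀ z, 0 ≤ ddb φ z)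
    (hβ : ContDiff ℝ ∞ β) (hc : HasCompactSupport β) (hΨ : Continuous Ψ)
    (hcΨ : HasCompactSupport Ψ) (hβΨ : ∀ z, dzb β z = z * Ψ z) {δ : ℝ} (hδ : 0 < δ) (hδ1 : δ ≤ 1) :
    ∫ z, δ ^ 2 / (‖z‖ ^ 2 + δ ^ 2) ^ 2 * (‖β z‖ ^ 2 * Real.exp (φ z)) ≤
      2 * ∫ z, (2 + ‖z‖ ^ 2) ^ 3 * ‖Ψ z‖ ^ 2 * Real.exp (φ z) := by
  set a := δ ^ 2 with ha
  have ha0 : 0 < a := by positivity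
  have ha1 : a ≤ 1 := by rw [ha]; nlinarith
  set L1 : ℂ → ℝ := fun z => Real.log (‖z‖ ^ 2 + (1 + a)) with hL1
  set L0 : ℂ → ℝ := fun z => Real.log (‖z‖ ^ 2 + a) with hL0
  have s1 : ContDiff ℝ ∞ L1 := contDiff_log_norm_sq_add (by positivity)
  have s0 : ContDiff ℝ ∞ L0 := contDiff_log_norm_sq_add (by positivity)
  set w : ℂ → ℝ := fun z => 1 + (L1 z + (-1) * L0 z) with hw
  set Φ : ℂ → ℝ := fun z => φ z + 2 * L1 z with hΦ
  have sneg : ContDiff ℝ ∞ (fun z => (-1) * L0 z) := contDiff_const.mul s0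
  have sdiff : ContDiff ℝ ∞ (fun z => L1 z + (-1) * L0 z) := s1.add sneg
  have sw : ContDiff ℝ ∞ w := contDiff_const.add sdiff
  have s2 : ContDiff ℝ ∞ (fun z => 2 * L1 z) := contDiff_const.mul s1
  have sΦ : ContDiff ℝ ∞ Φ := hφ.add s2
  have hsp : ∀ z : ℂ, 0 < ‖z‖ ^ 2 + a := fun z => by positivity
  have dw : ∀ z, ddb w z = (1 + a) / (‖z‖ ^ 2 + (1 + a)) ^ 2 - a / (‖z‖ ^ 2 + a) ^ 2 := by
    intro z
    rw [hw, ddb_add contDiff_const sdiff, ddb_add s1 sneg, ddb_const_mul s0, hL1, hL0,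
      ddb_log_norm_sq_add (by positivity), ddb_log_norm_sq_add (by positivity)]
    have : ddb (fun _ => (1 : ℝ)) z = 0 := by
      unfold ddb
      have : dzb (fun _ => ((1 : ℝ) : ℂ)) = fun _ => 0 := by ext z; exact dzb_const _
      rw [this, dz_const]; simp
    rw [this]; ring
  have dΦ : ∀ z, ddb Φ z = ddb φ z + 2 * ((1 + a) / (‖z‖ ^ 2 + (1 + a)) ^ 2) := by
    intro z
    rw [hΦ, ddb_add hφ s2, ddb_const_mul s1, hL1, ddb_log_norm_sq_add (by positivity)]
  have hw_eq : ∀ z, w z = 1 + Real.log (1 + 1 / (‖z‖ ^ 2 + a)) := by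
    intro z
    have := hsp z
    simp only [hw, hL1, hL0]
    rw [show 1 + 1 / (‖z‖ ^ 2 + a) = (‖z‖ ^ 2 + (1 + a)) / (‖z‖ ^ 2 + a) by field_simp; ring,
      Real.log_div (by positivity) (by positivity)]
    ring
  have hw1 : ∀ z, 1 ≤ w z := by
    intro z
    rw [hw_eq]
    have := Real.log_nonneg (x := 1 + 1 / (‖z‖ ^ 2 + a)) (by have := hsp z; simp; positivity)
    linarith
  have hw2 : ∀ z, w z ≤ 1 + 1 / (‖z‖ ^ 2 + a) := by
    intro z
    rw [hw_eq]
    have := Real.log_le_sub_one_of_pos (x := 1 + 1 / (‖z‖ ^ 2 + a))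
      (by have := hsp z; positivity)
    linarith
  have hdz : ∀ z, ‖dz (fun z => (w z : ℂ)) z‖ =
      ‖z‖ / ((‖z‖ ^ 2 + a) * (‖z‖ ^ 2 + (1 + a))) := by
    intro z
    have h := hsp z
    have hd : HasDerivAt (fun t : ℝ => 1 + (Real.log (t + (1 + a)) + (-1) * Real.log (t + a)))
        (- (1 / ((‖z‖ ^ 2 + a) * (‖z‖ ^ 2 + (1 + a))))) (‖z‖ ^ 2) := by
      have e1 := ((hasDerivAt_id (‖z‖ ^ 2)).add_const (1 + a)).log (by simp; positivity)
      have e2 := ((hasDerivAt_id (‖z‖ ^ 2)).add_const a).log (by simp; positivity)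
      have := (e1.add (e2.const_mul (-1))).const_add 1
      simp only [id] at this
      exact this.congr_deriv (by field_simp; ring)
    have := dz_comp_norm_sq hd
    rw [show dz (fun z => (w z : ℂ)) z = _ from this, norm_mul]
    simp only [RCLike.norm_conj, Complex.norm_real, norm_neg, Real.norm_eq_abs]
    rw [abs_of_pos (by positivity)]
    field_simp
  have key := energy_integral hβ hc sw sΦ (fun z => zero_le_one.trans (hw1 z))
  have hexp : ∀ z, Real.exp (Φ z) = Real.exp (φ z) * (‖z‖ ^ 2 + (1 + a)) ^ 2 := by
    intro z
    simp only [hΦ, hL1]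
    rw [Real.exp_add, two_mul, Real.exp_add, Real.exp_log (by positivity)]; ring
  have cΦ := sΦ.continuous
  have cφ := hφ.continuous
  have cw := sw.continuous
  have cβ := hβ.continuous
  have cdb := (contDiff_dzb hβ).continuous
  have cdw := (contDiff_dz (ofReal_contDiff sw)).continuous
  have cddw := continuous_ddb sw
  have cddΦ := continuous_ddb sΦ
  have hcβ2 : HasCompactSupport (fun z => ‖β z‖ ^ 2) :=
    hc.comp_left (g := fun x : ℂ => ‖x‖ ^ 2) (by simp)
  have cs : Continuous (fun z : ℂ => a / (‖z‖ ^ 2 + a) ^ 2) :=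
    continuous_const.div (by fun_prop) (fun z => by have := hsp z; positivity)
  have step : ∫ z, (a / (‖z‖ ^ 2 + a) ^ 2 * (‖β z‖ ^ 2 * Real.exp (φ z))
      - 2 * ((2 + ‖z‖ ^ 2) ^ 3 * ‖Ψ z‖ ^ 2 * Real.exp (φ z))) ≤
      ∫ z, (‖β z‖ ^ 2 * Real.exp (Φ z) * (w z * ddb Φ z - ddb w z) -
      (w z * Real.exp (Φ z) * ‖dzb β z‖ ^ 2 +
        2 * (Real.exp (Φ z) * ‖β z‖ * ‖dz (fun z => (w z : ℂ)) z‖ * ‖dzb β z‖))) := by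
    apply integral_mono
    · apply Continuous.integrable_of_hasCompactSupport
      · fun_prop
      · apply HasCompactSupport.sub
        · exact hcβ2.mul_right.mul_left
        · apply HasCompactSupport.mul_left; apply HasCompactSupport.mul_right
          apply HasCompactSupport.mul_left
          exact hcΨ.comp_left (g := fun x : ℂ => ‖x‖ ^ 2) (by simp)
    · apply Continuous.integrable_of_hasCompactSupport
      · fun_prop
      · apply HasCompactSupport.sub
        · exact hcβ2.mul_right.mul_right
        · apply HasCompactSupport.add
          · apply HasCompactSupport.mul_left
            exact (dzb_hasCompactSupport hc).comp_left (g := fun x : ℂ => ‖x‖ ^ 2) (by simp)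
          · apply HasCompactSupport.mul_left; apply HasCompactSupport.mul_left
            exact (dzb_hasCompactSupport hc).comp_left (g := fun x : ℂ => ‖x‖) (by simp)
    · intro z
      simp only
      rw [hexp, hdz, dw, dΦ, hβΨ, norm_mul]
      have hs := hsp z
      have hφ0 := hsub z
      have h1 := hw1 z
      have h2 := hw2 z
      set s := ‖z‖ ^ 2 + a with hs_def
      have hs' : ‖z‖ ^ 2 + (1 + a) = 1 + s := by rw [hs_def]; ring
      rw [hs']
      exact point_estimate_algebra ha0 hs_def ha1 hs (norm_nonneg _) (norm_nonneg _)
        (norm_nonneg _) (Real.exp_pos _) h1 h2 hφ0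
  have I1 : Integrable fun z => a / (‖z‖ ^ 2 + a) ^ 2 * (‖β z‖ ^ 2 * Real.exp (φ z)) := by
    apply Continuous.integrable_of_hasCompactSupport
    · fun_prop
    · exact hcβ2.mul_right.mul_left
  have I2 : Integrable fun z => 2 * ((2 + ‖z‖ ^ 2) ^ 3 * ‖Ψ z‖ ^ 2 * Real.exp (φ z)) := by
    apply Continuous.integrable_of_hasCompactSupport
    · fun_prop
    · apply HasCompactSupport.mul_left; apply HasCompactSupport.mul_right
      apply HasCompactSupport.mul_left
      exact hcΨ.comp_left (g := fun x : ℂ => ‖x‖ ^ 2) (by simp)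
  have I3 : Integrable fun z => ‖β z‖ ^ 2 * Real.exp (Φ z) * (w z * ddb Φ z - ddb w z) := by
    apply Continuous.integrable_of_hasCompactSupport
    · fun_prop
    · exact hcβ2.mul_right.mul_right
  have I4 : Integrable fun z => (w z * Real.exp (Φ z) * ‖dzb β z‖ ^ 2 +
        2 * (Real.exp (Φ z) * ‖β z‖ * ‖dz (fun z => (w z : ℂ)) z‖ * ‖dzb β z‖)) := by
    apply Continuous.integrable_of_hasCompactSupport
    · fun_prop
    · apply HasCompactSupport.add
      · apply HasCompactSupport.mul_left
        exact (dzb_hasCompactSupport hc).comp_left (g := fun x : ℂ => ‖x‖ ^ 2) (by simp)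
      · apply HasCompactSupport.mul_left; apply HasCompactSupport.mul_left
        exact (dzb_hasCompactSupport hc).comp_left (g := fun x : ℂ => ‖x‖) (by simp)
  rw [integral_sub I1 I2, integral_sub I3 I4, integral_const_mul] at step
  linarith

/-- A pointwise Ohsawa–Takegoshi type inequality in dual form. -/
lemma point_estimate {φ : ℂ → ℝ} {β Ψ : ℂ → ℂ} (hφ : ContDiff ℝ ∞ φ) (hsub : ∀ z, 0 ≤ ddb φ z)
    (hβ : ContDiff ℝ ∞ β) (hc : HasCompactSupport β) (hΨ : Continuous Ψ)
    (hcΨ : HasCompactSupport Ψ) (hβΨ : ∀ z, dzb β z = z * Ψ z) :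
    ‖β 0‖ ^ 2 * Real.exp (φ 0) ≤
      3 * ∫ z, (2 + ‖z‖ ^ 2) ^ 3 * ‖Ψ z‖ ^ 2 * Real.exp (φ z) := by
  set J := ∫ z, (2 + ‖z‖ ^ 2) ^ 3 * ‖Ψ z‖ ^ 2 * Real.exp (φ z) with hJ
  have hJ0 : 0 ≤ J := integral_nonneg fun z => by positivity
  have cφ := hφ.continuous
  have cβ := hβ.continuous
  have cont : Continuous fun z => ‖β z‖ ^ 2 * Real.exp (φ z) := by fun_prop
  refine le_of_forall_lt_imp_le_of_dense fun v hv => ?_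
  rcases lt_or_ge v 0 with hv0 | hv0
  · linarith
  obtain ⟨ε, hε, hball⟩ := Metric.eventually_nhds_iff_ball.1
    (cont.continuousAt.eventually_const_lt hv)
  set δ := min ε 1 with hδdef
  have hδ : 0 < δ := lt_min hε one_pos
  have h := point_estimate_aux hφ hsub hβ hc hΨ hcΨ hβΨ hδ (min_le_right _ _)
  have hlow : Real.pi / 4 * v ≤
      ∫ z, δ ^ 2 / (‖z‖ ^ 2 + δ ^ 2) ^ 2 * (‖β z‖ ^ 2 * Real.exp (φ z)) := by
    have hcs : HasCompactSupport fun z =>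
        δ ^ 2 / (‖z‖ ^ 2 + δ ^ 2) ^ 2 * (‖β z‖ ^ 2 * Real.exp (φ z)) := by
      apply HasCompactSupport.mul_left; apply HasCompactSupport.mul_right
      exact hc.comp_left (g := fun x : ℂ => ‖x‖ ^ 2) (by simp)
    have hcont : Continuous fun z =>
        δ ^ 2 / (‖z‖ ^ 2 + δ ^ 2) ^ 2 * (‖β z‖ ^ 2 * Real.exp (φ z)) :=
      (continuous_const.div (by fun_prop) (fun z => by positivity)).mul cont
    have hI := hcont.integrable_of_hasCompactSupport (μ := volume) hcs
    have h1 : ∫ z in ball (0 : ℂ) δ, (1 / (4 * δ ^ 2) * v) ≤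
        ∫ z in ball (0 : ℂ) δ, δ ^ 2 / (‖z‖ ^ 2 + δ ^ 2) ^ 2 * (‖β z‖ ^ 2 * Real.exp (φ z)) := by
      refine setIntegral_mono_on (integrableOn_const measure_ball_lt_top.ne) hI.integrableOn
        measurableSet_ball fun z hz => ?_
      have hz' : ‖z‖ < δ := by simpa using hz
      have hzε := hball z (ball_subset_ball (min_le_left _ _) hz)
      refine mul_le_mul ?_ hzε.le hv0 (by positivity)
      rw [div_le_div_iff₀ (by positivity) (by positivity)]
      have : ‖z‖ ^ 2 ≤ δ ^ 2 := by gcongr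
      have : (‖z‖ ^ 2 + δ ^ 2) ^ 2 ≤ (2 * δ ^ 2) ^ 2 := by gcongr; linarith
      nlinarith
    have h2 := setIntegral_le_integral (μ := volume) (s := ball (0 : ℂ) δ) hI
      (ae_of_all _ fun z => by positivity)
    have h3 : ∫ z in ball (0 : ℂ) δ, (1 / (4 * δ ^ 2) * v) = Real.pi / 4 * v := by
      rw [setIntegral_const, measureReal_def, Complex.volume_ball]
      simp
      rw [ENNReal.toReal_ofReal hδ.le]
      field_simp
    linarith
  have := Real.pi_gt_three
  nlinarith

end PointEstimate

noncomputable section Submean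

lemma ddb_eq_trace {f : ℂ → ℝ} (hf : ContDiff ℝ ∞ f) (z : ℂ) :
    ddb f z = (fderiv ℝ (fderiv ℝ f) z 1 1 +
      fderiv ℝ (fderiv ℝ f) z Complex.I Complex.I) / 4 := by
  have h := hf.fderiv_right (m := ∞) (by simp)
  have h2 : ∀ v, HasFDerivAt (fun z => fderiv ℝ f z v)
      ((fderiv ℝ (fderiv ℝ f) z).flip v) z := by
    intro v
    have := (h.differentiable (by simp) z).hasFDerivAt.clm_apply (hasFDerivAt_const v z)
    refine this.congr_fderiv ?_
    ext u; simp
  have e0 : ∀ z v, fderiv ℝ (fun z => (f z : ℂ)) z v = (fderiv ℝ f z v : ℂ) := by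
    intro z v
    have : HasFDerivAt (fun z => (f z : ℂ)) _ z :=
      Complex.ofRealCLM.hasFDerivAt.comp z (hf.differentiable (by simp) z).hasFDerivAt
    rw [this.fderiv]; simp
  have e1 : dzb (fun z => (f z : ℂ)) =
      fun z => ((fderiv ℝ f z 1 : ℂ) + Complex.I * (fderiv ℝ f z Complex.I : ℂ)) * 2⁻¹ := by
    ext z
    simp only [dzb, e0, div_eq_mul_inv]
  have e2 : ∀ v, HasFDerivAt (fun z => (fderiv ℝ f z v : ℂ))
      (Complex.ofRealCLM.comp ((fderiv ℝ (fderiv ℝ f) z).flip v)) z :=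
    fun v => Complex.ofRealCLM.hasFDerivAt.comp z (h2 v)
  have e3 : HasFDerivAt (fun z => ((fderiv ℝ f z 1 : ℂ) +
      Complex.I * (fderiv ℝ f z Complex.I : ℂ)) * (2⁻¹ : ℂ)) _ z :=
    ((e2 1).add ((e2 Complex.I).const_mul Complex.I)).mul_const (2⁻¹ : ℂ)
  have e3' := e1 ▸ e3
  unfold ddb
  rw [dz, e3'.fderiv]
  simp
  ring

lemma taylor_second_order {f : ℂ → ℝ} (hf : ContDiff ℝ ∞ f) (z : ℂ) {ε : ℝ} (hε : 0 < ε) :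
    ∃ δ > 0, ∀ v : ℂ, ‖v‖ < δ → |f (z + v) - f z - fderiv ℝ f z v -
      2⁻¹ * fderiv ℝ (fderiv ℝ f) z v v| ≤ ε * ‖v‖ ^ 2 := by
  have h := hf.fderiv_right (m := ∞) (by simp)
  have hd := (h.differentiable (by simp) z).hasFDerivAt
  set H := fderiv ℝ (fderiv ℝ f) z with hH
  have hs : IsSymmSndFDerivAt ℝ f z :=
    hf.contDiffAt.isSymmSndFDerivAt (by
      simp only [minSmoothness_of_isRCLikeNormedField]
      exact WithTop.coe_le_coe.2 (le_top : (2 : ℕ∞) ≤ ⊤))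
  rw [hasFDerivAt_iff_isLittleO_nhds_zero] at hd
  have hb := Asymptotics.isLittleO_iff.1 hd hε
  obtain ⟨δ, hδ, hball⟩ := Metric.eventually_nhds_iff_ball.1 hb
  refine ⟨δ, hδ, fun v hv => ?_⟩
  have hD : ∀ x, HasFDerivAt (fun v => f (z + v) - f z - fderiv ℝ f z v - 2⁻¹ * H v v)
      (fderiv ℝ f (z + x) - fderiv ℝ f z - H x) x := by
    intro x
    have h1 : HasFDerivAt (fun v => f (z + v)) (fderiv ℝ f (z + x)) x := by
      exact (hf.differentiable (by simp) (z + x)).hasFDerivAt.comp x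
        ((hasFDerivAt_id x).const_add z)
    have h2 : HasFDerivAt (fun v => H v v) _ x :=
      (H.hasFDerivAt (x := x)).clm_apply (hasFDerivAt_id x)
    refine (((h1.sub_const (f z)).sub (fderiv ℝ f z).hasFDerivAt).sub
      (h2.const_mul 2⁻¹)).congr_fderiv ?_
    ext u
    have := hs.eq x u
    simp [← hH] at this ⊢
    rw [this]; ring
  have hconv := (convex_closedBall (0 : ℂ) ‖v‖).norm_image_sub_le_of_norm_hasFDerivWithin_le
    (f := fun v => f (z + v) - f z - fderiv ℝ f z v - 2⁻¹ * H v v)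
    (f' := fun x => fderiv ℝ f (z + x) - fderiv ℝ f z - H x) (C := ε * ‖v‖)
    (fun x _ => (hD x).hasFDerivWithinAt) (x := 0) (y := v)
    (by
      intro x hx
      have hx' : ‖x‖ ≤ ‖v‖ := by simpa using hx
      refine (hball x (by simpa using hx'.trans_lt hv)).trans ?_
      gcongr) (by simp) (by simp)
  simpa [sq, mul_assoc] using hconv

open Real in
lemma ddb_nonneg_of_submean {f : ℂ → ℝ} (hf : ContDiff ℝ ∞ f) (z : ℂ)
    {t₀ : ℝ} (ht₀ : 0 < t₀) (hm : ∀ t : ℝ, 0 < t → t < t₀ →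
      f z * (2 * π) ≤ ∫ θ in (0 : ℝ)..2 * π, f (z + t * Complex.exp (θ * Complex.I))) :
    0 ≤ ddb f z := by
  rw [ddb_eq_trace hf]
  set H := fderiv ℝ (fderiv ℝ f) z with hH
  set D := fderiv ℝ f z with hD
  refine div_nonneg ?_ (by norm_num)
  refine le_of_forall_pos_le_add fun ε hε => ?_
  obtain ⟨δ, hδ, hT⟩ := taylor_second_order hf z (ε := ε / 4) (by positivity)
  set t := min δ t₀ / 2 with ht
  have hm0 : 0 < min δ t₀ := lt_min hδ ht₀
  have htδ : min δ t₀ ≤ δ := min_le_left _ _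
  have htt : min δ t₀ ≤ t₀ := min_le_right _ _
  have ht0 : 0 < t := by positivity
  have key := hm t ht0 (by rw [ht]; linarith)
  have hv : ∀ θ : ℝ, (t : ℂ) * Complex.exp (θ * Complex.I) =
      (t * cos θ) • (1 : ℂ) + (t * sin θ) • Complex.I := by
    intro θ
    rw [Complex.exp_mul_I]
    simp
    ring
  have hb : ∀ θ : ℝ, f (z + t * Complex.exp (θ * Complex.I)) ≤
      f z + t * cos θ * D 1 + t * sin θ * D Complex.I
        + t ^ 2 / 2 * (cos θ ^ 2 * H 1 1 + sin θ * cos θ * (H 1 Complex.I + H Complex.I 1) +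
          sin θ ^ 2 * H Complex.I Complex.I) + ε / 4 * t ^ 2 := by
    intro θ
    have hn : ‖(t : ℂ) * Complex.exp (θ * Complex.I)‖ = t := by
      rw [norm_mul, Complex.norm_exp_ofReal_mul_I]; simp [abs_of_pos ht0]
    have := (abs_le.1 (hT ((t : ℂ) * Complex.exp (θ * Complex.I))
      (by rw [hn, ht]; linarith))).2
    rw [hn] at this
    have e1 : D ((t : ℂ) * Complex.exp (θ * Complex.I)) =
        t * cos θ * D 1 + t * sin θ * D Complex.I := by
      rw [hv, map_add, map_smul, map_smul]; simp
    have e2 : H ((t : ℂ) * Complex.exp (θ * Complex.I)) ((t : ℂ) * Complex.exp (θ * Complex.I)) =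
        t ^ 2 * (cos θ ^ 2 * H 1 1 + sin θ * cos θ * (H 1 Complex.I + H Complex.I 1) +
          sin θ ^ 2 * H Complex.I Complex.I) := by
      rw [hv, map_add, map_smul, map_smul]
      simp only [add_apply, smul_apply, map_add, map_smul,
        smul_eq_mul]
      ring
    rw [e1, e2] at this
    linarith
  have hi := intervalIntegral.integral_mono_on (a := 0) (b := 2 * π) (μ := volume)
    (by positivity)
    (f := fun θ : ℝ => f (z + t * Complex.exp (θ * Complex.I)))
    (by apply Continuous.intervalIntegrable; have := hf.continuous; fun_prop)
    (by apply Continuous.intervalIntegrable; fun_prop) (fun θ _ => hb θ)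
  have hval : ∫ θ in (0 : ℝ)..2 * π, (f z + t * cos θ * D 1 + t * sin θ * D Complex.I
        + t ^ 2 / 2 * (cos θ ^ 2 * H 1 1 + sin θ * cos θ * (H 1 Complex.I + H Complex.I 1) +
          sin θ ^ 2 * H Complex.I Complex.I) + ε / 4 * t ^ 2) =
      f z * (2 * π) + t ^ 2 / 2 * π * (H 1 1 + H Complex.I Complex.I) +
        ε / 4 * t ^ 2 * (2 * π) := by
    have ii : ∀ {g : ℝ → ℝ}, Continuous g → IntervalIntegrable g volume 0 (2 * π) :=
      fun hg => hg.intervalIntegrable _ _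
    rw [intervalIntegral.integral_add (ii (by fun_prop)) (ii (by fun_prop)),
      intervalIntegral.integral_add (ii (by fun_prop)) (ii (by fun_prop)),
      intervalIntegral.integral_add (ii (by fun_prop)) (ii (by fun_prop)),
      intervalIntegral.integral_add (ii (by fun_prop)) (ii (by fun_prop)),
      intervalIntegral.integral_const_mul,
      intervalIntegral.integral_add (ii (by fun_prop)) (ii (by fun_prop)),
      intervalIntegral.integral_add (ii (by fun_prop)) (ii (by fun_prop))]
    simp only [intervalIntegral.integral_mul_const, intervalIntegral.integral_const_mul,
      integral_cos, integral_sin, integral_cos_sq, integral_sin_sq, integral_sin_mul_cos₁]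
    simp
    ring
  rw [hval] at hi
  have h3 : 0 ≤ t ^ 2 / 2 * π * (H 1 1 + H Complex.I Complex.I + ε) := by
    have := key.trans hi
    nlinarith
  have h4 : 0 < t ^ 2 / 2 * π := by positivity
  exact nonneg_of_mul_nonneg_right h3 h4

end Submean

noncomputable section Regularization

open Real

/-- A real function on `ℂ` that is invariant under rotations about the origin. -/
def IsRadial (g : ℂ → ℝ) : Prop := ∀ u z : ℂ, ‖u‖ = 1 → g (u * z) = g z

variable {E : Type*} [NormedAddCommGroup E]

lemma integrable_circle_prod {F : ℝ → ℂ → E}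
    (hF : StronglyMeasurable (Function.uncurry F)) {B R : ℝ} (hB : ∀ θ z, ‖F θ z‖ ≤ B)
    (hR : ∀ θ z, R < ‖z‖ → F θ z = 0) (a b : ℝ) :
    Integrable (Function.uncurry F) ((volume.restrict (Set.uIoc a b)).prod volume) := by
  have h1 : (volume.restrict (Set.uIoc a b)).prod (volume : Measure ℂ) =
      (volume.prod volume).restrict (Set.uIoc a b ×ˢ univ) := by
    rw [← Measure.prod_restrict, Measure.restrict_univ]
  have h2 : IntegrableOn (Function.uncurry F) (Set.uIoc a b ×ˢ closedBall (0 : ℂ) R)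
      (volume.prod volume) := by
    refine Measure.integrableOn_of_bounded (M := B) ?_ hF.aestronglyMeasurable ?_
    · rw [Measure.prod_prod]
      exact (ENNReal.mul_lt_top (by simp [Set.uIoc]) measure_closedBall_lt_top).ne
    · exact ae_of_all _ fun p => hB p.1 p.2
  rw [h1]
  refine h2.of_forall_sdiff_eq_zero (measurableSet_uIoc.prod MeasurableSet.univ) fun p hp => ?_
  apply hR
  by_contra! hcon
  exact hp.2 ⟨hp.1.1, by simpa using hcon⟩

lemma integrable_of_bounded_of_support {F : ℂ → E} (hF : AEStronglyMeasurable F) {B R : ℝ}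
    (hB : ∀ z, ‖F z‖ ≤ B) (hR : ∀ z, R < ‖z‖ → F z = 0) : Integrable F := by
  have h2 : IntegrableOn F (closedBall (0 : ℂ) R) := by
    refine Measure.integrableOn_of_bounded (M := B) measure_closedBall_lt_top.ne hF ?_
    exact ae_of_all _ hB
  rw [← integrableOn_univ]
  refine h2.of_forall_sdiff_eq_zero MeasurableSet.univ fun p hp => hR _ ?_
  simpa using hp.2

variable [NormedSpace ℝ E]

lemma integral_rotate (f : ℂ → E) {u : ℂ} (hu : ‖u‖ = 1) : ∫ z, f (u * z) = ∫ z, f z := by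
  let a : Circle := ⟨u, by simpa [Submonoid.unitSphere] using hu⟩
  have h := (rotation a).measurePreserving
  have := h.integral_comp (rotation a).toHomeomorph.measurableEmbedding f
  exact this

lemma norm_circle (θ : ℝ) : ‖Complex.exp (θ * Complex.I)‖ = 1 := Complex.norm_exp_ofReal_mul_I θ

lemma integral_radial_smul [CompleteSpace E] {g : ℂ → ℝ} (hg : IsRadial g) (hgm : Measurable g)
    {f : ℂ → E} (hf : StronglyMeasurable f) {B R : ℝ} (hB : ∀ z, ‖g z • f z‖ ≤ B)
    (hR : ∀ z, R < ‖z‖ → g z = 0) :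
    (2 * π) • ∫ z, g z • f z = ∫ z, g z • ∫ θ in (0 : ℝ)..2 * π, f (Complex.exp (θ * Complex.I) * z) ∧
    Integrable (fun z => g z • ∫ θ in (0 : ℝ)..2 * π, f (Complex.exp (θ * Complex.I) * z)) := by
  have hcont : Continuous fun p : ℝ × ℂ => Complex.exp (p.1 * Complex.I) * p.2 := by fun_prop
  have hsm : StronglyMeasurable (Function.uncurry fun (θ : ℝ) (z : ℂ) =>
      g z • f (Complex.exp (θ * Complex.I) * z)) :=
    (hgm.stronglyMeasurable.comp_measurable measurable_snd).smul
      (hf.comp_measurable hcont.measurable)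
  have hI := integrable_circle_prod hsm (B := B) (R := R)
    (fun θ z => by rw [← hg _ z (norm_circle θ)]; exact hB _)
    (fun θ z hz => by rw [hR z hz, zero_smul]) 0 (2 * π)
  have hsw := intervalIntegral_integral_swap hI
  have e1 : ∀ θ : ℝ, ∫ z, g z • f (Complex.exp (θ * Complex.I) * z) = ∫ z, g z • f z := by
    intro θ
    rw [← integral_rotate (fun z => g z • f z) (norm_circle θ)]
    simp only [hg _ _ (norm_circle θ)]
  simp only [e1, intervalIntegral.integral_const, sub_zero, intervalIntegral.integral_smul] at hsw
  refine ⟨hsw, ?_⟩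
  have := hI.integral_prod_right
  simp only [Function.uncurry] at this
  simp only [← intervalIntegral.integral_smul]
  simpa [intervalIntegral.integral_of_le (show (0 : ℝ) ≤ 2 * π by positivity),
    Set.uIoc_of_le (show (0 : ℝ) ≤ 2 * π by positivity)] using this

lemma radial_submean {g : ℂ → ℝ} (hg : IsRadial g) (hgc : Continuous g) (hg0 : ∀ z, 0 ≤ g z)
    {f : ℂ → ℝ} (hf : StronglyMeasurable f) {B R : ℝ} (hR0 : 0 ≤ R) (hB : ∀ z, ‖z‖ ≤ R → |f z| ≤ B)
    (hR : ∀ z, R < ‖z‖ → g z = 0) {m : ℝ}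
    (hm : ∀ z, m * (2 * π) ≤ ∫ θ in (0 : ℝ)..2 * π, f (Complex.exp (θ * Complex.I) * z)) :
    m * ∫ z, g z ≤ ∫ z, g z * f z := by
  obtain ⟨G, hG⟩ := (isCompact_closedBall (0 : ℂ) R).exists_bound_of_continuousOn hgc.continuousOn
  have hGB : ∀ z, ‖g z • f z‖ ≤ G * |B| := by
    intro z
    rcases le_or_gt ‖z‖ R with h | h
    · rw [norm_smul]
      have := hG z (by simpa using h)
      exact mul_le_mul this ((hB z h).trans (le_abs_self _)) (norm_nonneg _)
        ((norm_nonneg _).trans this)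
    · rw [hR z h, zero_smul, norm_zero]
      have := hG 0 (by simpa using hR0)
      exact mul_nonneg ((norm_nonneg _).trans this) (abs_nonneg _)
  obtain ⟨h1, h2⟩ := integral_radial_smul hg hgc.measurable hf hGB hR
  have hgi : Integrable g := hgc.integrable_of_hasCompactSupport
    (HasCompactSupport.intro (isCompact_closedBall (0 : ℂ) R) fun z hz => hR z (by simpa using hz))
  have h3 : ∫ z, g z * (m * (2 * π)) ≤
      ∫ z, g z • ∫ θ in (0 : ℝ)..2 * π, f (Complex.exp (θ * Complex.I) * z) :=
    integral_mono (hgi.mul_const _) h2 fun z => mul_le_mul_of_nonneg_left (hm z) (hg0 z)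
  rw [← h1, integral_mul_const] at h3
  simp only [smul_eq_mul] at h3
  have := Real.pi_pos
  nlinarith

/-- The properties of (real-valued) subharmonic functions bounded below that are used. -/
structure BddSubharmonic (r : ℂ → ℝ) : Prop where
  usc : UpperSemicontinuous r
  bdd : ∃ M : ℝ, ∀ z, M ≤ r z
  mean : ∀ c ζ : ℂ, r c * (2 * π) ≤
    ∫ θ in (0 : ℝ)..2 * π, r (c + Complex.exp (θ * Complex.I) * ζ)

namespace BddSubharmonic

variable {r : ℂ → ℝ}

lemma measurable (h : BddSubharmonic r) : Measurable r := h.usc.measurable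

lemma locBdd (h : BddSubharmonic r) (R : ℝ) : ∃ B : ℝ, ∀ z, ‖z‖ ≤ R → |r z| ≤ B := by
  obtain ⟨M, hM⟩ := h.bdd
  obtain ⟨B, hB⟩ := (h.usc.upperSemicontinuousOn (closedBall 0 R)).bddAbove_of_isCompact
    (isCompact_closedBall 0 R)
  refine ⟨max |M| |B|, fun z hz => abs_le.2 ⟨?_, ?_⟩⟩
  · have := hM z
    have := neg_abs_le M
    have := le_max_left |M| |B|
    linarith
  · have := hB (mem_image_of_mem r (show z ∈ closedBall (0 : ℂ) R by simpa using hz))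
    exact (this.trans (le_abs_self B)).trans (le_max_right _ _)

lemma locallyIntegrable (h : BddSubharmonic r) : LocallyIntegrable r := by
  rw [locallyIntegrable_iff]
  intro k hk
  obtain ⟨R, hR⟩ := hk.isBounded.subset_closedBall 0
  obtain ⟨B, hB⟩ := h.locBdd R
  refine IntegrableOn.mono_set ?_ hR
  refine Measure.integrableOn_of_bounded (M := B) measure_closedBall_lt_top.ne
    h.measurable.aestronglyMeasurable ?_
  filter_upwards [ae_restrict_mem measurableSet_closedBall] with z hz
  exact hB z (by simpa using hz)

lemma comp_add_left (h : BddSubharmonic r) (a : ℂ) : BddSubharmonic (fun z => r (a + z)) where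
  usc := fun z y hy => (continuous_const.add continuous_id).continuousAt.eventually
    (h.usc (a + z) y hy)
  bdd := by obtain ⟨M, hM⟩ := h.bdd; exact ⟨M, fun z => hM _⟩
  mean c ζ := by simpa [add_assoc] using h.mean (a + c) ζ

end BddSubharmonic

/-- An unnormalized radial bump function supported in the disc of radius `ε`. -/
def radialBump (ε : ℝ) (z : ℂ) : ℝ := Real.smoothTransition (1 - ‖z‖ ^ 2 / ε ^ 2)

/-- A radial mollifier supported in the disc of radius `ε`. -/
def mollifier (ε : ℝ) (z : ℂ) : ℝ := (∫ z, radialBump ε z)⁻¹ * radialBump ε z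

lemma contDiff_radialBump (ε : ℝ) : ContDiff ℝ ∞ (radialBump ε) :=
  Real.smoothTransition.contDiff.comp (contDiff_const.sub ((contDiff_norm_sq ℝ).div_const _))

lemma radialBump_eq_zero {ε : ℝ} (hε : 0 < ε) {z : ℂ} (hz : ε ≤ ‖z‖) : radialBump ε z = 0 := by
  apply Real.smoothTransition.zero_of_nonpos
  have : 1 ≤ ‖z‖ ^ 2 / ε ^ 2 := by
    rw [one_le_div (by positivity)]; gcongr
  linarith

lemma hasCompactSupport_radialBump {ε : ℝ} (hε : 0 < ε) : HasCompactSupport (radialBump ε) :=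
  HasCompactSupport.intro (isCompact_closedBall (0 : ℂ) ε) fun z hz =>
    radialBump_eq_zero hε (by simp at hz; exact hz.le)

lemma integral_radialBump_pos {ε : ℝ} (hε : 0 < ε) : 0 < ∫ z, radialBump ε z := by
  refine (contDiff_radialBump ε).continuous.integral_pos_of_hasCompactSupport_nonneg_nonzero
    (hasCompactSupport_radialBump hε) (fun z => Real.smoothTransition.nonneg _) (x := 0) ?_
  simp [radialBump]

lemma contDiff_mollifier (ε : ℝ) : ContDiff ℝ ∞ (mollifier ε) :=
  contDiff_const.mul (contDiff_radialBump ε)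

lemma mollifier_eq_zero {ε : ℝ} (hε : 0 < ε) {z : ℂ} (hz : ε ≤ ‖z‖) : mollifier ε z = 0 := by
  rw [mollifier, radialBump_eq_zero hε hz, mul_zero]

lemma hasCompactSupport_mollifier {ε : ℝ} (hε : 0 < ε) : HasCompactSupport (mollifier ε) :=
  (hasCompactSupport_radialBump hε).mul_left

lemma mollifier_nonneg {ε : ℝ} (hε : 0 < ε) (z : ℂ) : 0 ≤ mollifier ε z :=
  mul_nonneg (inv_nonneg.2 (integral_radialBump_pos hε).le) (Real.smoothTransition.nonneg _)

lemma integral_mollifier {ε : ℝ} (hε : 0 < ε) : ∫ z, mollifier ε z = 1 := by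
  unfold mollifier
  rw [integral_const_mul, inv_mul_cancel₀ (integral_radialBump_pos hε).ne']

lemma isRadial_mollifier (ε : ℝ) : IsRadial (mollifier ε) := by
  intro u z hu
  simp [mollifier, radialBump, hu]

lemma mollifier_neg (ε : ℝ) (z : ℂ) : mollifier ε (-z) = mollifier ε z := by
  simp [mollifier, radialBump]

lemma integrable_mollifier {ε : ℝ} (hε : 0 < ε) : Integrable (mollifier ε) :=
  (contDiff_mollifier ε).continuous.integrable_of_hasCompactSupport (hasCompactSupport_mollifier hε)

/-- Convolution with the radial mollifier. -/
def mollify (ε : ℝ) (f : ℂ → E) (z : ℂ) : E := ∫ ζ, mollifier ε ζ • f (z - ζ)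

lemma mollify_eq_convolution (ε : ℝ) (f : ℂ → E) :
    mollify ε f = convolution (mollifier ε) f (ContinuousLinearMap.lsmul ℝ ℝ) volume := by
  ext z; simp [mollify, convolution]

lemma contDiff_mollify [CompleteSpace E] {ε : ℝ} (hε : 0 < ε) {f : ℂ → E}
    (hf : LocallyIntegrable f) : ContDiff ℝ ∞ (mollify ε f) := by
  rw [mollify_eq_convolution]
  exact (hasCompactSupport_mollifier hε).contDiff_convolution_left _ (contDiff_mollifier ε) hf

lemma integrable_mollify {ε : ℝ} (hε : 0 < ε) {f : ℂ → E} (hf : LocallyIntegrable f) (z : ℂ) :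
    Integrable (fun ζ => mollifier ε ζ • f (z - ζ)) :=
  (hasCompactSupport_mollifier hε).convolutionExists_left (ContinuousLinearMap.lsmul ℝ ℝ)
    (contDiff_mollifier ε).continuous hf z

lemma le_mollify {ε : ℝ} (hε : 0 < ε) {f : ℂ → ℝ} (hf : LocallyIntegrable f) {z : ℂ} {a : ℝ}
    (ha : ∀ ζ, ‖ζ‖ < ε → a ≤ f (z - ζ)) : a ≤ mollify ε f z := by
  have h : ∫ ζ, mollifier ε ζ * a ≤ mollify ε f z := by
    refine integral_mono ((integrable_mollifier hε).mul_const a) (integrable_mollify hε hf z) ?_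
    intro ζ
    rcases lt_or_ge ‖ζ‖ ε with h | h
    · exact mul_le_mul_of_nonneg_left (ha ζ h) (mollifier_nonneg hε ζ)
    · simp [mollifier_eq_zero hε h]
  rwa [integral_mul_const, integral_mollifier hε, one_mul] at h

lemma mollify_le {ε : ℝ} (hε : 0 < ε) {f : ℂ → ℝ} (hf : LocallyIntegrable f) {z : ℂ} {a : ℝ}
    (ha : ∀ ζ, ‖ζ‖ < ε → f (z - ζ) ≤ a) : mollify ε f z ≤ a := by
  have h : mollify ε f z ≤ ∫ ζ, mollifier ε ζ * a := by
    refine integral_mono (integrable_mollify hε hf z) ((integrable_mollifier hε).mul_const a) ?_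
    intro ζ
    rcases lt_or_ge ‖ζ‖ ε with h | h
    · exact mul_le_mul_of_nonneg_left (ha ζ h) (mollifier_nonneg hε ζ)
    · simp [mollifier_eq_zero hε h]
  rwa [integral_mul_const, integral_mollifier hε, one_mul] at h

namespace BddSubharmonic

variable {r : ℂ → ℝ}

lemma le_mollify_self (h : BddSubharmonic r) {ε : ℝ} (hε : 0 < ε) (z : ℂ) :
    r z ≤ mollify ε r z := by
  obtain ⟨B, hB⟩ := h.locBdd (‖z‖ + ε)
  have := radial_submean (isRadial_mollifier ε) (contDiff_mollifier ε).continuous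
    (mollifier_nonneg hε) (f := fun ζ => r (z - ζ)) (B := B) (R := ε)
    (h.measurable.comp (measurable_const.sub measurable_id)).stronglyMeasurable hε.le
    (fun ζ hζ => hB _ ((norm_sub_le _ _).trans (by gcongr)))
    (fun ζ hζ => mollifier_eq_zero hε hζ.le) (m := r z)
    (fun ζ => by simpa [sub_eq_add_neg] using h.mean z (-ζ))
  rwa [integral_mollifier hε, mul_one] at this

lemma abs_mollify_le {ε : ℝ} (hε : 0 < ε) (hε1 : ε ≤ 1) (h : BddSubharmonic r) {R B : ℝ}
    (hB : ∀ z, ‖z‖ ≤ R + 1 → |r z| ≤ B) {z : ℂ} (hz : ‖z‖ ≤ R) : |mollify ε r z| ≤ B := by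
  have hb : ∀ ζ : ℂ, ‖ζ‖ < ε → |r (z - ζ)| ≤ B := fun ζ hζ =>
    hB _ ((norm_sub_le _ _).trans (by linarith))
  exact abs_le.2 ⟨le_mollify hε h.locallyIntegrable fun ζ hζ => (abs_le.1 (hb ζ hζ)).1,
    mollify_le hε h.locallyIntegrable fun ζ hζ => (abs_le.1 (hb ζ hζ)).2⟩

lemma tendsto_mollify (h : BddSubharmonic r) (z : ℂ) :
    Tendsto (fun ε => mollify ε r z) (𝓝[>] 0) (𝓝 (r z)) := by
  rw [tendsto_order]
  refine ⟨fun a ha => ?_, fun a ha => ?_⟩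
  · filter_upwards [self_mem_nhdsWithin] with ε hε
    exact ha.trans_le (h.le_mollify_self hε z)
  · obtain ⟨b, hb1, hb2⟩ := exists_between ha
    obtain ⟨δ, hδ, hball⟩ := Metric.eventually_nhds_iff_ball.1 (h.usc z b hb1)
    filter_upwards [Ioo_mem_nhdsGT hδ] with ε hε
    refine (mollify_le hε.1 h.locallyIntegrable fun ζ hζ => (hball _ ?_).le).trans_lt hb2
    simpa using hζ.trans hε.2

lemma ddb_mollify_nonneg (h : BddSubharmonic r) {ε : ℝ} (hε : 0 < ε) (z : ℂ) :
    0 ≤ ddb (mollify ε r) z := by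
  refine ddb_nonneg_of_submean (contDiff_mollify hε h.locallyIntegrable) z one_pos
    fun t ht _ => ?_
  obtain ⟨B, hB⟩ := h.locBdd (‖z‖ + t + ε)
  obtain ⟨G, hG⟩ := (contDiff_mollifier ε).continuous.bounded_above_of_compact_support
    (hasCompactSupport_mollifier hε)
  have hcont : Continuous fun p : ℝ × ℂ => z + t * Complex.exp (p.1 * Complex.I) - p.2 := by
    fun_prop
  have hsm : StronglyMeasurable (Function.uncurry fun (θ : ℝ) (ζ : ℂ) =>
      mollifier ε ζ • r (z + t * Complex.exp (θ * Complex.I) - ζ)) :=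
    ((contDiff_mollifier ε).continuous.stronglyMeasurable.comp_measurable measurable_snd).smul
      (h.measurable.stronglyMeasurable.comp_measurable hcont.measurable)
  have hI := integrable_circle_prod hsm (B := G * |B|) (R := ε)
    (fun θ ζ => by
      rw [norm_smul]
      rcases lt_or_ge ‖ζ‖ ε with h' | h'
      · refine mul_le_mul (hG ζ) ?_ (norm_nonneg _) ((norm_nonneg _).trans (hG ζ))
        refine (hB _ ?_).trans (le_abs_self B)
        refine (norm_sub_le _ _).trans <| add_le_add ((norm_add_le _ _).trans ?_) h'.le
        rw [norm_mul, norm_circle, mul_one, Complex.norm_real, Real.norm_eq_abs, abs_of_pos ht]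
      · rw [mollifier_eq_zero hε h', norm_zero, zero_mul]
        exact mul_nonneg ((norm_nonneg _).trans (hG ζ)) (abs_nonneg _))
    (fun θ ζ hζ => by simp [mollifier_eq_zero hε hζ.le]) 0 (2 * π)
  have hsw := intervalIntegral_integral_swap hI
  have e : ∫ θ in (0 : ℝ)..2 * π, mollify ε r (z + t * Complex.exp (θ * Complex.I)) =
      ∫ ζ, ∫ θ in (0 : ℝ)..2 * π, mollifier ε ζ • r (z + t * Complex.exp (θ * Complex.I) - ζ) := hsw
  rw [e, mollify, ← integral_mul_const]
  refine integral_mono ((integrable_mollify hε h.locallyIntegrable z).mul_const _) ?_ ?_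
  · have := hI.integral_prod_right
    simpa [intervalIntegral.integral_of_le (show (0 : ℝ) ≤ 2 * π by positivity),
      Set.uIoc_of_le (show (0 : ℝ) ≤ 2 * π by positivity)] using this
  · intro ζ
    simp only [smul_eq_mul, intervalIntegral.integral_const_mul]
    rw [mul_assoc]
    refine mul_le_mul_of_nonneg_left ?_ (mollifier_nonneg hε ζ)
    have e2 : ∀ θ : ℝ, z + t * Complex.exp (θ * Complex.I) - ζ =
        z - ζ + Complex.exp (θ * Complex.I) * t := fun θ => by ring
    simp only [e2]
    exact h.mean (z - ζ) t

end BddSubharmonic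

end Regularization

noncomputable section Potential

open Real

lemma hasCompactSupport_ofReal {φ : ℂ → ℝ} (hc : HasCompactSupport φ) :
    HasCompactSupport (fun z => (φ z : ℂ)) :=
  hc.comp_left (g := fun x : ℝ => (x : ℂ)) (by simp)

lemma hasCompactSupport_ddb {φ : ℂ → ℝ} (hc : HasCompactSupport φ) : HasCompactSupport (ddb φ) :=
  (dz_hasCompactSupport (dzb_hasCompactSupport (hasCompactSupport_ofReal hc))).comp_left
    (g := Complex.re) (by simp)

lemma integral_mul_ddb {u v : ℂ → ℝ} (hu : ContDiff ℝ ∞ u) (hv : ContDiff ℝ ∞ v)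
    (hc : HasCompactSupport v) : ∫ z, u z * ddb v z = ∫ z, v z * ddb u z := by
  have hU := ofReal_contDiff hu
  have hV := ofReal_contDiff hv
  have hcV := hasCompactSupport_ofReal hc
  have hd : ∀ {f : ℂ → ℂ} (z : ℂ), ContDiff ℝ ∞ f → DifferentiableAt ℝ f z :=
    fun z hf => hf.differentiable (by simp) z
  have hA : ContDiff ℝ ∞ (fun z => (u z : ℂ) * dzb (fun z => (v z : ℂ)) z) :=
    hU.mul (contDiff_dzb hV)
  have hB : ContDiff ℝ ∞ (fun z => (v z : ℂ) * dz (fun z => (u z : ℂ)) z) :=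
    hV.mul (contDiff_dz hU)
  have hcA : HasCompactSupport (fun z => (u z : ℂ) * dzb (fun z => (v z : ℂ)) z) :=
    (dzb_hasCompactSupport hcV).mul_left
  have hcB : HasCompactSupport (fun z => (v z : ℂ) * dz (fun z => (u z : ℂ)) z) := hcV.mul_right
  have h1 := integral_dz hA hcA
  have h2 := integral_dzb hB hcB
  have i1 : Integrable (fun z => u z * ddb v z) :=
    (hu.continuous.mul (continuous_ddb hv)).integrable_of_hasCompactSupport
      (hasCompactSupport_ddb hc).mul_left
  have i2 : Integrable (fun z => v z * ddb u z) :=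
    (hv.continuous.mul (continuous_ddb hu)).integrable_of_hasCompactSupport hc.mul_right
  have key : ∀ z, ((u z * ddb v z - v z * ddb u z : ℝ) : ℂ) =
      dz (fun z => (u z : ℂ) * dzb (fun z => (v z : ℂ)) z) z -
        dzb (fun z => (v z : ℂ) * dz (fun z => (u z : ℂ)) z) z := by
    intro z
    rw [dz_mul (hd z hU) (hd z (contDiff_dzb hV)), dzb_mul (hd z hV) (hd z (contDiff_dz hU)),
      ← dz_dzb_comm hU]
    push_cast
    rw [ofReal_ddb hu, ofReal_ddb hv]
    ring
  rw [← sub_eq_zero, ← integral_sub i1 i2, ← Complex.ofReal_eq_zero, ← integral_complex_ofReal]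
  simp only [key]
  rw [integral_sub, h1, h2, sub_zero]
  · exact (contDiff_dz hA).continuous.integrable_of_hasCompactSupport (dz_hasCompactSupport hcA)
  · exact (contDiff_dzb hB).continuous.integrable_of_hasCompactSupport (dzb_hasCompactSupport hcB)

lemma locallyIntegrable_log_norm : LocallyIntegrable (fun z : ℂ => log ‖z‖) := by
  rw [locallyIntegrable_iff]
  intro k hk
  obtain ⟨R, hR⟩ := hk.isBounded.subset_ball 0
  refine IntegrableOn.mono_set ?_ hR
  rw [integrableOn_fun_norm_addHaar volume (f := log)]
  simp only [Complex.finrank_real_complex, Nat.add_one_sub_one, pow_one, smul_eq_mul]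
  exact (Real.continuous_mul_log.continuousOn.integrableOn_compact isCompact_Icc).mono_set
    Ioo_subset_Icc_self

/-- The normalizing constant of the logarithmic potential. -/
def logConst : ℝ := ∫ z : ℂ, 1 / (‖z‖ ^ 2 + 1) ^ 2

lemma integrable_logConst : Integrable (fun z : ℂ => 1 / (‖z‖ ^ 2 + 1) ^ 2) := by
  have := integrable_one_add_norm (E := ℂ) (μ := volume) (r := 4) (by norm_num)
  have hne : ∀ z : ℂ, (‖z‖ ^ 2 + 1) ^ 2 ≠ 0 := fun z => by positivity
  have hcont : Continuous (fun z : ℂ => 1 / (‖z‖ ^ 2 + 1) ^ 2) := by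
    fun_prop (disch := assumption)
  refine (this.const_mul 4).mono' hcont.aestronglyMeasurable (ae_of_all _ fun z => ?_)
  have h0 := norm_nonneg z
  rw [Real.rpow_neg (by positivity), show (4 : ℝ) = (4 : ℕ) by norm_num, Real.rpow_natCast,
    Real.norm_of_nonneg (by positivity), ← div_eq_mul_inv, div_le_div_iff₀ (by positivity) (by positivity)]
  push_cast
  nlinarith [sq_nonneg (‖z‖ - 1), sq_nonneg (‖z‖ ^ 2 - 1), mul_nonneg h0 (sq_nonneg (‖z‖ - 1)),
    sq_nonneg ((‖z‖ - 1) * (‖z‖ + 1)), sq_nonneg ((‖z‖ - 1) ^ 2), pow_nonneg h0 3]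

lemma logConst_pos : 0 < logConst := by
  refine (integral_pos_iff_support_of_nonneg (fun z => by positivity) integrable_logConst).2 ?_
  have : Function.support (fun z : ℂ => 1 / (‖z‖ ^ 2 + 1) ^ 2) = univ := by
    ext z
    simp only [Function.mem_support, mem_univ, iff_true]
    positivity
  rw [this]
  simp

lemma tendsto_integral_approx_identity {f : ℂ → ℝ} (hf : Continuous f) {B : ℝ} (hB : ∀ z, |f z| ≤ B) :
    Tendsto (fun δ : ℝ => ∫ z, f z * (δ ^ 2 / (‖z‖ ^ 2 + δ ^ 2) ^ 2)) (𝓝[>] 0)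
      (𝓝 (f 0 * logConst)) := by
  have e : ∀ δ : ℝ, 0 < δ → ∫ z : ℂ, f z * (δ ^ 2 / (‖z‖ ^ 2 + δ ^ 2) ^ 2) =
      ∫ z : ℂ, f (δ • z) * (1 / (‖z‖ ^ 2 + 1) ^ 2) := by
    intro δ hδ
    have := Measure.integral_comp_smul (volume : Measure ℂ)
      (fun z => f z * (δ ^ 2 / (‖z‖ ^ 2 + δ ^ 2) ^ 2)) δ
    rw [Complex.finrank_real_complex, abs_of_pos (by positivity), smul_eq_mul] at this
    rw [eq_comm, ← mul_right_inj' (show ((δ ^ 2)⁻¹ : ℝ) ≠ 0 by positivity), ← this,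
      ← integral_const_mul]
    congr 1; ext z
    rw [norm_smul, Real.norm_of_nonneg hδ.le]
    field_simp
  have h2 : Tendsto (fun δ : ℝ => ∫ z : ℂ, f (δ • z) * (1 / (‖z‖ ^ 2 + 1) ^ 2)) (𝓝[>] 0)
      (𝓝 (∫ z : ℂ, f 0 * (1 / (‖z‖ ^ 2 + 1) ^ 2))) := by
    refine tendsto_integral_filter_of_dominated_convergence
      (fun z => B * (1 / (‖z‖ ^ 2 + 1) ^ 2)) ?_ ?_ (integrable_logConst.const_mul B) ?_
    · refine Eventually.of_forall fun δ => Continuous.aestronglyMeasurable ?_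
      have : ∀ z : ℂ, (‖z‖ ^ 2 + 1) ^ 2 ≠ 0 := fun z => by positivity
      fun_prop (disch := assumption)
    · refine Eventually.of_forall fun δ => ae_of_all _ fun z => ?_
      rw [norm_mul, Real.norm_of_nonneg (show (0 : ℝ) ≤ 1 / (‖z‖ ^ 2 + 1) ^ 2 by positivity)]
      exact mul_le_mul_of_nonneg_right (hB _) (by positivity)
    · refine ae_of_all _ fun z => Tendsto.mul_const _ ?_
      have : Continuous fun δ : ℝ => f (δ • z) := by fun_prop
      have := this.tendsto 0
      simp only [zero_smul] at this
      exact this.mono_left nhdsWithin_le_nhds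
  rw [integral_const_mul] at h2
  refine h2.congr' ?_
  filter_upwards [self_mem_nhdsWithin] with δ hδ
  exact (e δ hδ).symm

lemma tendsto_integral_log_regularization {g : ℂ → ℝ} (hg : Continuous g) (hc : HasCompactSupport g) :
    Tendsto (fun δ : ℝ => ∫ z, log (‖z‖ ^ 2 + δ ^ 2) * g z) (𝓝[>] 0)
      (𝓝 (∫ z, 2 * log ‖z‖ * g z)) := by
  have hi1 : Integrable (fun z => 2 * |log ‖z‖| * |g z|) := by
    have := locallyIntegrable_log_norm.integrable_smul_left_of_hasCompactSupport hg hc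
    refine (this.norm.const_mul 2).congr (ae_of_all _ fun z => ?_)
    simp only [norm_smul, Real.norm_eq_abs]
    ring
  have hi2 : Integrable (fun z => log (‖z‖ ^ 2 + 1) * |g z|) := by
    have : Continuous fun z : ℂ => log (‖z‖ ^ 2 + 1) := (contDiff_log_norm_sq_add one_pos).continuous
    exact (this.mul hg.abs).integrable_of_hasCompactSupport (hc.abs.mul_left)
  refine tendsto_integral_filter_of_dominated_convergence
    (fun z => 2 * |log ‖z‖| * |g z| + log (‖z‖ ^ 2 + 1) * |g z|) ?_ ?_ (hi1.add hi2) ?_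
  · filter_upwards [self_mem_nhdsWithin] with δ hδ
    have hδ' : (0 : ℝ) < δ := hδ
    have : Continuous fun z : ℂ => log (‖z‖ ^ 2 + δ ^ 2) :=
      (contDiff_log_norm_sq_add (by positivity)).continuous
    exact (this.mul hg).aestronglyMeasurable
  · filter_upwards [Ioo_mem_nhdsGT one_pos] with δ hδ
    filter_upwards [compl_mem_ae_iff.2 (measure_singleton (0 : ℂ))] with z hz
    have hz0 : 0 < ‖z‖ := norm_pos_iff.2 hz
    rw [norm_mul, Real.norm_eq_abs, Real.norm_eq_abs, ← add_mul]
    refine mul_le_mul_of_nonneg_right ?_ (abs_nonneg _)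
    have hδ0 := hδ.1
    have hp : 0 < ‖z‖ ^ 2 := by positivity
    have h1 : 2 * log ‖z‖ ≤ log (‖z‖ ^ 2 + δ ^ 2) := by
      rw [show 2 * log ‖z‖ = log (‖z‖ ^ 2) by rw [Real.log_pow]; norm_num]
      exact Real.log_le_log hp (by nlinarith)
    have h2 : log (‖z‖ ^ 2 + δ ^ 2) ≤ log (‖z‖ ^ 2 + 1) :=
      Real.log_le_log (by positivity) (by nlinarith [hδ.2])
    have h3 : 0 ≤ log (‖z‖ ^ 2 + 1) := Real.log_nonneg (by linarith)
    have h4 := neg_abs_le (log ‖z‖)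
    have h5 := abs_nonneg (log ‖z‖)
    exact abs_le.2 ⟨by linarith, by linarith⟩
  · filter_upwards [compl_mem_ae_iff.2 (measure_singleton (0 : ℂ))] with z hz
    have hz0 : 0 < ‖z‖ := norm_pos_iff.2 hz
    refine Tendsto.mul_const _ ?_
    have : ContinuousAt (fun δ : ℝ => log (‖z‖ ^ 2 + δ ^ 2)) 0 := by
      refine ContinuousAt.log (by fun_prop) (by positivity)
    have := this.tendsto
    rw [show log (‖z‖ ^ 2 + 0 ^ 2) = 2 * log ‖z‖ by
      rw [zero_pow two_ne_zero, add_zero, Real.log_pow]; norm_num] at this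
    exact this.mono_left nhdsWithin_le_nhds

lemma integral_log_mul_ddb {f : ℂ → ℝ} (hf : ContDiff ℝ ∞ f) (hc : HasCompactSupport f) :
    ∫ z, 2 * log ‖z‖ * ddb f z = f 0 * logConst := by
  obtain ⟨B, hB⟩ := hf.continuous.bounded_above_of_compact_support hc
  refine tendsto_nhds_unique
    ((tendsto_integral_log_regularization (continuous_ddb hf) (hasCompactSupport_ddb hc)).congr' ?_)
    (tendsto_integral_approx_identity hf.continuous hB)
  filter_upwards [self_mem_nhdsWithin] with δ hδ
  have hδ' : (0 : ℝ) < δ := hδ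
  rw [integral_mul_ddb (contDiff_log_norm_sq_add (by positivity)) hf hc]
  simp only [ddb_log_norm_sq_add (show (0 : ℝ) < δ ^ 2 by positivity)]

end Potential

noncomputable section ConvolutionDerivative

open Real

lemma fderiv_integral_mul_sub_apply {g : ℂ → ℂ} (hg : LocallyIntegrable g) {f : ℂ → ℂ}
    (hf : ContDiff ℝ ∞ f) (hc : HasCompactSupport f) (z v : ℂ) :
    fderiv ℝ (fun z => ∫ ζ, g ζ * f (z - ζ)) z v = ∫ ζ, g ζ * fderiv ℝ f (z - ζ) v := by
  have h := hc.hasFDerivAt_convolution_right (ContinuousLinearMap.mul ℝ ℂ) hg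
    (hf.of_le (by simp)) z
  have h' : HasFDerivAt (fun z => ∫ ζ, g ζ * f (z - ζ)) _ z := h
  rw [h'.fderiv]
  exact convolution_precompR_apply (L := ContinuousLinearMap.mul ℝ ℂ) hg (hc.fderiv (𝕜 := ℝ))
    (hf.continuous_fderiv (by simp)) z v

lemma integrable_mul_sub {g : ℂ → ℂ} (hg : LocallyIntegrable g) {f : ℂ → ℂ}
    (hf : Continuous f) (hc : HasCompactSupport f) (z : ℂ) : Integrable (fun ζ => g ζ * f (z - ζ)) :=
  hc.convolutionExists_right (ContinuousLinearMap.mul ℝ ℂ) hg hf z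

lemma integral_mul_fderiv_combination {g : ℂ → ℂ} (hg : LocallyIntegrable g) {f : ℂ → ℂ}
    (hf : ContDiff ℝ ∞ f) (hc : HasCompactSupport f) (z a : ℂ) :
    ∫ ζ, g ζ * ((fderiv ℝ f (z - ζ) 1 + a * fderiv ℝ f (z - ζ) Complex.I) / 2) =
      ((∫ ζ, g ζ * fderiv ℝ f (z - ζ) 1) + a * ∫ ζ, g ζ * fderiv ℝ f (z - ζ) Complex.I) / 2 := by
  have hi : ∀ v, Integrable (fun ζ => g ζ * fderiv ℝ f (z - ζ) v) := fun v =>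
    integrable_mul_sub hg (f := fun z => fderiv ℝ f z v)
      ((hf.continuous_fderiv (by simp)).clm_apply continuous_const) (hc.fderiv_apply (𝕜 := ℝ) v) z
  rw [← integral_const_mul, ← integral_add (hi 1) ((hi Complex.I).const_mul a), ← integral_div]
  congr 1; ext ζ
  ring

lemma dz_integral_mul_sub {g : ℂ → ℂ} (hg : LocallyIntegrable g) {f : ℂ → ℂ}
    (hf : ContDiff ℝ ∞ f) (hc : HasCompactSupport f) (z : ℂ) :
    dz (fun z => ∫ ζ, g ζ * f (z - ζ)) z = ∫ ζ, g ζ * dz f (z - ζ) := by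
  have := integral_mul_fderiv_combination hg hf hc z (-Complex.I)
  simp only [neg_mul, ← sub_eq_add_neg] at this
  simp only [dz, fderiv_integral_mul_sub_apply hg hf hc]
  exact this.symm

lemma dzb_integral_mul_sub {g : ℂ → ℂ} (hg : LocallyIntegrable g) {f : ℂ → ℂ}
    (hf : ContDiff ℝ ∞ f) (hc : HasCompactSupport f) (z : ℂ) :
    dzb (fun z => ∫ ζ, g ζ * f (z - ζ)) z = ∫ ζ, g ζ * dzb f (z - ζ) := by
  simp only [dzb, fderiv_integral_mul_sub_apply hg hf hc]
  exact (integral_mul_fderiv_combination hg hf hc z Complex.I).symm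

lemma locallyIntegrable_ofReal {g : ℂ → ℝ} (hg : LocallyIntegrable g) :
    LocallyIntegrable (fun z => (g z : ℂ)) := by
  rw [locallyIntegrable_iff] at hg ⊢
  intro k hk
  exact (hg k hk).ofReal

lemma contDiff_integral_mul_sub {g : ℂ → ℝ} (hg : LocallyIntegrable g) {f : ℂ → ℝ}
    (hf : ContDiff ℝ ∞ f) (hc : HasCompactSupport f) :
    ContDiff ℝ ∞ (fun z => ∫ ζ, g ζ * f (z - ζ)) :=
  hc.contDiff_convolution_right (ContinuousLinearMap.lsmul ℝ ℝ) hg hf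

lemma ddb_integral_mul_sub {g : ℂ → ℝ} (hg : LocallyIntegrable g) {f : ℂ → ℝ}
    (hf : ContDiff ℝ ∞ f) (hc : HasCompactSupport f) (z : ℂ) :
    ddb (fun z => ∫ ζ, g ζ * f (z - ζ)) z = ∫ ζ, g ζ * ddb f (z - ζ) := by
  have hF := ofReal_contDiff hf
  have hcF := hasCompactSupport_ofReal hc
  rw [← Complex.ofReal_inj, ofReal_ddb (contDiff_integral_mul_sub hg hf hc)]
  have e : (fun z => ((∫ ζ, g ζ * f (z - ζ) : ℝ) : ℂ)) =
      fun z => ∫ ζ, (g ζ : ℂ) * (fun z => (f z : ℂ)) (z - ζ) := by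
    ext z
    rw [← integral_complex_ofReal]
    simp
  have hgC := locallyIntegrable_ofReal hg
  have e2 : dzb (fun z => ∫ ζ, (g ζ : ℂ) * (fun z => (f z : ℂ)) (z - ζ)) =
      fun z => ∫ ζ, (g ζ : ℂ) * dzb _ (z - ζ) :=
    funext fun z => dzb_integral_mul_sub hgC hF hcF z
  rw [e, e2, dz_integral_mul_sub hgC (contDiff_dzb hF) (dzb_hasCompactSupport hcF),
    ← integral_complex_ofReal]
  simp only [← ofReal_ddb hf]
  simp

lemma fderiv_sub_left_apply (f : ℂ → ℂ) (hf : ContDiff ℝ ∞ f) (a z v : ℂ) :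
    fderiv ℝ (fun z => f (a - z)) z v = - fderiv ℝ f (a - z) v := by
  have h := ((hf.differentiable (by simp) (a - z)).hasFDerivAt).comp z
    ((hasFDerivAt_const a z).sub (hasFDerivAt_id z))
  have h' : HasFDerivAt (fun z => f (a - z)) _ z := h
  rw [h'.fderiv]
  simp

lemma dzb_comp_sub_left {f : ℂ → ℂ} (hf : ContDiff ℝ ∞ f) (a z : ℂ) :
    dzb (fun z => f (a - z)) z = - dzb f (a - z) := by
  simp only [dzb, fderiv_sub_left_apply f hf]
  ring

lemma ddb_comp_sub_left {f : ℂ → ℝ} (hf : ContDiff ℝ ∞ f) (a z : ℂ) :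
    ddb (fun z => f (a - z)) z = ddb f (a - z) := by
  have hF := ofReal_contDiff hf
  have h1 : dzb (fun z => ((f (a - z) : ℝ) : ℂ)) = fun z => - (dzb (fun z => (f z : ℂ)) (a - z)) := by
    ext z
    exact dzb_comp_sub_left hF a z
  have h2 : ContDiff ℝ ∞ (fun z => dzb (fun z => (f z : ℂ)) (a - z)) :=
    (contDiff_dzb hF).comp (contDiff_const.sub contDiff_id)
  unfold ddb
  rw [h1]
  congr 1
  simp only [dz, fderiv_fun_neg, neg_apply, fderiv_sub_left_apply _ (contDiff_dzb hF)]
  ring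

/-- Twice the logarithmic potential of `μ`. -/
def logPotential (μ : ℂ → ℝ) (z : ℂ) : ℝ := ∫ ζ, 2 * log ‖ζ‖ * μ (z - ζ)

lemma locallyIntegrable_two_log_norm : LocallyIntegrable (fun z : ℂ => 2 * log ‖z‖) := by
  exact locallyIntegrable_log_norm.smul (2 : ℝ)

lemma contDiff_logPotential {μ : ℂ → ℝ} (hμ : ContDiff ℝ ∞ μ) (hc : HasCompactSupport μ) :
    ContDiff ℝ ∞ (logPotential μ) :=
  contDiff_integral_mul_sub locallyIntegrable_two_log_norm hμ hc

lemma ddb_logPotential {μ : ℂ → ℝ} (hμ : ContDiff ℝ ∞ μ) (hc : HasCompactSupport μ) (z : ℂ) :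
    ddb (logPotential μ) z = logConst * μ z := by
  have h1 : ContDiff ℝ ∞ (fun ζ => μ (z - ζ)) := hμ.comp (contDiff_const.sub contDiff_id)
  have h2 : HasCompactSupport (fun ζ => μ (z - ζ)) := hc.comp_homeomorph (Homeomorph.subLeft z)
  have := integral_log_mul_ddb h1 h2
  simp only [ddb_comp_sub_left hμ, sub_zero] at this
  rw [mul_comm, ← this]
  exact ddb_integral_mul_sub locallyIntegrable_two_log_norm hμ hc z

lemma logPotential_eq (μ : ℂ → ℝ) (z : ℂ) :
    logPotential μ z = ∫ ζ, 2 * log ‖z - ζ‖ * μ ζ := by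
  rw [logPotential, ← integral_sub_left_eq_self _ volume z]
  simp

lemma integrable_logPotential {μ : ℂ → ℝ} (hμ : Continuous μ) (hc : HasCompactSupport μ) (z : ℂ) :
    Integrable (fun ζ => 2 * log ‖z - ζ‖ * μ ζ) := by
  have h := hc.convolutionExists_right (ContinuousLinearMap.lsmul ℝ ℝ)
    locallyIntegrable_two_log_norm hμ z
  have h' : Integrable (fun ζ => 2 * log ‖ζ‖ * μ (z - ζ)) := h
  simpa using h'.comp_sub_left z

lemma ddb_nonpos_of_isLocalMax {f : ℂ → ℝ} (hf : ContDiff ℝ ∞ f) {z : ℂ} (h : IsLocalMax f z) :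
    ddb f z ≤ 0 := by
  obtain ⟨t₀, ht₀, hb⟩ := Metric.eventually_nhds_iff_ball.1 h
  have := ddb_nonneg_of_submean (f := fun z => (-1) * f z) (contDiff_const.mul hf) z ht₀
    fun t ht htt => ?_
  · rw [ddb_const_mul hf] at this
    linarith
  · have hle : ∫ θ in (0 : ℝ)..2 * π, -1 * f z ≤
        ∫ θ in (0 : ℝ)..2 * π, -1 * f (z + t * Complex.exp (θ * Complex.I)) := by
      have hfc := hf.continuous
      refine intervalIntegral.integral_mono_on (by positivity) (by simp)
        (Continuous.intervalIntegrable (by fun_prop) _ _) fun θ _ => ?_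
      have := hb (z + t * Complex.exp (θ * Complex.I))
        (by simpa [norm_circle, abs_of_pos ht] using htt)
      linarith
    rw [intervalIntegral.integral_const, smul_eq_mul] at hle
    linarith

lemma le_of_ddb_nonneg_of_sphere {f : ℂ → ℝ} (hf : ContDiff ℝ ∞ f) (hsub : ∀ z, 0 ≤ ddb f z)
    {R S : ℝ} (hS : ∀ z : ℂ, ‖z‖ = R → f z ≤ S) {z : ℂ} (hz : ‖z‖ ≤ R) : f z ≤ S := by
  have hRR : 0 ≤ R := (norm_nonneg z).trans hz
  refine le_of_forall_pos_le_add fun η hη => ?_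
  have hq : ContDiff ℝ ∞ (fun z : ℂ => ‖z‖ ^ 2) := contDiff_norm_sq ℝ
  set a := η / (R ^ 2 + 1) with ha
  have ha0 : 0 < a := by positivity
  have hF : ContDiff ℝ ∞ (fun z => f z + a * ‖z‖ ^ 2) := hf.add (contDiff_const.mul hq)
  have hd : ∀ z, 0 < ddb (fun z => f z + a * ‖z‖ ^ 2) z := by
    intro z
    rw [ddb_add hf (contDiff_const.mul hq), ddb_const_mul hq]
    have := ddb_comp_norm_sq (F := fun t => t) (F' := fun _ => 1) (F'' := fun _ => 0)
      (fun t _ => hasDerivAt_id t) (fun t _ => hasDerivAt_const t 1) z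
    rw [this]
    have := hsub z
    simp
    linarith
  obtain ⟨w, hw, hmax⟩ := (isCompact_closedBall (0 : ℂ) R).exists_isMaxOn
    ⟨z, by simpa using hz⟩ hF.continuous.continuousOn
  have hw' : ‖w‖ ≤ R := by simpa using hw
  have hwR : ‖w‖ = R := by
    refine le_antisymm hw' (le_of_not_gt fun hlt => ?_)
    have : IsLocalMax (fun z => f z + a * ‖z‖ ^ 2) w :=
      hmax.isLocalMax (closedBall_mem_nhds_of_mem (by simpa using hlt))
    exact absurd (ddb_nonpos_of_isLocalMax hF this) (not_le.2 (hd w))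
  have h1 := hmax (show z ∈ closedBall (0 : ℂ) R by simpa using hz)
  have h2 := hS w hwR
  simp only [mem_ofPred_eq] at h1
  rw [hwR] at h1
  have h3 : a * R ^ 2 ≤ η := by
    rw [ha, div_mul_eq_mul_div, div_le_iff₀ (by positivity)]
    nlinarith
  have h4 : 0 ≤ a * ‖z‖ ^ 2 := by positivity
  linarith

end ConvolutionDerivative

noncomputable section Minorant

open Real

lemma eq_of_ddb_eq_zero_of_bddBelow {f : ℂ → ℝ} (hf : ContDiff ℝ ∞ f) (h0 : ∀ z, ddb f z = 0)
    {M : ℝ} (hM : ∀ z, M ≤ f z) (z w : ℂ) : f z = f w := by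
  have hh : InnerProductSpace.HarmonicOnNhd f univ := by
    intro z _
    refine ⟨hf.contDiffAt.of_le ENat.LEInfty.out, Eventually.of_forall fun z => ?_⟩
    have := h0 z
    rw [ddb_eq_trace hf] at this
    rw [InnerProductSpace.laplacian_eq_iteratedFDeriv_complexPlane]
    simp only [iteratedFDeriv_two_apply]
    simp
    linarith
  obtain ⟨F, hF, hre⟩ := hh.exists_analyticOnNhd_univ_re_eq
  have hFd : Differentiable ℂ F := fun z => (hF z (mem_univ z)).differentiableAt
  have hre' : ∀ z, (F z).re = f z := fun z => by
    first
      | exact hre (mem_univ z)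
      | exact congrFun hre z
  have hb : Bornology.IsBounded (range fun z => Complex.exp (-F z)) := by
    refine isBounded_iff_forall_norm_le.2 ⟨exp (-M), ?_⟩
    rintro _ ⟨z, rfl⟩
    rw [Complex.norm_exp]
    apply exp_le_exp.2
    have := hM z
    simp [hre' z]
    linarith
  have := congrArg norm (hFd.neg.cexp.apply_eq_apply_of_bounded hb z w)
  simp only [Pi.neg_apply, Complex.norm_exp, Complex.neg_re, hre'] at this
  linarith [exp_injective this]

lemma logPotential_zero_le {μ : ℂ → ℝ} (hμ : Continuous μ) (hc : HasCompactSupport μ)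
    (h0 : ∀ z, 0 ≤ μ z) {R : ℝ} (hR : 1 ≤ R) (hs : ∀ z, R < ‖z‖ → μ z = 0) :
    logPotential μ 0 ≤ 2 * log R * ∫ z, μ z := by
  rw [logPotential_eq, ← integral_const_mul]
  refine integral_mono (integrable_logPotential hμ hc 0)
    ((hμ.integrable_of_hasCompactSupport hc).const_mul _) fun ζ => ?_
  rcases lt_or_ge R ‖ζ‖ with h | h
  · simp [hs ζ h]
  · have hle : log ‖ζ‖ ≤ log R := by
      rcases eq_or_ne ζ 0 with rfl | hne
      · simpa using Real.log_nonneg hR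
      · exact Real.log_le_log (norm_pos_iff.2 hne) h
    have := h0 ζ
    simp only [zero_sub, norm_neg]
    nlinarith

lemma le_logPotential {μ : ℂ → ℝ} (hμ : Continuous μ) (hc : HasCompactSupport μ)
    (h0 : ∀ z, 0 ≤ μ z) {R : ℝ} (hR : 1 ≤ R) (hs : ∀ z, R < ‖z‖ → μ z = 0) {z : ℂ}
    (hz : 2 * R ≤ ‖z‖) :
    2 * log (‖z‖ / 2) * ∫ z, μ z ≤ logPotential μ z := by
  rw [logPotential_eq, ← integral_const_mul]
  refine integral_mono ((hμ.integrable_of_hasCompactSupport hc).const_mul _)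
    (integrable_logPotential hμ hc z) fun ζ => ?_
  rcases lt_or_ge R ‖ζ‖ with h | h
  · simp [hs ζ h]
  · have hle : log (‖z‖ / 2) ≤ log ‖z - ζ‖ := by
      refine Real.log_le_log (by linarith) ?_
      have := norm_sub_norm_le z ζ
      linarith
    have := h0 ζ
    simp only
    nlinarith

namespace BddSubharmonic

variable {r : ℂ → ℝ}

lemma mollify_eq_integral_mul_sub (ε : ℝ) (z : ℂ) :
    mollify ε r z = ∫ ζ, r ζ * mollifier ε (z - ζ) := by
  rw [mollify, ← integral_sub_left_eq_self _ volume z]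
  simp [mul_comm]

lemma exists_test_function (h : BddSubharmonic r) (hnc : ¬ ∃ c, ∀ z, r z = c) :
    ∃ θ : ℂ → ℝ, ContDiff ℝ ∞ θ ∧ HasCompactSupport θ ∧ (∀ z, 0 ≤ θ z) ∧ (∀ z, θ z ≤ 1) ∧
      0 < ∫ z, r z * ddb θ z := by
  by_contra hcon
  apply hnc
  refine ⟨r 0, fun z => ?_⟩
  have hconst : ∀ ε : ℝ, 0 < ε → mollify ε r z = mollify ε r 0 := by
    intro ε hε
    obtain ⟨M, hM⟩ := h.bdd
    refine eq_of_ddb_eq_zero_of_bddBelow (contDiff_mollify hε h.locallyIntegrable) (fun w => ?_)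
      (M := M) (fun w => le_mollify hε h.locallyIntegrable fun ζ _ => hM _) z 0
    refine le_antisymm ?_ (h.ddb_mollify_nonneg hε w)
    by_contra! hpos
    obtain ⟨B, hB⟩ := (contDiff_mollifier ε).continuous.bounded_above_of_compact_support
      (hasCompactSupport_mollifier hε)
    have hB0 : 0 ≤ B := (norm_nonneg _).trans (hB 0)
    have hs : ContDiff ℝ ∞ (fun ζ => mollifier ε (w - ζ)) :=
      (contDiff_mollifier ε).comp (contDiff_const.sub contDiff_id)
    have hcs : HasCompactSupport (fun ζ => mollifier ε (w - ζ)) :=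
      (hasCompactSupport_mollifier hε).comp_homeomorph (Homeomorph.subLeft w)
    refine hcon ⟨fun ζ => (B + 1)⁻¹ * mollifier ε (w - ζ), contDiff_const.mul hs, hcs.mul_left,
      fun ζ => mul_nonneg (by positivity) (mollifier_nonneg hε _), fun ζ => ?_, ?_⟩
    · rw [inv_mul_le_iff₀ (by positivity)]
      have := (le_abs_self _).trans (hB (w - ζ))
      linarith
    · simp only [ddb_const_mul hs, ddb_comp_sub_left (contDiff_mollifier ε)]
      have e : mollify ε r = fun z => ∫ ζ, r ζ * mollifier ε (z - ζ) :=
        funext fun z => mollify_eq_integral_mul_sub ε z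
      rw [e, ddb_integral_mul_sub h.locallyIntegrable (contDiff_mollifier ε)
        (hasCompactSupport_mollifier hε)] at hpos
      have : ∫ ζ, r ζ * ((B + 1)⁻¹ * ddb (mollifier ε) (w - ζ)) =
          (B + 1)⁻¹ * ∫ ζ, r ζ * ddb (mollifier ε) (w - ζ) := by
        rw [← integral_const_mul]; congr 1; ext ζ; ring
      rw [this]
      positivity
  refine tendsto_nhds_unique (h.tendsto_mollify z) ((h.tendsto_mollify 0).congr' ?_)
  filter_upwards [self_mem_nhdsWithin] with ε hε
  exact (hconst ε hε).symm

lemma tendsto_integral_mollify_mul (h : BddSubharmonic r) {g : ℂ → ℝ} (hg : Continuous g)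
    (hc : HasCompactSupport g) :
    Tendsto (fun ε => ∫ z, mollify ε r z * g z) (𝓝[>] 0) (𝓝 (∫ z, r z * g z)) := by
  obtain ⟨R, hR⟩ := hc.isCompact.isBounded.subset_closedBall 0
  obtain ⟨B, hB⟩ := h.locBdd (R + 1)
  refine tendsto_integral_filter_of_dominated_convergence (fun z => B * |g z|) ?_ ?_
    ((hg.integrable_of_hasCompactSupport hc).abs.const_mul B) ?_
  · filter_upwards [self_mem_nhdsWithin] with ε hε
    exact ((contDiff_mollify hε h.locallyIntegrable).continuous.mul hg).aestronglyMeasurable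
  · filter_upwards [Ioo_mem_nhdsGT one_pos] with ε hε
    refine ae_of_all _ fun z => ?_
    by_cases hz : z ∈ tsupport g
    · rw [norm_mul, Real.norm_eq_abs, Real.norm_eq_abs]
      exact mul_le_mul_of_nonneg_right
        (abs_mollify_le hε.1 hε.2.le h hB (by simpa using hR hz)) (abs_nonneg _)
    · simp [image_eq_zero_of_notMem_tsupport hz]
  · exact ae_of_all _ fun z => (h.tendsto_mollify z).mul_const _

lemma exists_logarithmic_minorant (h : BddSubharmonic r) (hnc : ¬ ∃ c, ∀ z, r z = c) :
    ∃ A : ℝ, 0 < A ∧ ∃ C : ℝ, ∀ᶠ ε in 𝓝[>] (0 : ℝ), ∃ p : ℂ → ℝ, ContDiff ℝ ∞ p ∧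
      (∀ z, ddb p z ≤ ddb (mollify ε r) z) ∧ (∀ z, A * log (2 + ‖z‖ ^ 2) - C ≤ p z) ∧ p 0 ≤ C := by
  obtain ⟨θ, hθ, hθc, hθ0, hθ1, hm⟩ := h.exists_test_function hnc
  set m := ∫ z, r z * ddb θ z with hmdef
  obtain ⟨R', hR'⟩ := hθc.isCompact.isBounded.subset_closedBall 0
  set R := max R' 1 with hRdef
  have hR1 : 1 ≤ R := le_max_right _ _
  obtain ⟨B, hB⟩ := h.locBdd (2 * R + 1)
  have hB0 : 0 ≤ B := (abs_nonneg _).trans (hB 0 (by simp; linarith))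
  have hc1 := logConst_pos
  have hlogR := Real.log_nonneg hR1
  have hlog2 : 0 ≤ log 2 := Real.log_nonneg one_le_two
  have hlog4 : 0 ≤ log (2 + 4 * R ^ 2) := Real.log_nonneg (by nlinarith)
  refine ⟨m / (2 * logConst), by positivity, 4 * m * log R / logConst + 2 * log 2 * m / logConst +
    m / (2 * logConst) * log (2 + 4 * R ^ 2) + 2 * B, ?_⟩
  have htend := h.tendsto_integral_mollify_mul (continuous_ddb hθ) (hasCompactSupport_ddb hθc)
  filter_upwards [Ioo_mem_nhdsGT one_pos, htend.eventually (lt_mem_nhds (show m / 2 < m by linarith)),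
    htend.eventually (gt_mem_nhds (show m < 2 * m by linarith))] with ε hε hm1 hm2
  have hsm := contDiff_mollify hε.1 h.locallyIntegrable
  rw [integral_mul_ddb hsm hθ hθc] at hm1 hm2
  set μ : ℂ → ℝ := fun z => θ z * ddb (mollify ε r) z with hμdef
  have hμ : ContDiff ℝ ∞ μ := by
    refine hθ.mul ?_
    exact Complex.reCLM.contDiff.comp (contDiff_dz (contDiff_dzb (ofReal_contDiff hsm)))
  have hμc : HasCompactSupport μ := hθc.mul_right
  have hμ0 : ∀ z, 0 ≤ μ z := fun z => mul_nonneg (hθ0 z) (h.ddb_mollify_nonneg hε.1 z)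
  have hμs : ∀ z, R < ‖z‖ → μ z = 0 := by
    intro z hz
    have : z ∉ tsupport θ := fun hzs => by
      have h1 : ‖z‖ ≤ R' := by simpa using hR' hzs
      exact absurd (h1.trans (le_max_left R' 1)) (not_le.2 hz)
    simp [hμdef, image_eq_zero_of_notMem_tsupport this]
  have hpot := contDiff_logPotential hμ hμc
  set p : ℂ → ℝ := fun z => logConst⁻¹ * logPotential μ z with hpdef
  have hp : ContDiff ℝ ∞ p := contDiff_const.mul hpot
  have hddp : ∀ z, ddb p z = μ z := by
    intro z
    rw [hpdef, ddb_const_mul hpot, ddb_logPotential hμ hμc, inv_mul_cancel_left₀ hc1.ne']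
  have hdd : ∀ z, ddb p z ≤ ddb (mollify ε r) z := by
    intro z
    rw [hddp]
    exact mul_le_of_le_one_left (h.ddb_mollify_nonneg hε.1 z) (hθ1 z)
  have hfar : ∀ z, 2 * R ≤ ‖z‖ → m / logConst * log (‖z‖ / 2) ≤ p z := by
    intro z hz
    have h1 := le_logPotential hμ.continuous hμc hμ0 hR1 hμs hz
    have h2 : 0 ≤ log (‖z‖ / 2) := Real.log_nonneg (by linarith)
    rw [hpdef, div_mul_eq_mul_div, div_le_iff₀ hc1, mul_comm, mul_comm _ logConst,
      mul_inv_cancel_left₀ hc1.ne']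
    nlinarith
  refine ⟨p, hp, hdd, fun z => ?_, ?_⟩
  · have hA : 0 < m / (2 * logConst) := by positivity
    have t1 : 0 ≤ 4 * m * log R / logConst := by positivity
    have t2 : 0 ≤ 2 * log 2 * m / logConst := by positivity
    have t3 : 0 ≤ m / (2 * logConst) * log (2 + 4 * R ^ 2) := by positivity
    rcases le_total (2 * R) ‖z‖ with hz | hz
    · have h1 : log (2 + ‖z‖ ^ 2) ≤ 2 * log (‖z‖ / 2) + 4 * log 2 := by
        rw [Real.log_div (by linarith) two_ne_zero]
        have : log (2 + ‖z‖ ^ 2) ≤ log (2 ^ 2 * ‖z‖ ^ 2) :=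
          Real.log_le_log (by positivity) (by nlinarith)
        rw [Real.log_mul (by norm_num) (pow_ne_zero 2 (by linarith)), Real.log_pow, Real.log_pow] at this
        push_cast at this
        linarith
      have h2 := mul_le_mul_of_nonneg_left h1 hA.le
      have h3 : m / (2 * logConst) * (2 * log (‖z‖ / 2) + 4 * log 2) =
          m / logConst * log (‖z‖ / 2) + 2 * log 2 * m / logConst := by
        field_simp
        ring
      have := hfar z hz
      linarith
    · have h1 : log (2 + ‖z‖ ^ 2) ≤ log (2 + 4 * R ^ 2) :=
        Real.log_le_log (by positivity) (by nlinarith [norm_nonneg z])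
      have h2 := mul_le_mul_of_nonneg_left h1 hA.le
      have hσ : ContDiff ℝ ∞ (fun z => mollify ε r z + (-1) * p z) :=
        hsm.add (contDiff_const.mul hp)
      have hle := le_of_ddb_nonneg_of_sphere hσ (fun z => ?_) (R := 2 * R) (S := B) (fun w hw => ?_) hz
      · have := (abs_le.1 (abs_mollify_le hε.1 hε.2.le h hB hz)).1
        linarith
      · rw [ddb_add hsm (contDiff_const.mul hp), ddb_const_mul hp]
        linarith [hdd z]
      · have h3 := (abs_le.1 (abs_mollify_le hε.1 hε.2.le h hB hw.le)).2
        have h4 := hfar w hw.ge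
        have h5 : 0 ≤ m / logConst * log (‖w‖ / 2) :=
          mul_nonneg (by positivity) (Real.log_nonneg (by linarith))
        linarith
  · have h1 := logPotential_zero_le hμ.continuous hμc hμ0 hR1 hμs
    have h2 : p 0 ≤ 4 * m * log R / logConst := by
      rw [hpdef, le_div_iff₀ hc1, mul_comm, mul_inv_cancel_left₀ hc1.ne']
      nlinarith
    have t2 : 0 ≤ 2 * log 2 * m / logConst := by positivity
    have t3 : 0 ≤ m / (2 * logConst) * log (2 + 4 * R ^ 2) := by positivity
    linarith

end BddSubharmonic

end Minorant

noncomputable section Weyl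

open Real

lemma integral_circle_of_differentiable {h : ℂ → ℂ} (hh : Differentiable ℂ h) (c ζ : ℂ) :
    ∫ θ in (0 : ℝ)..2 * π, h (c + Complex.exp (θ * Complex.I) * ζ) = (2 * π) • h c := by
  have hd : Differentiable ℂ (fun t => h (c + t * ζ)) := by fun_prop
  have := (hd.diffContOnCl (s := ball (0 : ℂ) |1|)).circleAverage
  rw [circleAverage_def] at this
  simp only [circleMap_zero, Complex.ofReal_one, one_mul, zero_mul, add_zero] at this
  rw [← this, smul_smul, mul_inv_cancel₀ (by positivity), one_smul]

lemma integral_radial_mul_of_differentiable {g : ℂ → ℝ} (hg : IsRadial g) (hgc : Continuous g)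
    (hc : HasCompactSupport g) {h : ℂ → ℂ} (hh : Differentiable ℂ h) (z : ℂ) :
    ∫ ζ, g ζ • h (z + ζ) = (∫ ζ, g ζ) • h z := by
  obtain ⟨R, hR⟩ := hc.isCompact.isBounded.subset_closedBall 0
  have hcont : Continuous (fun ζ => h (z + ζ)) := by have := hh.continuous; fun_prop
  have hcs : HasCompactSupport (fun ζ => g ζ • h (z + ζ)) := hc.smul_right
  obtain ⟨B, hB⟩ := (hgc.smul hcont).bounded_above_of_compact_support hcs
  have hR' : ∀ ζ, R < ‖ζ‖ → g ζ = 0 := fun ζ hζ => image_eq_zero_of_notMem_tsupport fun hmem => by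
    have : ‖ζ‖ ≤ R := by simpa using hR hmem
    linarith
  have := (integral_radial_smul hg hgc.measurable hcont.stronglyMeasurable hB hR').1
  simp only [integral_circle_of_differentiable hh] at this
  simp only [smul_comm (g _) (2 * π), integral_smul] at this
  rw [integral_smul_const] at this
  exact smul_right_injective ℂ (by positivity : (2 * π) ≠ 0) this

lemma mollify_of_differentiable {ε : ℝ} (hε : 0 < ε) {h : ℂ → ℂ} (hh : Differentiable ℂ h) (z : ℂ) :
    mollify ε h z = h z := by
  have := integral_radial_mul_of_differentiable (isRadial_mollifier ε)
    (contDiff_mollifier ε).continuous (hasCompactSupport_mollifier hε) hh z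
  rw [integral_mollifier hε, one_smul] at this
  rw [← this, mollify, ← integral_neg_eq_self]
  simp [mollifier_neg]

lemma mollify_eq_kernel {E : Type*} [NormedAddCommGroup E] [NormedSpace ℝ E] (ε : ℝ) (f : ℂ → E)
    (z : ℂ) : mollify ε f z = ∫ w, mollifier ε (z - w) • f w := by
  rw [mollify, ← integral_sub_left_eq_self _ volume z]
  simp

lemma integral_smul_mollify {ε : ℝ} (hε : 0 < ε) {g : ℂ → ℝ} (hg : Continuous g)
    (hc : HasCompactSupport g) {H : ℂ → ℂ} (hH : LocallyIntegrable H) :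
    ∫ z, g z • mollify ε H z = ∫ z, mollify ε g z • H z := by
  obtain ⟨R, hR⟩ := hc.isCompact.isBounded.subset_closedBall 0
  obtain ⟨B, hB⟩ := (contDiff_mollifier ε).continuous.bounded_above_of_compact_support
    (hasCompactSupport_mollifier hε)
  have hHm : AEStronglyMeasurable H := hH.aestronglyMeasurable
  set K := closedBall (0 : ℂ) (R + ε) with hK
  have hHK : Integrable (fun w => ‖K.indicator H w‖) :=
    ((hH.integrableOn_isCompact (isCompact_closedBall 0 (R + ε))).integrable_indicator
      measurableSet_closedBall).norm
  have hgi : Integrable (fun z => B * ‖g z‖) :=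
    (hg.integrable_of_hasCompactSupport hc).norm.const_mul B
  have hmc : Continuous fun p : ℂ × ℂ => mollifier ε (p.1 - p.2) := by
    have := (contDiff_mollifier ε).continuous
    fun_prop
  have hprod : Integrable (Function.uncurry fun z w => g z • (mollifier ε (z - w) • H w))
      (volume.prod volume) := by
    refine (hgi.mul_prod hHK).mono' ?_ (ae_of_all _ fun p => ?_)
    · exact (hg.comp continuous_fst).aestronglyMeasurable.smul
        (hmc.aestronglyMeasurable.smul hHm.comp_snd)
    · obtain ⟨z, w⟩ := p
      simp only [Function.uncurry_apply_pair, norm_smul]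
      by_cases hw : w ∈ K
      · rw [indicator_of_mem hw, ← mul_assoc, mul_comm ‖g z‖]
        gcongr
        exact hB _
      · have : ‖g z‖ * ‖mollifier ε (z - w)‖ = 0 := by
          by_cases hz : z ∈ tsupport g
          · have h1 : ‖z‖ ≤ R := by simpa using hR hz
            have h2 : R + ε < ‖w‖ := by simpa [hK] using hw
            have h3 := norm_sub_norm_le w z
            rw [norm_sub_rev] at h3
            rw [mollifier_eq_zero hε (by linarith), norm_zero, mul_zero]
          · rw [image_eq_zero_of_notMem_tsupport hz, norm_zero, zero_mul]
        rw [← mul_assoc, this, zero_mul]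
        have : 0 ≤ B := (norm_nonneg _).trans (hB 0)
        positivity
  have hsw := integral_integral_swap hprod
  have e1 : ∀ z, ∫ w, g z • (mollifier ε (z - w) • H w) = g z • mollify ε H z := by
    intro z
    rw [integral_smul, mollify_eq_kernel]
  have e2 : ∀ w, ∫ z, g z • (mollifier ε (z - w) • H w) = mollify ε g w • H w := by
    intro w
    rw [mollify_eq_kernel, ← integral_smul_const]
    congr 1; ext z
    rw [smul_smul, ← mollifier_neg ε (w - z), neg_sub, smul_eq_mul, mul_comm]
  simpa only [e1, e2] using hsw

lemma tendsto_integral_mollify_smul {g : ℂ → ℝ} (hg : Continuous g)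
    (hc : HasCompactSupport g) {H : ℂ → ℂ} (hH : LocallyIntegrable H) :
    Tendsto (fun ε => ∫ z, mollify ε g z • H z) (𝓝[>] 0) (𝓝 (∫ z, g z • H z)) := by
  obtain ⟨R, hR⟩ := hc.isCompact.isBounded.subset_closedBall 0
  obtain ⟨B, hB⟩ := hg.bounded_above_of_compact_support hc
  have hgl : LocallyIntegrable g := hg.locallyIntegrable
  have hHm : AEStronglyMeasurable H := hH.aestronglyMeasurable
  set K := closedBall (0 : ℂ) (R + 1) with hK
  have hHK : Integrable (fun w => B * ‖K.indicator H w‖) :=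
    ((hH.integrableOn_isCompact (isCompact_closedBall 0 (R + 1))).integrable_indicator
      measurableSet_closedBall).norm.const_mul B
  refine tendsto_integral_filter_of_dominated_convergence _ ?_ ?_ hHK ?_
  · filter_upwards [self_mem_nhdsWithin] with ε hε
    exact (contDiff_mollify hε hgl).continuous.aestronglyMeasurable.smul hHm
  · filter_upwards [Ioo_mem_nhdsGT one_pos] with ε hε
    refine ae_of_all _ fun z => ?_
    rw [norm_smul]
    by_cases hz : z ∈ K
    · rw [indicator_of_mem hz]
      refine mul_le_mul_of_nonneg_right (abs_le.2 ⟨?_, ?_⟩) (norm_nonneg _)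
      · exact le_mollify hε.1 hgl fun ζ _ => (abs_le.1 (hB _)).1
      · exact mollify_le hε.1 hgl fun ζ _ => (abs_le.1 (hB _)).2
    · rw [indicator_of_notMem hz, norm_zero, mul_zero]
      have : mollify ε g z = 0 := by
        have h0 : ∀ ζ : ℂ, ‖ζ‖ < ε → g (z - ζ) = 0 := fun ζ hζ =>
          image_eq_zero_of_notMem_tsupport fun hmem => by
            have h1 : ‖z - ζ‖ ≤ R := by simpa using hR hmem
            have h2 : R + 1 < ‖z‖ := by simpa [hK] using hz
            have h3 := norm_sub_norm_le z ζ
            linarith [hε.2]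
        exact le_antisymm (mollify_le hε.1 hgl fun ζ hζ => (h0 ζ hζ).le)
          (le_mollify hε.1 hgl fun ζ hζ => (h0 ζ hζ).ge)
      rw [this, norm_zero, zero_mul]
  · refine ae_of_all _ fun z => Tendsto.smul_const ?_ _
    rw [Metric.tendsto_nhds]
    intro η hη
    obtain ⟨δ, hδ, hball⟩ := Metric.continuous_iff.1 hg z (η / 2) (by positivity)
    filter_upwards [Ioo_mem_nhdsGT hδ] with ε hε
    have hb : ∀ ζ : ℂ, ‖ζ‖ < ε → |g (z - ζ) - g z| ≤ η / 2 := fun ζ hζ =>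
      (hball (z - ζ) (by simpa using hζ.trans hε.2)).le
    have h1 := le_mollify hε.1 hgl (z := z) (a := g z - η / 2) fun ζ hζ => by
      have := (abs_le.1 (hb ζ hζ)).1; linarith
    have h2 := mollify_le hε.1 hgl (z := z) (a := g z + η / 2) fun ζ hζ => by
      have := (abs_le.1 (hb ζ hζ)).2; linarith
    rw [Real.dist_eq]
    exact abs_lt.2 ⟨by linarith, by linarith⟩

lemma weyl_lemma {H : ℂ → ℂ} (hH : LocallyIntegrable H)
    (h0 : ∀ γ : ℂ → ℂ, ContDiff ℝ ∞ γ → HasCompactSupport γ → ∫ z, H z * dzb γ z = 0) :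
    ∃ h : ℂ → ℂ, Differentiable ℂ h ∧ H =ᵐ[volume] h := by
  have hd : ∀ ε : ℝ, 0 < ε → Differentiable ℂ (mollify ε H) := by
    intro ε hε z
    have hM := ofReal_contDiff (contDiff_mollifier ε)
    have hcM := hasCompactSupport_ofReal (hasCompactSupport_mollifier hε)
    refine holomorphic_of_dzb ((contDiff_mollify hε hH).differentiable (by simp) z) ?_
    have e : mollify ε H = fun z => ∫ ζ, H ζ * (fun z => (mollifier ε z : ℂ)) (z - ζ) := by
      ext z
      rw [mollify_eq_kernel]
      congr 1; ext w
      rw [Complex.real_smul, mul_comm]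
    rw [e, dzb_integral_mul_sub hH hM hcM, ← neg_inj, neg_zero, ← integral_neg]
    rw [← h0 (fun ζ => (mollifier ε (z - ζ) : ℂ)) (hM.comp (contDiff_const.sub contDiff_id))
      (hcM.comp_homeomorph (Homeomorph.subLeft z))]
    congr 1; ext ζ
    rw [dzb_comp_sub_left hM, mul_neg]
  have hlim : ∀ δ : ℝ, 0 < δ → ∀ z, Tendsto (fun ε => mollify ε H z) (𝓝[>] 0) (𝓝 (mollify δ H z)) := by
    intro δ hδ z
    have hm : Continuous (fun w => mollifier δ (z - w)) := by
      have := (contDiff_mollifier δ).continuous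
      fun_prop
    have hmc : HasCompactSupport (fun w => mollifier δ (z - w)) :=
      (hasCompactSupport_mollifier hδ).comp_homeomorph (Homeomorph.subLeft z)
    have := tendsto_integral_mollify_smul hm hmc hH
    rw [mollify_eq_kernel]
    refine this.congr' ?_
    filter_upwards [self_mem_nhdsWithin] with ε hε
    rw [← integral_smul_mollify hε hm hmc hH, ← mollify_eq_kernel, mollify_of_differentiable hδ (hd ε hε)]
  have heq : ∀ δ : ℝ, 0 < δ → mollify δ H = mollify 1 H := fun δ hδ =>
    funext fun z => tendsto_nhds_unique (hlim δ hδ z) (hlim 1 one_pos z)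
  refine ⟨mollify 1 H, hd 1 one_pos, ?_⟩
  have hloc : LocallyIntegrable (mollify 1 H) := (hd 1 one_pos).continuous.locallyIntegrable
  have := ae_eq_zero_of_integral_contDiff_smul_eq_zero (hH.sub hloc) fun g hg hgc => ?_
  · filter_upwards [this] with z hz
    exact sub_eq_zero.1 hz
  · have i1 := hH.integrable_smul_left_of_hasCompactSupport hg.continuous hgc
    have i2 := hloc.integrable_smul_left_of_hasCompactSupport hg.continuous hgc
    simp only [Pi.sub_apply, smul_sub]
    rw [integral_sub i1 i2, sub_eq_zero]
    refine tendsto_nhds_unique (tendsto_integral_mollify_smul hg.continuous hgc hH) ?_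
    refine tendsto_const_nhds.congr' ?_
    filter_upwards [self_mem_nhdsWithin] with ε hε
    rw [← integral_smul_mollify hε hg.continuous hgc hH, heq ε hε]

end Weyl

noncomputable section Weighted

open Real

def cutoffProfile (t : ℝ) : ℝ := smoothTransition (1 - t)

lemma contDiff_cutoffProfile : ContDiff ℝ ∞ cutoffProfile :=
  Real.smoothTransition.contDiff.comp (contDiff_const.sub contDiff_id)

lemma cutoffProfile_zero : cutoffProfile 0 = 1 := by
  simp [cutoffProfile]

lemma cutoffProfile_of_one_le {t : ℝ} (ht : 1 ≤ t) : cutoffProfile t = 0 :=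
  smoothTransition.zero_of_nonpos (by linarith)

def cutoffKernel (z : ℂ) : ℝ := deriv cutoffProfile (‖z‖ ^ 2)

lemma continuous_cutoffKernel : Continuous cutoffKernel := by
  have : Continuous (deriv cutoffProfile) := contDiff_cutoffProfile.continuous_deriv (by simp)
  exact this.comp (by fun_prop)

lemma cutoffKernel_eq_zero {z : ℂ} (hz : 1 < ‖z‖) : cutoffKernel z = 0 := by
  have h : cutoffProfile =ᶠ[𝓝 (‖z‖ ^ 2)] fun _ => 0 := by
    filter_upwards [lt_mem_nhds (show 1 < ‖z‖ ^ 2 by nlinarith)] with t ht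
    exact cutoffProfile_of_one_le ht.le
  rw [cutoffKernel, h.deriv_eq]
  simp

lemma hasCompactSupport_cutoffKernel : HasCompactSupport cutoffKernel :=
  HasCompactSupport.of_support_subset_isCompact (isCompact_closedBall (0 : ℂ) 1) fun z hz => by
    by_contra h
    exact hz (cutoffKernel_eq_zero (by simpa using h))

lemma isRadial_cutoffKernel : IsRadial cutoffKernel := fun u z hu => by
  simp [cutoffKernel, hu]

namespace BddSubharmonic

variable {r : ℂ → ℝ}

lemma weighted_estimate (h : BddSubharmonic r) (hnc : ¬ ∃ c, ∀ z, r z = c) :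
    ∃ k₀ C : ℝ, 0 < C ∧ ∀ k : ℝ, k₀ ≤ k → ∀ γ : ℂ → ℂ, ContDiff ℝ ∞ γ → HasCompactSupport γ →
      exp (k * r 0) ≤ C * ∫ z, ‖(cutoffKernel z : ℂ) + dzb γ z‖ ^ 2 * exp (k * r z) := by
  obtain ⟨A, hA, C, hev⟩ := h.exists_logarithmic_minorant hnc
  set k₀ := 3 / A with hk₀
  have hk0 : 0 < k₀ := by positivity
  refine ⟨k₀, 3 * exp (2 * k₀ * C), by positivity, fun k hk γ hγ hγc => ?_⟩
  have hk' : 0 ≤ k := hk0.le.trans hk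
  set Ψ : ℂ → ℂ := fun z => (cutoffKernel z : ℂ) + dzb γ z with hΨ
  have hΨc : Continuous Ψ :=
    (Complex.continuous_ofReal.comp continuous_cutoffKernel).add (contDiff_dzb hγ).continuous
  have hΨs : HasCompactSupport Ψ :=
    (hasCompactSupport_ofReal hasCompactSupport_cutoffKernel).add (dzb_hasCompactSupport hγc)
  set β : ℂ → ℂ := fun z => ((cutoffProfile (‖z‖ ^ 2) : ℝ) : ℂ) + z * γ z with hβ
  have hF : ContDiff ℝ ∞ fun z : ℂ => cutoffProfile (‖z‖ ^ 2) :=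
    contDiff_cutoffProfile.comp (contDiff_norm_sq ℝ)
  have hFo := ofReal_contDiff hF
  have hzγ : ContDiff ℝ ∞ fun z : ℂ => z * γ z := contDiff_id.mul hγ
  have hβc : ContDiff ℝ ∞ β := hFo.add hzγ
  have hβs : HasCompactSupport β := by
    refine HasCompactSupport.add ?_ hγc.mul_left
    refine hasCompactSupport_ofReal (HasCompactSupport.of_support_subset_isCompact
      (isCompact_closedBall (0 : ℂ) 1) fun z hz => ?_)
    by_contra hh
    refine hz (cutoffProfile_of_one_le ?_)
    have : 1 < ‖z‖ := by simpa using hh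
    nlinarith
  have hβΨ : ∀ z, dzb β z = z * Ψ z := by
    intro z
    have hd : HasDerivAt cutoffProfile (deriv cutoffProfile (‖z‖ ^ 2)) (‖z‖ ^ 2) :=
      (contDiff_cutoffProfile.differentiable (by simp) _).hasDerivAt
    rw [hβ, dzb_add (hFo.differentiable (by simp) z) (hzγ.differentiable (by simp) z),
      dzb_comp_norm_sq hd, dzb_mul (by fun_prop) (hγ.differentiable (by simp) z), dzb_id]
    simp only [hΨ, cutoffKernel]
    ring
  have hβ0 : β 0 = 1 := by simp [hβ, cutoffProfile_zero]
  have hbound : ∀ᶠ ε in 𝓝[>] (0 : ℝ), exp (k * r 0) ≤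
      3 * exp (2 * k₀ * C) * ∫ z, ‖Ψ z‖ ^ 2 * exp (k * mollify ε r z) := by
    filter_upwards [hev, self_mem_nhdsWithin] with ε ⟨p, hp, hdd, hlow, hp0⟩ hε
    have hm := contDiff_mollify hε h.locallyIntegrable
    have hkm : ContDiff ℝ ∞ fun z => k * mollify ε r z := contDiff_const.mul hm
    have hkp : ContDiff ℝ ∞ fun z => -k₀ * p z := contDiff_const.mul hp
    have hφ : ContDiff ℝ ∞ fun z => k * mollify ε r z + -k₀ * p z := hkm.add hkp
    have hsub : ∀ z, 0 ≤ ddb (fun z => k * mollify ε r z + -k₀ * p z) z := by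
      intro z
      rw [ddb_add hkm hkp, ddb_const_mul hm, ddb_const_mul hp]
      have h1 := hdd z
      have h2 := h.ddb_mollify_nonneg hε z
      nlinarith
    have hpt := point_estimate hφ hsub hβc hβs hΨc hΨs hβΨ
    rw [hβ0, norm_one, one_pow, one_mul] at hpt
    have hle : ∫ z, (2 + ‖z‖ ^ 2) ^ 3 * ‖Ψ z‖ ^ 2 * exp (k * mollify ε r z + -k₀ * p z) ≤
        ∫ z, exp (k₀ * C) * (‖Ψ z‖ ^ 2 * exp (k * mollify ε r z)) := by
      have cm := hm.continuous
      have cp := hp.continuous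
      have hs2 : HasCompactSupport fun z => ‖Ψ z‖ ^ 2 :=
        hΨs.comp_left (g := fun x : ℂ => ‖x‖ ^ 2) (by simp)
      refine integral_mono ?_ ?_ fun z => ?_
      · exact Continuous.integrable_of_hasCompactSupport (by fun_prop) hs2.mul_left.mul_right
      · exact Continuous.integrable_of_hasCompactSupport (by fun_prop) hs2.mul_right.mul_left
      · have e1 : (2 + ‖z‖ ^ 2) ^ 3 = exp (3 * log (2 + ‖z‖ ^ 2)) := by
          rw [mul_comm, exp_mul, exp_log (by positivity)]
          norm_cast
        have e2 : 3 * log (2 + ‖z‖ ^ 2) + (k * mollify ε r z + -k₀ * p z) ≤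
            k₀ * C + k * mollify ε r z := by
          have h3 := mul_le_mul_of_nonneg_left (hlow z) hk0.le
          have h4 : k₀ * A = 3 := by rw [hk₀]; field_simp
          rw [mul_sub, ← mul_assoc, h4] at h3
          linarith
        calc (2 + ‖z‖ ^ 2) ^ 3 * ‖Ψ z‖ ^ 2 * exp (k * mollify ε r z + -k₀ * p z)
            = ‖Ψ z‖ ^ 2 * exp (3 * log (2 + ‖z‖ ^ 2) + (k * mollify ε r z + -k₀ * p z)) := by
              rw [exp_add (3 * log (2 + ‖z‖ ^ 2)), e1]; ring
          _ ≤ ‖Ψ z‖ ^ 2 * exp (k₀ * C + k * mollify ε r z) := by gcongr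
          _ = _ := by rw [exp_add]; ring
    rw [integral_const_mul] at hle
    have h0 : exp (k * r 0) * exp (-(k₀ * C)) ≤ exp (k * mollify ε r 0 + -k₀ * p 0) := by
      rw [← exp_add]
      apply exp_le_exp.2
      have h5 := mul_le_mul_of_nonneg_left (h.le_mollify_self hε 0) hk'
      have h6 := mul_le_mul_of_nonneg_left hp0 hk0.le
      linarith
    have h7 := (h0.trans hpt).trans (mul_le_mul_of_nonneg_left hle zero_le_three)
    calc exp (k * r 0) = exp (k * r 0) * exp (-(k₀ * C)) * exp (k₀ * C) := by
          rw [mul_assoc, ← exp_add]; simp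
      _ ≤ _ := mul_le_mul_of_nonneg_right h7 (exp_pos _).le
      _ = _ := by
        rw [show 2 * k₀ * C = k₀ * C + k₀ * C by ring, exp_add]; ring
  obtain ⟨R, hR⟩ := hΨs.isCompact.isBounded.subset_closedBall 0
  obtain ⟨B, hB⟩ := h.locBdd (R + 1)
  have hlim : Tendsto (fun ε => ∫ z, ‖Ψ z‖ ^ 2 * exp (k * mollify ε r z)) (𝓝[>] 0)
      (𝓝 (∫ z, ‖Ψ z‖ ^ 2 * exp (k * r z))) := by
    refine tendsto_integral_filter_of_dominated_convergence
      (fun z => ‖Ψ z‖ ^ 2 * exp (k * B)) ?_ ?_ ?_ ?_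
    · filter_upwards [self_mem_nhdsWithin] with ε hε
      have := (contDiff_mollify hε h.locallyIntegrable).continuous
      exact Continuous.aestronglyMeasurable (by fun_prop)
    · filter_upwards [Ioo_mem_nhdsGT one_pos] with ε hε
      refine ae_of_all _ fun z => ?_
      by_cases hz : z ∈ tsupport Ψ
      · have := (abs_le.1 (abs_mollify_le hε.1 hε.2.le h hB (by simpa using hR hz))).2
        rw [Real.norm_of_nonneg (by positivity)]
        gcongr
      · simp [image_eq_zero_of_notMem_tsupport hz]
    · refine Continuous.integrable_of_hasCompactSupport (by fun_prop) ?_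
      exact (hΨs.comp_left (g := fun x : ℂ => ‖x‖ ^ 2) (by simp)).mul_right
    · refine ae_of_all _ fun z => ?_
      exact (((h.tendsto_mollify z).const_mul k).rexp).const_mul _
  exact ge_of_tendsto (hlim.const_mul _) hbound

end BddSubharmonic

end Weighted

noncomputable section Entire

open Real

namespace BddSubharmonic

variable {r : ℂ → ℝ}

def halfWeight (r : ℂ → ℝ) (k : ℝ) (z : ℂ) : ℝ := exp (k * r z / 2)

lemma halfWeight_sq (r : ℂ → ℝ) (k : ℝ) (z : ℂ) : halfWeight r k z ^ 2 = exp (k * r z) := by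
  rw [halfWeight, ← exp_nat_mul]
  congr 1
  push_cast
  ring

lemma measurable_halfWeight (h : BddSubharmonic r) (k : ℝ) : Measurable (halfWeight r k) := by
  have := h.measurable
  unfold halfWeight
  fun_prop

lemma halfWeight_bound (h : BddSubharmonic r) (k R : ℝ) :
    ∃ B : ℝ, ∀ z, ‖z‖ ≤ R → halfWeight r k z ≤ B := by
  obtain ⟨B, hB⟩ := h.locBdd R
  refine ⟨exp (|k| * B / 2), fun z hz => exp_le_exp.2 ?_⟩
  have h1 := le_abs_self (k * r z)
  rw [abs_mul] at h1
  have := mul_le_mul_of_nonneg_left (hB z hz) (abs_nonneg k)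
  linarith

lemma memLp_mul_halfWeight (h : BddSubharmonic r) (k : ℝ) {f : ℂ → ℂ} (hf : Continuous f)
    (hc : HasCompactSupport f) : MemLp (fun z => f z * halfWeight r k z) 2 := by
  have hm : AEStronglyMeasurable (fun z => f z * halfWeight r k z) := by
    have := h.measurable_halfWeight k
    have := hf.measurable
    exact Measurable.aestronglyMeasurable (by fun_prop)
  rw [memLp_two_iff_integrable_sq_norm hm]
  obtain ⟨R, hR⟩ := hc.isCompact.isBounded.subset_closedBall 0
  obtain ⟨B, hB⟩ := h.halfWeight_bound k R
  obtain ⟨D, hD⟩ := hf.bounded_above_of_compact_support hc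
  have hD0 : 0 ≤ D := (norm_nonneg _).trans (hD 0)
  have hzero : ∀ z, R < ‖z‖ → f z = 0 := fun z hz => image_eq_zero_of_notMem_tsupport fun hmem => by
    have : ‖z‖ ≤ R := by simpa using hR hmem
    linarith
  refine integrable_of_bounded_of_support (hm.norm.pow 2) (B := (D * B) ^ 2) (R := R)
    (fun z => ?_) fun z hz => by simp [hzero z hz]
  by_cases hz : ‖z‖ ≤ R
  · have h0 : 0 ≤ halfWeight r k z := (exp_pos _).le
    rw [norm_pow, norm_norm, norm_mul, Complex.norm_real, Real.norm_of_nonneg h0]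
    have := hB z hz
    have := hD z
    gcongr
  · rw [hzero z (not_le.1 hz)]
    simp only [zero_mul, norm_zero]
    norm_num
    positivity

def dbarRange (r : ℂ → ℝ) (k : ℝ) : Submodule ℂ (Lp ℂ 2 (volume : Measure ℂ)) where
  carrier := {f | ∃ γ : ℂ → ℂ, ContDiff ℝ ∞ γ ∧ HasCompactSupport γ ∧
    f =ᵐ[volume] fun z => dzb γ z * halfWeight r k z}
  add_mem' := by
    rintro f g ⟨γ, hγ, hγc, hf⟩ ⟨δ, hδ, hδc, hg⟩
    refine ⟨fun z => γ z + δ z, hγ.add hδ, hγc.add hδc, ?_⟩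
    filter_upwards [hf, hg, Lp.coeFn_add f g] with z h1 h2 h3
    rw [h3, Pi.add_apply, h1, h2,
      dzb_add (hγ.differentiable (by simp) z) (hδ.differentiable (by simp) z), add_mul]
  zero_mem' := by
    refine ⟨fun _ => 0, contDiff_const, HasCompactSupport.zero, ?_⟩
    filter_upwards [Lp.coeFn_zero ℂ 2 (volume : Measure ℂ)] with z hz
    rw [hz]
    simp [dzb_const]
  smul_mem' := by
    rintro c f ⟨γ, hγ, hγc, hf⟩
    refine ⟨fun z => c * γ z, contDiff_const.mul hγ, hγc.mul_left, ?_⟩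
    filter_upwards [hf, Lp.coeFn_smul c f] with z h1 h2
    rw [h2, Pi.smul_apply, h1, dzb_const_mul c (hγ.differentiable (by simp) z), smul_eq_mul,
      mul_assoc]

lemma exists_entire (h : BddSubharmonic r) (hnc : ¬ ∃ c, ∀ z, r z = c) :
    ∃ k₀ c : ℝ, 0 < c ∧ ∀ k : ℝ, k₀ ≤ k → ∃ f : ℂ → ℂ, Differentiable ℂ f ∧
      Integrable (fun z => ‖f z‖ ^ 2 * exp (-(k * r z))) ∧
      ∫ z, ‖f z‖ ^ 2 * exp (-(k * r z)) ≤ 1 ∧ c * exp (k * r 0 / 2) ≤ ‖f 0‖ := by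
  obtain ⟨k₀, C, hC, hest⟩ := h.weighted_estimate hnc
  set I := ∫ z, cutoffKernel z with hI
  refine ⟨k₀, (√C * (|I| + 1))⁻¹, by positivity, fun k hk => ?_⟩
  set w := halfWeight r k with hw
  have hw0 : ∀ z, 0 < w z := fun z => exp_pos _
  have hκL : MemLp (fun z => (cutoffKernel z : ℂ) * w z) 2 :=
    h.memLp_mul_halfWeight k (Complex.continuous_ofReal.comp continuous_cutoffKernel)
      (hasCompactSupport_ofReal hasCompactSupport_cutoffKernel)
  set κ : Lp ℂ 2 (volume : Measure ℂ) := hκL.toLp with hκ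
  set S := (dbarRange r k).topologicalClosure with hS
  set P := κ - S.starProjection κ with hP
  have hPS : P ∈ Sᗮ := S.sub_starProjection_mem_orthogonal κ
  have hPκ : inner ℂ P κ = ((‖P‖ ^ 2 : ℝ) : ℂ) := by
    have h1 : inner ℂ P (S.starProjection κ) = 0 :=
      (Submodule.mem_orthogonal' S P).1 hPS _ (S.starProjection_apply_mem κ)
    have h2 : inner ℂ P P = ((‖P‖ ^ 2 : ℝ) : ℂ) := by
      rw [inner_self_eq_norm_sq_to_K]; simp
    rw [← h2]
    conv_rhs => rw [hP, inner_sub_right, ← hP]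
    rw [h1, sub_zero]
  have hnorm : ∀ f : Lp ℂ 2 (volume : Measure ℂ), ‖f‖ ^ 2 = ∫ z, ‖f z‖ ^ 2 := by
    intro f
    have h1 : inner ℂ f f = ((‖f‖ ^ 2 : ℝ) : ℂ) := by
      rw [inner_self_eq_norm_sq_to_K]; simp
    rw [L2.inner_def] at h1
    have h2 : ∀ z, inner ℂ (f z) (f z) = ((‖f z‖ ^ 2 : ℝ) : ℂ) := fun z => by
      rw [inner_self_eq_norm_sq_to_K]; simp
    simp only [h2, integral_complex_ofReal] at h1
    exact_mod_cast h1.symm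
  have hlow : exp (k * r 0) ≤ C * ‖P‖ ^ 2 := by
    have hcl : IsClosed {s : Lp ℂ 2 (volume : Measure ℂ) | exp (k * r 0) ≤ C * ‖κ - s‖ ^ 2} :=
      isClosed_le continuous_const (by fun_prop)
    have hsub : (dbarRange r k : Set (Lp ℂ 2 (volume : Measure ℂ))) ⊆
        {s | exp (k * r 0) ≤ C * ‖κ - s‖ ^ 2} := by
      rintro s hs
      obtain ⟨γ, hγ, hγc, hs⟩ := (dbarRange r k).neg_mem hs
      have h1 := hest k hk γ hγ hγc
      have h2 : ‖κ - s‖ ^ 2 = ∫ z, ‖(cutoffKernel z : ℂ) + dzb γ z‖ ^ 2 * exp (k * r z) := by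
        rw [hnorm]
        refine integral_congr_ae ?_
        filter_upwards [hs, Lp.coeFn_sub κ s, Lp.coeFn_neg s, hκL.coeFn_toLp] with z h1 h2 h3 h4
        rw [h3, Pi.neg_apply] at h1
        rw [h2, Pi.sub_apply, hκ, h4, sub_eq_add_neg, h1, ← add_mul, norm_mul, Complex.norm_real,
          Real.norm_of_nonneg (hw0 z).le, mul_pow, hw, halfWeight_sq]
      exact h1.trans_eq (by rw [h2])
    exact closure_minimal hsub hcl (S.starProjection_apply_mem κ)
  have hP0 : 0 < ‖P‖ := by
    have h1 : 0 < C * ‖P‖ ^ 2 := (exp_pos _).trans_le hlow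
    rcases (norm_nonneg P).eq_or_lt with h0 | h0
    · rw [← h0] at h1; simp at h1
    · exact h0
  set H : ℂ → ℂ := fun z => w z * (starRingEnd ℂ) (P z) with hH
  have hPm : MemLp P 2 := Lp.memLp P
  have hHloc : LocallyIntegrable H := by
    rw [locallyIntegrable_iff]
    intro K hK
    obtain ⟨R, hR⟩ := hK.isBounded.subset_closedBall 0
    obtain ⟨B, hB⟩ := h.halfWeight_bound k R
    have h1 : IntegrableOn (fun z => (starRingEnd ℂ) (P z)) K :=
      (locallyIntegrable_iff.1 (hPm.star.locallyIntegrable (by norm_num))) K hK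
    refine Integrable.bdd_mul (c := B) h1 ?_ ?_
    · have := h.measurable_halfWeight k
      exact Measurable.aestronglyMeasurable (by fun_prop)
    · refine (ae_restrict_iff' hK.measurableSet).2 (ae_of_all _ fun z hz => ?_)
      rw [Complex.norm_real, Real.norm_of_nonneg (hw0 z).le]
      exact hB z (by simpa using hR hz)
  have hH0 : ∀ γ : ℂ → ℂ, ContDiff ℝ ∞ γ → HasCompactSupport γ → ∫ z, H z * dzb γ z = 0 := by
    intro γ hγ hγc
    have hm := h.memLp_mul_halfWeight k (contDiff_dzb hγ).continuous (dzb_hasCompactSupport hγc)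
    have hmem : hm.toLp ∈ S :=
      (dbarRange r k).le_topologicalClosure ⟨γ, hγ, hγc, hm.coeFn_toLp⟩
    have := (Submodule.mem_orthogonal' S P).1 hPS _ hmem
    rw [L2.inner_def] at this
    rw [← this]
    refine integral_congr_ae ?_
    filter_upwards [hm.coeFn_toLp] with z hz
    rw [hz, RCLike.inner_apply]
    simp only [hH]
    ring
  obtain ⟨f, hf, hfH⟩ := weyl_lemma hHloc hH0
  have hfP : ∀ᵐ z, ‖f z‖ ^ 2 * exp (-(k * r z)) = ‖P z‖ ^ 2 := by
    filter_upwards [hfH] with z hz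
    rw [← hz, hH]
    simp only [norm_mul, Complex.norm_real, RCLike.norm_conj, Real.norm_of_nonneg (hw0 z).le]
    rw [mul_pow, hw, halfWeight_sq, mul_right_comm, ← exp_add]
    simp
  have hfi : Integrable fun z => ‖f z‖ ^ 2 * exp (-(k * r z)) :=
    ((memLp_two_iff_integrable_sq_norm hPm.1).1 hPm).congr (hfP.mono fun z hz => hz.symm)
  have hfint : ∫ z, ‖f z‖ ^ 2 * exp (-(k * r z)) = ‖P‖ ^ 2 := by
    rw [hnorm]; exact integral_congr_ae hfP
  have hfI : ‖f 0‖ * |I| = ‖P‖ ^ 2 := by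
    have h1 := integral_radial_mul_of_differentiable isRadial_cutoffKernel continuous_cutoffKernel
      hasCompactSupport_cutoffKernel hf 0
    rw [L2.inner_def] at hPκ
    have h2 : ∫ ζ, cutoffKernel ζ • f (0 + ζ) = ((‖P‖ ^ 2 : ℝ) : ℂ) := by
      rw [← hPκ]
      refine integral_congr_ae ?_
      filter_upwards [hκL.coeFn_toLp, hfH] with z hz hz'
      rw [hκ, hz, RCLike.inner_apply, zero_add, ← hz', hH, Complex.real_smul]
      ring
    have h3 := congrArg norm (h1.symm.trans h2)
    rw [norm_smul, Complex.norm_real, Real.norm_eq_abs, Real.norm_eq_abs,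
      abs_of_nonneg (sq_nonneg ‖P‖)] at h3
    rw [mul_comm]; exact h3
  refine ⟨fun z => ((‖P‖⁻¹ : ℝ) : ℂ) * f z, hf.const_mul _, ?_, ?_, ?_⟩
  · simp only [norm_mul, Complex.norm_real, mul_pow, mul_assoc]
    exact hfi.const_mul _
  · simp only [norm_mul, Complex.norm_real, mul_pow, mul_assoc]
    rw [integral_const_mul, hfint, norm_inv, norm_norm, ← mul_pow, inv_mul_cancel₀ hP0.ne']
    norm_num
  · rw [norm_mul, Complex.norm_real, norm_inv, norm_norm]
    have h1 : exp (k * r 0 / 2) ≤ √C * ‖P‖ := by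
      refine le_of_sq_le_sq ?_ (by positivity)
      rw [mul_pow, sq_sqrt hC.le]
      exact (halfWeight_sq r k 0).trans_le hlow
    have h2 : ‖P‖ ≤ (|I| + 1) * (‖P‖⁻¹ * ‖f 0‖) := by
      have : ‖P‖⁻¹ * ‖f 0‖ * |I| = ‖P‖ := by
        rw [mul_assoc, hfI, sq, inv_mul_cancel_left₀ hP0.ne']
      have : 0 ≤ ‖P‖⁻¹ * ‖f 0‖ := by positivity
      linarith
    rw [inv_mul_le_iff₀ (by positivity), mul_assoc]
    exact h1.trans (mul_le_mul_of_nonneg_left h2 (by positivity))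

lemma exists_entire_at (h : BddSubharmonic r) (hnc : ¬ ∃ c, ∀ z, r z = c) (a : ℂ) :
    ∃ k₀ c : ℝ, 0 < c ∧ ∀ k : ℝ, k₀ ≤ k → ∃ f : ℂ → ℂ, Differentiable ℂ f ∧
      Integrable (fun z => ‖f z‖ ^ 2 * exp (-(k * r z))) ∧
      ∫ z, ‖f z‖ ^ 2 * exp (-(k * r z)) ≤ 1 ∧ c * exp (k * r a / 2) ≤ ‖f a‖ := by
  have hnc' : ¬ ∃ c, ∀ z, r (a + z) = c := fun ⟨c, hc⟩ => hnc ⟨c, fun z => by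
    simpa using hc (z - a)⟩
  obtain ⟨k₀, c, hc, hk⟩ := (h.comp_add_left a).exists_entire hnc'
  refine ⟨k₀, c, hc, fun k hkk => ?_⟩
  obtain ⟨f, hf, hfi, hf1, hf0⟩ := hk k hkk
  have e : (fun z => ‖f (z - a)‖ ^ 2 * exp (-(k * r z))) =
      fun z => (fun z => ‖f z‖ ^ 2 * exp (-(k * r (a + z)))) (z - a) := by
    funext z; simp
  refine ⟨fun z => f (z - a), hf.comp (differentiable_id.sub_const a), ?_, ?_, ?_⟩
  · rw [e]; exact hfi.comp_sub_right a
  · rw [e, integral_sub_right_eq_self (fun z => ‖f z‖ ^ 2 * exp (-(k * r (a + z))))]; exact hf1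
  · simpa using hf0

end BddSubharmonic

end Entire

noncomputable section Series

lemma summable_norm_lp_one (c : lp (fun _ : ℕ => ℂ) 1) : Summable fun j => ‖c j‖ := by
  simpa using (lp.memℓp c).summable (by simp)

lemma norm_lp_one (c : lp (fun _ : ℕ => ℂ) 1) : ‖c‖ = ∑' j, ‖c j‖ := by
  simpa using lp.norm_eq_tsum_rpow (by simp) c

lemma summable_lp_one_mul (c : lp (fun _ : ℕ => ℂ) 1) {a : ℕ → ℂ} {B : ℝ} (hB : ∀ j, ‖a j‖ ≤ B) :
    Summable fun j => c j * a j := by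
  refine Summable.of_norm_bounded ((summable_norm_lp_one c).mul_right B) fun j => ?_
  rw [norm_mul]
  exact mul_le_mul_of_nonneg_left (hB j) (norm_nonneg _)

lemma norm_tsum_lp_one_mul_le (c : lp (fun _ : ℕ => ℂ) 1) {a : ℕ → ℂ} {B : ℝ}
    (hB : ∀ j, ‖a j‖ ≤ B) : ‖∑' j, c j * a j‖ ≤ ‖c‖ * B := by
  rw [norm_lp_one, ← tsum_mul_right]
  refine tsum_of_norm_bounded ((summable_norm_lp_one c).mul_right B).hasSum fun j => ?_
  rw [norm_mul]
  exact mul_le_mul_of_nonneg_left (hB j) (norm_nonneg _)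

abbrev lpSeries (φ : ℕ → ℂ → ℂ) (c : lp (fun _ : ℕ => ℂ) 1) (t : ℂ) : ℂ := ∑' j, c j * φ j t

lemma differentiableOn_lpSeries {φ : ℕ → ℂ → ℂ} (hφ : ∀ j, Differentiable ℂ (φ j)) {δ B : ℝ}
    (hB : ∀ j, ∀ t ∈ ball (0 : ℂ) δ, ‖φ j t‖ ≤ B) (c : lp (fun _ : ℕ => ℂ) 1) :
    DifferentiableOn ℂ (lpSeries φ c) (ball 0 δ) := by
  refine Complex.differentiableOn_tsum_of_summable_norm ((summable_norm_lp_one c).mul_right B)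
    (fun j => ((hφ j).const_mul _).differentiableOn) isOpen_ball fun j t ht => ?_
  rw [norm_mul]
  exact mul_le_mul_of_nonneg_left (hB j t ht) (norm_nonneg _)

lemma exists_coefficient_functional {φ : ℕ → ℂ → ℂ} (hφ : ∀ j, Differentiable ℂ (φ j)) {δ B : ℝ}
    (hδ : 0 < δ) (hB : ∀ j, ∀ t ∈ ball (0 : ℂ) δ, ‖φ j t‖ ≤ B) (n : ℕ) :
    ∃ T : lp (fun _ : ℕ => ℂ) 1 →L[ℂ] ℂ, ∀ c, T c = iteratedDeriv n (lpSeries φ c) 0 := by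
  have hFc : ∀ c : lp (fun _ : ℕ => ℂ) 1, ContDiffAt ℂ n (lpSeries φ c) 0 := fun c =>
    ((differentiableOn_lpSeries hφ hB c).analyticAt (ball_mem_nhds 0 hδ)).contDiffAt
  have hsum : ∀ c : lp (fun _ : ℕ => ℂ) 1, ∀ t ∈ ball (0 : ℂ) δ, Summable fun j => c j * φ j t :=
    fun c t ht => summable_lp_one_mul c fun j => hB j t ht
  have hadd : ∀ c d : lp (fun _ : ℕ => ℂ) 1, iteratedDeriv n (lpSeries φ (c + d)) 0 =
      iteratedDeriv n (lpSeries φ c) 0 + iteratedDeriv n (lpSeries φ d) 0 := fun c d => by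
    rw [← iteratedDeriv_fun_add (hFc c) (hFc d)]
    refine EventuallyEq.iteratedDeriv_eq n ?_
    filter_upwards [ball_mem_nhds (0 : ℂ) hδ] with t ht
    simp only [lpSeries, lp.coeFn_add, Pi.add_apply, add_mul]
    exact (hsum c t ht).tsum_add (hsum d t ht)
  have hsmul : ∀ (a : ℂ) (c : lp (fun _ : ℕ => ℂ) 1), iteratedDeriv n (lpSeries φ (a • c)) 0 =
      a * iteratedDeriv n (lpSeries φ c) 0 := fun a c => by
    rw [← iteratedDeriv_const_mul_field]
    refine EventuallyEq.iteratedDeriv_eq n (Eventually.of_forall fun t => ?_)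
    simp only [lpSeries, lp.coeFn_smul, Pi.smul_apply, smul_eq_mul, mul_assoc, tsum_mul_left]
  have hbd : ∀ c : lp (fun _ : ℕ => ℂ) 1, ‖iteratedDeriv n (lpSeries φ c) 0‖ ≤
      n.factorial * B / (δ / 2) ^ n * ‖c‖ := fun c => by
    have hsub : closedBall (0 : ℂ) (δ / 2) ⊆ ball 0 δ := closedBall_subset_ball (by linarith)
    have := Complex.norm_iteratedDeriv_le_of_forall_mem_sphere_norm_le n (half_pos hδ)
      (((differentiableOn_lpSeries hφ hB c).mono hsub).diffContOnCl_ball subset_rfl)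
      fun t ht => norm_tsum_lp_one_mul_le c fun j => hB j t (hsub (sphere_subset_closedBall ht))
    refine this.trans_eq ?_
    ring
  exact ⟨LinearMap.mkContinuous
    { toFun := fun c => iteratedDeriv n (lpSeries φ c) 0
      map_add' := hadd
      map_smul' := hsmul } _ hbd, fun c => rfl⟩

lemma bounded_at_one_of_extension {φ : ℕ → ℂ → ℂ} (hφ : ∀ j, Differentiable ℂ (φ j)) {δ B : ℝ}
    (hδ : 0 < δ) (hB : ∀ j, ∀ t ∈ ball (0 : ℂ) δ, ‖φ j t‖ ≤ B) {s : ℝ} (hs : 1 < s)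
    (hext : ∀ c : lp (fun _ : ℕ => ℂ) 1, ∃ G : ℂ → ℂ, DifferentiableOn ℂ G (ball 0 s) ∧
      G =ᶠ[𝓝 0] lpSeries φ c) :
    ∃ C : ℝ, ∀ j, ‖φ j 1‖ ≤ C := by
  obtain ⟨σ, hσ1, hσs⟩ := exists_between hs
  have hσ0 : 0 < σ := by linarith
  choose T hT using exists_coefficient_functional hφ hδ hB
  let T' : ℕ → lp (fun _ : ℕ => ℂ) 1 →L[ℂ] ℂ := fun n =>
    ((σ ^ n / n.factorial : ℝ) : ℂ) • T n
  obtain ⟨C, hC⟩ : ∃ C, ∀ n, ‖T' n‖ ≤ C := by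
    refine banach_steinhaus fun c => ?_
    obtain ⟨G, hG, hGF⟩ := hext c
    have hcl : closedBall (0 : ℂ) σ ⊆ ball 0 s := closedBall_subset_ball hσs
    obtain ⟨D, hD⟩ := (isCompact_closedBall (0 : ℂ) σ).exists_bound_of_continuousOn
      (hG.continuousOn.mono hcl)
    refine ⟨D, fun n => ?_⟩
    have h1 := Complex.norm_iteratedDeriv_le_of_forall_mem_sphere_norm_le n hσ0
      ((hG.mono hcl).diffContOnCl_ball subset_rfl)
      fun t ht => hD t (sphere_subset_closedBall ht)
    rw [hGF.iteratedDeriv_eq n] at h1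
    change ‖((σ ^ n / n.factorial : ℝ) : ℂ) • T n c‖ ≤ D
    rw [norm_smul, hT, Complex.norm_real, Real.norm_of_nonneg (by positivity),
      div_mul_eq_mul_div, div_le_iff₀ (by positivity)]
    rw [le_div_iff₀ (by positivity)] at h1
    linarith
  have hsingle : ∀ j, lpSeries φ (lp.single 1 j 1) = φ j := fun j => by
    funext t
    rw [lpSeries]
    rw [tsum_eq_single j fun i hi => by rw [lp.single_apply, Pi.single_eq_of_ne hi, zero_mul],
      lp.single_apply_self, one_mul]
  have hC0 : 0 ≤ C := (norm_nonneg _).trans (hC 0)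
  have hgeo : Summable fun n : ℕ => C * (σ⁻¹) ^ n :=
    (summable_geometric_of_lt_one (by positivity) (inv_lt_one_of_one_lt₀ hσ1)).mul_left C
  refine ⟨∑' n : ℕ, C * (σ⁻¹) ^ n, fun j => ?_⟩
  have hs := Complex.hasSum_taylorSeries_of_entire (hφ j) 0 1
  rw [← hs.tsum_eq]
  refine tsum_of_norm_bounded hgeo.hasSum fun n => ?_
  have h1 := ((T' n).le_opNorm (lp.single 1 j 1)).trans
    (mul_le_mul_of_nonneg_right (hC n) (norm_nonneg _))
  rw [lp.norm_single (by simp), norm_one, mul_one] at h1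
  change ‖((σ ^ n / n.factorial : ℝ) : ℂ) • T n _‖ ≤ C at h1
  rw [norm_smul, hT, hsingle, Complex.norm_real, Real.norm_of_nonneg (by positivity)] at h1
  rw [sub_zero, one_pow, one_smul, norm_smul, norm_inv, Complex.norm_natCast, inv_pow,
    ← div_eq_mul_inv, le_div_iff₀ (by positivity)]
  refine le_trans (le_of_eq ?_) h1
  ring

end Series

noncomputable section HartogsSeries

open Real

def realHartogs (r : ℂ → ℝ) : Set (ℂ × ℂ) := {p | ‖p.2‖ < exp (-r p.1)}

def IsUnitCoefficient (r : ℂ → ℝ) (j : ℕ) (f : ℂ → ℂ) : Prop :=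
  Differentiable ℂ f ∧ Integrable (fun z => ‖f z‖ ^ 2 * exp (-((2 * (j + 1) : ℝ) * r z))) ∧
    ∫ z, ‖f z‖ ^ 2 * exp (-((2 * (j + 1) : ℝ) * r z)) ≤ 1

abbrev monomialTerm (f : ℕ → ℂ → ℂ) (j : ℕ) (p : ℂ × ℂ) : ℂ := f j p.1 * p.2 ^ j

lemma exists_gap_of_mem_realHartogs {r : ℂ → ℝ} {p : ℂ × ℂ} (hp : p ∈ realHartogs r) :
    ∃ lam : ℝ, r p.1 < lam ∧ ‖p.2‖ < exp (-lam) := by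
  obtain ⟨s, hs1, hs2⟩ := exists_between (show ‖p.2‖ < exp (-r p.1) from hp)
  have hs0 : 0 < s := (norm_nonneg _).trans_lt hs1
  refine ⟨-log s, ?_, by rwa [neg_neg, exp_log hs0]⟩
  rw [lt_neg]
  exact (log_lt_iff_lt_exp hs0).2 hs2

lemma isOpen_realHartogs {r : ℂ → ℝ} (hr : UpperSemicontinuous r) : IsOpen (realHartogs r) := by
  rw [isOpen_iff_mem_nhds]
  intro p hp
  obtain ⟨lam, h1, h2⟩ := exists_gap_of_mem_realHartogs hp
  have e1 : ∀ᶠ q : ℂ × ℂ in 𝓝 p, r q.1 < lam := continuousAt_fst.eventually (hr p.1 lam h1)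
  have e2 : ∀ᶠ q : ℂ × ℂ in 𝓝 p, ‖q.2‖ < exp (-lam) :=
    (continuous_snd.norm.continuousAt).eventually (gt_mem_nhds h2)
  filter_upwards [e1, e2] with q h3 h4
  exact h4.trans (exp_lt_exp.2 (neg_lt_neg h3))

lemma norm_sq_le_of_unitCoefficient {r : ℂ → ℝ} {j : ℕ} {f : ℂ → ℂ}
    (hf : IsUnitCoefficient r j f) {z : ℂ} {t lam : ℝ} (ht : 0 < t)
    (hlam : ∀ ζ : ℂ, ‖ζ‖ < t → r (z + ζ) ≤ lam) :
    (∫ ζ, radialBump t ζ) * ‖f z‖ ^ 2 ≤ exp ((2 * (j + 1) : ℝ) * lam) := by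
  obtain ⟨hfd, hfi, hf1⟩ := hf
  set k : ℝ := 2 * (j + 1) with hk
  have hk0 : 0 ≤ k := by positivity
  have hrad : IsRadial (radialBump t) := fun u z hu => by simp [radialBump, hu]
  have hm := integral_radial_mul_of_differentiable hrad (contDiff_radialBump t).continuous
    (hasCompactSupport_radialBump ht) (hfd.pow 2) z
  have hm' := congrArg norm hm
  rw [norm_smul, Real.norm_of_nonneg (integral_radialBump_pos ht).le] at hm'
  simp only [Pi.pow_apply, norm_pow] at hm'
  rw [← hm']
  refine (norm_integral_le_integral_norm _).trans ?_
  have hmono : ∫ ζ, ‖radialBump t ζ • f (z + ζ) ^ 2‖ ≤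
      ∫ ζ, exp (k * lam) * (‖f (z + ζ)‖ ^ 2 * exp (-(k * r (z + ζ)))) := by
    refine integral_mono_of_nonneg (ae_of_all _ fun _ => norm_nonneg _)
      ((hfi.comp_add_left z).const_mul _) (ae_of_all _ fun ζ => ?_)
    simp only [norm_smul, norm_pow]
    have h0 : 0 ≤ radialBump t ζ := smoothTransition.nonneg _
    have h1 : radialBump t ζ ≤ 1 := smoothTransition.le_one _
    rw [Real.norm_of_nonneg h0]
    rcases lt_or_ge ‖ζ‖ t with hζ | hζ
    · have h2 : 1 ≤ exp (k * lam) * exp (-(k * r (z + ζ))) := by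
        rw [← exp_add]
        apply one_le_exp
        have := mul_le_mul_of_nonneg_left (hlam ζ hζ) hk0
        linarith
      calc radialBump t ζ * ‖f (z + ζ)‖ ^ 2 ≤ 1 * ‖f (z + ζ)‖ ^ 2 := by gcongr
        _ ≤ (exp (k * lam) * exp (-(k * r (z + ζ)))) * ‖f (z + ζ)‖ ^ 2 := by gcongr
        _ = _ := by ring
    · rw [radialBump_eq_zero ht hζ, zero_mul]
      positivity
  refine hmono.trans ?_
  rw [integral_const_mul,
    integral_add_left_eq_self (fun ζ => ‖f ζ‖ ^ 2 * exp (-(k * r ζ))) z]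
  exact mul_le_of_le_one_right (exp_pos _).le hf1

lemma exists_local_bound {r : ℂ → ℝ} (hr : UpperSemicontinuous r) {f : ℕ → ℂ → ℂ}
    (hf : ∀ j, IsUnitCoefficient r j (f j)) {p : ℂ × ℂ} (hp : p ∈ realHartogs r) :
    ∃ δ B : ℝ, 0 < δ ∧ ∀ j, ∀ q ∈ ball p δ, ‖monomialTerm f j q‖ ≤ B := by
  obtain ⟨lam, h1, h2⟩ := exists_gap_of_mem_realHartogs hp
  obtain ⟨t, ht, hball⟩ := Metric.eventually_nhds_iff_ball.1 (hr p.1 lam h1)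
  have e2 : ∀ᶠ q : ℂ × ℂ in 𝓝 p, ‖q.2‖ < exp (-lam) :=
    (continuous_snd.norm.continuousAt).eventually (gt_mem_nhds h2)
  obtain ⟨δ, hδ, hδb⟩ := Metric.eventually_nhds_iff_ball.1 e2
  set m := ∫ ζ, radialBump (t / 2) ζ with hm
  have hm0 : 0 < m := integral_radialBump_pos (by positivity)
  refine ⟨min δ (t / 2), √(exp (2 * lam) / m), by positivity, fun j q hq => ?_⟩
  have hq1 : q.1 ∈ ball p.1 (t / 2) := by
    rw [mem_ball, Prod.dist_eq] at hq
    exact ((le_max_left _ _).trans_lt hq).trans_le (min_le_right _ _)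
  have hq2 : ‖q.2‖ < exp (-lam) := hδb q (ball_subset_ball (min_le_left _ _) hq)
  have hb := norm_sq_le_of_unitCoefficient (hf j) (half_pos ht) (z := q.1) (lam := lam)
    fun ζ hζ => (hball _ (by
      rw [mem_ball, dist_eq_norm] at hq1 ⊢
      calc ‖q.1 + ζ - p.1‖ = ‖(q.1 - p.1) + ζ‖ := by ring_nf
        _ ≤ ‖q.1 - p.1‖ + ‖ζ‖ := norm_add_le _ _
        _ < t := by linarith)).le
  refine le_sqrt_of_sq_le ?_
  rw [le_div_iff₀ hm0, norm_mul, norm_pow, mul_pow]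
  have h3 : (‖q.2‖ ^ j) ^ 2 ≤ exp (-(2 * j * lam)) := by
    have : exp (-(2 * j * lam)) = (exp (-lam) ^ j) ^ 2 := by
      rw [← exp_nat_mul, ← exp_nat_mul]
      congr 1
      push_cast
      ring
    rw [this]
    gcongr
  calc ‖f j q.1‖ ^ 2 * (‖q.2‖ ^ j) ^ 2 * m = (m * ‖f j q.1‖ ^ 2) * (‖q.2‖ ^ j) ^ 2 := by ring
    _ ≤ exp ((2 * (j + 1) : ℝ) * lam) * exp (-(2 * j * lam)) :=
      mul_le_mul hb h3 (by positivity) (exp_pos _).le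
    _ = exp (2 * lam) := by rw [← exp_add]; ring_nf

lemma differentiable_monomialTerm {f : ℕ → ℂ → ℂ} (hf : ∀ j, Differentiable ℂ (f j)) (j : ℕ) :
    Differentiable ℂ (monomialTerm f j) := by
  have := hf j
  unfold monomialTerm
  fun_prop

lemma differentiableOn_series {U : Set (ℂ × ℂ)} {u : ℕ → ℂ × ℂ → ℂ}
    (hu : ∀ j, Differentiable ℂ (u j))
    (hB : ∀ p ∈ U, ∃ δ B : ℝ, 0 < δ ∧ ∀ j, ∀ q ∈ ball p δ, ‖u j q‖ ≤ B)
    (c : lp (fun _ : ℕ => ℂ) 1) : DifferentiableOn ℂ (fun p => ∑' j, c j * u j p) U := by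
  intro p hp
  obtain ⟨δ, B, hδ, hb⟩ := hB p hp
  have hB0 : 0 ≤ B := (norm_nonneg _).trans (hb 0 p (mem_ball_self hδ))
  refine (HasFDerivAt.differentiableAt (hasFDerivAt_tsum_of_isPreconnected
    (f := fun j p => c j * u j p) (f' := fun j p => c j • fderiv ℂ (u j) p)
    (s := ball p (δ / 2)) (x₀ := p)
    ((summable_norm_lp_one c).mul_right (2 * B / (δ / 2))) isOpen_ball
    (convex_ball _ _).isPreconnected (fun j q _ => ?_) (fun j q hq => ?_)
    (mem_ball_self (half_pos hδ)) (summable_lp_one_mul c fun j => hb j p (mem_ball_self hδ))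
    (mem_ball_self (half_pos hδ)))).differentiableWithinAt
  · exact (hu j q).hasFDerivAt.const_mul (c j)
  · rw [norm_smul]
    refine mul_le_mul_of_nonneg_left ?_ (norm_nonneg _)
    have hsub : ball q (δ / 2) ⊆ ball p δ := ball_subset_ball' (by
      rw [mem_ball] at hq; linarith)
    refine Complex.norm_fderiv_le_div_of_mapsTo_ball (hu j).differentiableOn (fun x hx => ?_)
      (half_pos hδ)
    rw [mem_closedBall, dist_eq_norm]
    refine (norm_sub_le _ _).trans ?_
    have h1 := hb j x (hsub hx)
    have h2 := hb j q (hsub (mem_ball_self (half_pos hδ)))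
    linarith

lemma lintegral_monomialTerm_le {r : ℂ → ℝ} (hr : UpperSemicontinuous r) {f : ℕ → ℂ → ℂ}
    {j : ℕ} (hf : IsUnitCoefficient r j (f j)) :
    ∫⁻ p in realHartogs r, ‖monomialTerm f j p‖ₑ ^ 2 ≤ ENNReal.ofReal π := by
  obtain ⟨hfd, hfi, hf1⟩ := hf
  have hG : MeasurableSet (realHartogs r) := (isOpen_realHartogs hr).measurableSet
  have hm : Measurable (monomialTerm f j) := by
    have := hfd.continuous.measurable
    unfold monomialTerm
    fun_prop
  rw [← lintegral_indicator hG, Measure.volume_eq_prod,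
    lintegral_prod _ ((hm.enorm.pow_const 2).indicator hG).aemeasurable]
  have hin : ∀ z : ℂ, ∫⁻ w : ℂ, (realHartogs r).indicator (fun p => ‖monomialTerm f j p‖ₑ ^ 2) (z, w)
      ≤ ENNReal.ofReal π * ENNReal.ofReal (‖f j z‖ ^ 2 * exp (-((2 * (j + 1) : ℝ) * r z))) := by
    intro z
    set s := exp (-r z) with hs
    calc _ ≤ ∫⁻ w : ℂ, (ball (0 : ℂ) s).indicator
          (fun _ => ENNReal.ofReal (‖f j z‖ ^ 2 * (s ^ j) ^ 2)) w := by
          refine lintegral_mono fun w => ?_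
          by_cases hw : ‖w‖ < s
          · rw [indicator_of_mem (show (z, w) ∈ realHartogs r from hw),
              indicator_of_mem (by simpa using hw), ← ofReal_norm, ← ENNReal.ofReal_pow (norm_nonneg _)]
            refine ENNReal.ofReal_le_ofReal ?_
            simp only [monomialTerm, norm_mul, norm_pow, mul_pow]
            gcongr
          · rw [indicator_of_notMem (show (z, w) ∉ realHartogs r from hw)]
            exact zero_le
      _ = ENNReal.ofReal (‖f j z‖ ^ 2 * (s ^ j) ^ 2) * (ENNReal.ofReal s ^ 2 * NNReal.pi) := by
          rw [lintegral_indicator isOpen_ball.measurableSet, setLIntegral_const, Complex.volume_ball]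
      _ = _ := by
          have hpi : (NNReal.pi : ENNReal) = ENNReal.ofReal π := by
            rw [ENNReal.ofReal, ← NNReal.coe_real_pi, Real.toNNReal_coe]
          rw [hpi, ← ENNReal.ofReal_pow (exp_pos _).le, ← ENNReal.ofReal_mul (by positivity),
            ← ENNReal.ofReal_mul (by positivity), ← ENNReal.ofReal_mul (by positivity)]
          congr 1
          have : exp (-((2 * (j + 1) : ℝ) * r z)) = (s ^ j) ^ 2 * s ^ 2 := by
            rw [hs, ← exp_nat_mul, ← exp_nat_mul, ← exp_nat_mul, ← exp_add]
            congr 1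
            push_cast
            ring
          rw [this]
          ring
  refine (lintegral_mono hin).trans ?_
  rw [lintegral_const_mul' _ _ ENNReal.ofReal_ne_top, ← ofReal_integral_eq_lintegral_ofReal hfi
    (ae_of_all _ fun z => by positivity)]
  refine mul_le_of_le_one_right (zero_le) ?_
  exact ENNReal.ofReal_le_one.2 hf1

lemma memLp_series {r : ℂ → ℝ} (hr : UpperSemicontinuous r) {f : ℕ → ℂ → ℂ}
    (hf : ∀ j, IsUnitCoefficient r j (f j)) (c : lp (fun _ : ℕ => ℂ) 1) :
    MemLp (fun p => ∑' j, c j * monomialTerm f j p) 2 (volume.restrict (realHartogs r)) := by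
  have hG := isOpen_realHartogs hr
  have hd := differentiable_monomialTerm fun j => (hf j).1
  set μ := (volume : Measure (ℂ × ℂ)).restrict (realHartogs r) with hμ
  have hdiff := differentiableOn_series (U := realHartogs r) hd
    (fun p hp => exists_local_bound hr hf hp) c
  have hmeas : ∀ j, AEStronglyMeasurable (fun p => c j * monomialTerm f j p) μ := fun j =>
    ((hd j).const_mul (c j)).continuous.aestronglyMeasurable
  have hnorm : ∀ j, eLpNorm (monomialTerm f j) 2 μ ≤ ENNReal.ofReal π ^ (1 / 2 : ℝ) := fun j => by
    have h2 := eLpNorm_nnreal_eq_lintegral (f := monomialTerm f j) (μ := μ) (p := 2) (by norm_num)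
    simp only [NNReal.coe_ofNat, ENNReal.coe_ofNat, ENNReal.rpow_ofNat] at h2
    rw [h2]
    exact ENNReal.rpow_le_rpow (lintegral_monomialTerm_le hr (hf j)) (by norm_num)
  set K := ENNReal.ofReal π ^ (1 / 2 : ℝ) with hK
  have hKt : K ≠ ⊤ := ENNReal.rpow_ne_top_of_nonneg (by norm_num) ENNReal.ofReal_ne_top
  have hsumc : ∑' j, ‖c j‖ₑ ≠ ⊤ := by
    have := (summable_norm_lp_one c).tsum_ofReal_ne_top
    simpa only [ofReal_norm] using this
  refine ⟨(hdiff.continuousOn.aestronglyMeasurable hG.measurableSet), ?_⟩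
  have hlim : eLpNorm (fun p => ∑' j, c j * monomialTerm f j p) 2 μ ≤
      liminf (fun n => eLpNorm (∑ j ∈ Finset.range n, fun p => c j * monomialTerm f j p) 2 μ)
        atTop := by
    refine Lp.eLpNorm_lim_le_liminf_eLpNorm (fun n => Finset.aestronglyMeasurable_sum _
      fun j _ => hmeas j) _ ?_
    refine (ae_restrict_iff' hG.measurableSet).2 (ae_of_all _ fun p hp => ?_)
    obtain ⟨δ, B, hδ, hb⟩ := exists_local_bound hr hf hp
    simpa [Finset.sum_apply] using (summable_lp_one_mul c
      fun j => hb j p (mem_ball_self hδ)).hasSum.tendsto_sum_nat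
  refine (hlim.trans (liminf_le_of_frequently_le' (x := (∑' j, ‖c j‖ₑ) * K)
    (Frequently.of_forall fun n => ?_))).trans_lt (ENNReal.mul_lt_top hsumc.lt_top hKt.lt_top)
  refine (eLpNorm_sum_le (fun j _ => hmeas j) (by norm_num)).trans ?_
  rw [← ENNReal.tsum_mul_right]
  refine le_trans (Finset.sum_le_sum fun j _ => ?_) (ENNReal.sum_le_tsum (Finset.range n))
  have := eLpNorm_const_smul (c j) (monomialTerm f j) 2 μ
  change eLpNorm (fun p => c j * monomialTerm f j p) 2 μ = _ at this
  rw [this]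
  exact mul_le_mul_right (hnorm j) _

end HartogsSeries

noncomputable section Extension

open Real

lemma false_of_local_extension {r : ℂ → ℝ} (h : BddSubharmonic r) (hnc : ¬ ∃ c, ∀ z, r z = c)
    {q : ℂ × ℂ} (hq : q ∈ realHartogs r) {R : ℝ} (hR : ¬ ball q R ⊆ realHartogs r)
    (hext : ∀ f ∈ L2h (realHartogs r), ∃ g : ℂ × ℂ → ℂ, DifferentiableOn ℂ g (ball q R) ∧
      g =ᶠ[𝓝 q] f) : False := by
  obtain ⟨⟨a, b⟩, hab, habG⟩ := not_subset.1 hR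
  have hb : exp (-r a) ≤ ‖b‖ := not_lt.1 habG
  have hb0 : 0 < ‖b‖ := (exp_pos _).trans_le hb
  obtain ⟨b', hb', hab'⟩ : ∃ b' : ℂ, exp (-r a) < ‖b'‖ ∧ (a, b') ∈ ball q R := by
    have hc : Continuous fun τ : ℝ => ((a, (τ : ℂ) * b) : ℂ × ℂ) := by fun_prop
    have h1 : ∀ᶠ τ : ℝ in 𝓝[>] 1, ((a, (τ : ℂ) * b) : ℂ × ℂ) ∈ ball q R :=
      (hc.continuousAt.eventually (isOpen_ball.mem_nhds (by simpa using hab))).filter_mono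
        nhdsWithin_le_nhds
    obtain ⟨τ, h2, h3⟩ := (h1.and self_mem_nhdsWithin).exists
    have h4 : (1 : ℝ) < τ := h3
    refine ⟨τ * b, ?_, h2⟩
    rw [norm_mul, Complex.norm_real, Real.norm_of_nonneg (by linarith)]
    nlinarith
  obtain ⟨k₀, c, hc, hk⟩ := h.exists_entire_at hnc a
  have hchoice : ∀ j : ℕ, ∃ f : ℂ → ℂ, IsUnitCoefficient r j f ∧
      (k₀ ≤ (j : ℝ) → c * exp ((j + 1) * r a) ≤ ‖f a‖) := by
    intro j
    by_cases hj : k₀ ≤ (j : ℝ)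
    · obtain ⟨f, h1, h2, h3, h4⟩ := hk (2 * (j + 1)) (by linarith [j.cast_nonneg (α := ℝ)])
      refine ⟨f, ⟨h1, h2, h3⟩, fun _ => ?_⟩
      rwa [show (2 * ((j : ℝ) + 1)) * r a / 2 = (j + 1) * r a by ring] at h4
    · exact ⟨fun _ => 0, ⟨differentiable_const _, by simp, by simp⟩, fun hh => absurd hh hj⟩
  choose f hf hfa using hchoice
  set v : ℂ × ℂ := (a, b') - q with hv
  have hvR : ‖v‖ < R := by simpa [hv, dist_eq_norm] using hab'
  obtain ⟨δ, B, hδ, hbd⟩ := exists_local_bound h.usc hf hq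
  obtain ⟨s, hs1, hsv⟩ : ∃ s : ℝ, 1 < s ∧ s * ‖v‖ < R := by
    have hcs : Continuous fun s : ℝ => s * ‖v‖ := by fun_prop
    have h1 : ∀ᶠ s : ℝ in 𝓝[>] 1, s * ‖v‖ < R :=
      (hcs.continuousAt.eventually (gt_mem_nhds (by simpa using hvR))).filter_mono
        nhdsWithin_le_nhds
    obtain ⟨s, h2, h3⟩ := (h1.and self_mem_nhdsWithin).exists
    exact ⟨s, h3, h2⟩
  have hd := differentiable_monomialTerm fun j => (hf j).1
  have hline : Differentiable ℂ fun t : ℂ => q + t • v := by fun_prop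
  have hfar : ∀ {ρ σ : ℝ}, ρ * ‖v‖ ≤ σ → 0 < σ → ∀ t ∈ ball (0 : ℂ) ρ, q + t • v ∈ ball q σ := by
    intro ρ σ hρ hσ t ht
    rw [mem_ball_zero_iff] at ht
    rw [mem_ball, dist_eq_norm, add_sub_cancel_left, norm_smul]
    rcases (norm_nonneg v).eq_or_lt with h0 | h0
    · rw [← h0, mul_zero]; exact hσ
    · exact (mul_lt_mul_of_pos_right ht h0).trans_le hρ
  have hR0 : 0 < R := (norm_nonneg _).trans_lt hvR
  obtain ⟨C, hC⟩ := bounded_at_one_of_extension (φ := fun j t => monomialTerm f j (q + t • v))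
    (δ := δ / (‖v‖ + 1)) (B := B) (fun j => (hd j).comp hline) (by positivity)
    (fun j t ht => hbd j _ (hfar (by
      rw [div_mul_eq_mul_div, div_le_iff₀ (by positivity)]
      nlinarith [norm_nonneg v]) hδ t ht)) hs1 fun d => by
      have hmem : (fun p => ∑' j, d j * monomialTerm f j p) ∈ L2h (realHartogs r) := by
        refine ⟨differentiableOn_series hd (fun p hp => exists_local_bound h.usc hf hp) d, ?_⟩
        have := memLp_series h.usc hf d
        exact (memLp_two_iff_integrable_sq_norm this.1).1 this
      obtain ⟨g, hg, hgf⟩ := hext _ hmem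
      refine ⟨fun t => g (q + t • v), hg.comp hline.differentiableOn
        (fun t ht => hfar hsv.le hR0 t ht), ?_⟩
      have ht : Tendsto (fun t : ℂ => q + t • v) (𝓝 0) (𝓝 q) := by
        simpa using hline.continuous.tendsto 0
      exact ht.eventually hgf
  set y := exp (r a) * ‖b'‖ with hy
  have hy1 : 1 < y := by
    have := mul_lt_mul_of_pos_left hb' (exp_pos (r a))
    rwa [← exp_add, add_neg_cancel, exp_zero] at this
  obtain ⟨j, hj1, hj2⟩ := (((tendsto_pow_atTop_atTop_of_one_lt hy1).eventually_gt_atTop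
    (C / (c * exp (r a)))).and (tendsto_natCast_atTop_atTop.eventually_ge_atTop k₀)).exists
  rw [div_lt_iff₀ (by positivity)] at hj1
  have h1 := hC j
  simp only [one_smul, hv, add_sub_cancel, monomialTerm, norm_mul, norm_pow] at h1
  have h2 := mul_le_mul_of_nonneg_right (hfa j hj2) (pow_nonneg (norm_nonneg b') j)
  have h3 : c * exp ((j + 1) * r a) * ‖b'‖ ^ j = y ^ j * (c * exp (r a)) := by
    rw [hy, mul_pow, ← exp_nat_mul, add_mul, one_mul, exp_add]
    ring
  linarith

lemma eqOn_ball_of_eventuallyEq {E : Type*} [NormedAddCommGroup E] [NormedSpace ℂ E]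
    {f g : E → ℂ} {q : E} {R : ℝ} (hf : DifferentiableOn ℂ f (ball q R))
    (hg : DifferentiableOn ℂ g (ball q R)) (hfg : f =ᶠ[𝓝 q] g) : EqOn f g (ball q R) := by
  intro x hx
  have hline : Differentiable ℂ fun t : ℂ => q + t • (x - q) := by fun_prop
  set T : Set ℂ := (fun t : ℂ => q + t • (x - q)) ⁻¹' ball q R with hT
  have hTo : IsOpen T := isOpen_ball.preimage hline.continuous
  have hTc : Convex ℝ T := by
    intro s hs t ht α β hα hβ hαβ
    have := convex_ball q R hs ht hα hβ hαβ
    rw [hT, mem_preimage]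
    convert this using 1
    have hq : α • q + β • q = q := by rw [← add_smul, hαβ, one_smul]
    dsimp only
    rw [smul_add, smul_add, add_smul, smul_assoc, smul_assoc]
    generalize s • (x - q) = u
    generalize t • (x - q) = v
    calc q + (α • u + β • v) = (α • q + β • q) + (α • u + β • v) := by rw [hq]
      _ = _ := by abel
  have hR : 0 < R := (dist_nonneg).trans_lt hx
  have h0 : (0 : ℂ) ∈ T := by simp [hT, hR]
  have h1 : (1 : ℂ) ∈ T := by simpa [hT] using hx
  have ht : Tendsto (fun t : ℂ => q + t • (x - q)) (𝓝 0) (𝓝 q) := by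
    simpa using hline.continuous.tendsto 0
  have := ((hf.comp hline.differentiableOn fun t ht => ht).analyticOnNhd
    hTo).eqOn_of_preconnected_of_eventuallyEq
    ((hg.comp hline.differentiableOn fun t ht => ht).analyticOnNhd hTo) hTc.isPreconnected h0
    (ht.eventually hfg) h1
  simpa using this

lemma isL2hDomainOfHolomorphy_realHartogs {r : ℂ → ℝ} (h : BddSubharmonic r)
    (hnc : ¬ ∃ c, ∀ z, r z = c) : IsL2hDomainOfHolomorphy (realHartogs r) := by
  rintro ⟨D₀, D₁, hD₀, hc₀, hD₁, hc₁, hsub, hnsub, hext⟩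
  have hG := isOpen_realHartogs h.usc
  choose! g hg hgf using hext
  set W : Set (ℂ × ℂ) := {x | x ∈ D₁ ∩ realHartogs r ∧
    ∀ f ∈ L2h (realHartogs r), g f =ᶠ[𝓝 x] f} with hW
  have hprop : ∀ x ∈ W, ∀ s : ℝ, ball x s ⊆ D₁ → ball x s ⊆ realHartogs r → ball x s ⊆ W := by
    intro x hx s h1 h2 y hy
    refine ⟨⟨h1 hy, h2 hy⟩, fun f hf => ?_⟩
    have := eqOn_ball_of_eventuallyEq ((hg f hf).mono h1) (hf.1.mono h2) (hx.2 f hf)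
    exact this.eventuallyEq_of_mem (isOpen_ball.mem_nhds hy)
  have hWo : IsOpen W := by
    rw [Metric.isOpen_iff]
    intro x hx
    obtain ⟨s, hs, hsb⟩ := Metric.isOpen_iff.1 (hD₁.inter hG) x hx.1
    exact ⟨s, hs, hprop x hx s (fun y hy => (hsb hy).1) fun y hy => (hsb hy).2⟩
  have hD₀W : D₀ ⊆ W := fun x hx =>
    ⟨hsub hx, fun f hf => (hgf f hf).eventuallyEq_of_mem (hD₀.mem_nhds hx)⟩
  obtain ⟨x₀, hx₀⟩ := hc₀.nonempty
  have hnot : ¬ closure W ∩ D₁ ⊆ W := fun hcl => by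
    have := hc₁.isPreconnected.subset_of_closure_inter_subset hWo ⟨x₀, (hsub hx₀).1, hD₀W hx₀⟩ hcl
    exact hnsub fun x hx => (this hx).1.2
  obtain ⟨p, ⟨hpcl, hpD⟩, hpW⟩ := not_subset.1 hnot
  obtain ⟨ε, hε, hεb⟩ := Metric.isOpen_iff.1 hD₁ p hpD
  obtain ⟨q, hqW, hpq⟩ := Metric.mem_closure_iff.1 hpcl (ε / 3) (by positivity)
  have hqD : ball q (2 * (ε / 3)) ⊆ D₁ := (ball_subset_ball' (by
    rw [dist_comm]; linarith)).trans hεb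
  refine false_of_local_extension h hnc hqW.1.2 (R := 2 * (ε / 3)) (fun hqG => hpW ?_)
    fun f hf => ⟨g f, (hg f hf).mono hqD, hqW.2 f hf⟩
  exact hprop q hqW _ hqD hqG (by rw [mem_ball]; linarith)

end Extension

noncomputable section SupConvolution

lemma le_integral_of_forall_continuous_majorant {f : ℝ → ℝ} (hf : UpperSemicontinuous f)
    {M B K a b : ℝ} (hM : ∀ t, M ≤ f t) (hB : ∀ t, f t ≤ B)
    (hK : ∀ φ : ℝ → ℝ, Continuous φ → (∀ t, f t ≤ φ t) → K ≤ ∫ t in a..b, φ t) :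
    K ≤ ∫ t in a..b, f t := by
  set F : ℕ → ℝ → ℝ := fun n θ => ⨆ t, (f t - n * dist θ t) with hF
  have hle : ∀ (n : ℕ) (θ t : ℝ), f t - n * dist θ t ≤ B := fun n θ t => by
    have : 0 ≤ (n : ℝ) * dist θ t := by positivity
    linarith [hB t]
  have hbdd : ∀ (n : ℕ) (θ : ℝ), BddAbove (range fun t => f t - n * dist θ t) := fun n θ =>
    ⟨B, by rintro _ ⟨t, rfl⟩; exact hle n θ t⟩
  have hfF : ∀ n θ, f θ ≤ F n θ := fun n θ => by
    simpa using le_ciSup (hbdd n θ) θ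
  have hFB : ∀ n θ, F n θ ≤ B := fun n θ => ciSup_le (hle n θ)
  have hFc : ∀ n, Continuous (F n) := fun n => by
    refine (LipschitzWith.of_le_add_mul (n : NNReal) fun x y => ?_).continuous
    refine ciSup_le fun t => ?_
    have h1 := le_ciSup (hbdd n y) t
    have h2 : dist y t ≤ dist x y + dist x t := by
      rw [dist_comm x y]; exact dist_triangle y x t
    have h3 : (n : ℝ) * dist y t ≤ n * (dist x y + dist x t) := by gcongr
    simp only [NNReal.coe_natCast]
    simp only [hF]
    linarith
  have hlim : ∀ θ, Tendsto (fun n => F n θ) atTop (𝓝 (f θ)) := fun θ => by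
    refine tendsto_order.2 ⟨fun y hy => Eventually.of_forall fun n => hy.trans_le (hfF n θ),
      fun y hy => ?_⟩
    obtain ⟨y', hy1, hy2⟩ := exists_between hy
    obtain ⟨δ, hδ, hδf⟩ := Metric.eventually_nhds_iff.1 (hf θ y' hy1)
    obtain ⟨N, hN⟩ := exists_nat_ge ((B - y') / δ)
    filter_upwards [eventually_ge_atTop N] with n hn
    refine (ciSup_le fun t => ?_).trans_lt hy2
    by_cases ht : dist t θ < δ
    · have : 0 ≤ (n : ℝ) * dist θ t := by positivity
      linarith [hδf ht]
    · rw [not_lt, dist_comm] at ht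
      have h1 : B - y' ≤ N * δ := (div_le_iff₀ hδ).1 hN
      have h2 : (N : ℝ) * δ ≤ n * dist θ t := by gcongr
      linarith [hB t]
  refine ge_of_tendsto' (intervalIntegral.tendsto_integral_filter_of_dominated_convergence
    (fun _ => max |M| |B|) (Eventually.of_forall fun n => (hFc n).aestronglyMeasurable)
    (Eventually.of_forall fun n => ae_of_all _ fun t _ => ?_) (by simp)
    (ae_of_all _ fun t _ => hlim t)) fun n => hK (F n) (hFc n) (hfF n)
  rw [Real.norm_eq_abs]
  exact abs_le_max_abs_abs ((hM t).trans (hfF n t)) (hFB n t)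

open Real in
lemma bddSubharmonic_of_subharmonicOn {r : ℂ → ℝ}
    (hr : SubharmonicOn (fun z => (r z : EReal)) univ) (hM : ∃ M, ∀ z, M ≤ r z) :
    BddSubharmonic r := by
  obtain ⟨-, husc, -, -, hmean⟩ := hr
  have hu : UpperSemicontinuous r := fun z y hy => by
    have := upperSemicontinuousOn_univ_iff.1 husc z (y : EReal)
      (EReal.coe_lt_coe_iff.2 hy)
    filter_upwards [this] with w hw using EReal.coe_lt_coe_iff.1 hw
  refine ⟨hu, hM, fun c ζ => ?_⟩
  obtain ⟨M, hM⟩ := hM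
  obtain rfl | hζ := eq_or_ne ζ 0
  · simp [mul_comm]
  set f : ℝ → ℝ := fun θ => r (c + ‖ζ‖ * Complex.exp (θ * Complex.I)) with hf
  have hper : Function.Periodic f (2 * π) := fun θ => by
    simp only [hf]
    congr 3
    push_cast
    rw [add_mul, Complex.exp_add, Complex.exp_two_pi_mul_I, mul_one]
  have hshift : ∫ θ in (0 : ℝ)..2 * π, r (c + Complex.exp (θ * Complex.I) * ζ) =
      ∫ θ in (0 : ℝ)..2 * π, f θ := by
    have h1 : ∀ θ : ℝ, r (c + Complex.exp (θ * Complex.I) * ζ) = f (θ + ζ.arg) := fun θ => by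
      simp only [hf]
      congr 2
      conv_lhs => rw [← Complex.norm_mul_exp_arg_mul_I ζ]
      push_cast
      rw [add_mul, Complex.exp_add]
      ring
    simp_rw [h1]
    rw [intervalIntegral.integral_comp_add_right, zero_add, add_comm,
      hper.intervalIntegral_add_eq ζ.arg 0, zero_add]
  rw [hshift]
  have hcont : Continuous fun θ : ℝ => c + ‖ζ‖ * Complex.exp (θ * Complex.I) := by fun_prop
  obtain ⟨B, hB⟩ := (hu.upperSemicontinuousOn (closedBall c ‖ζ‖)).bddAbove_of_isCompact
    (isCompact_closedBall c ‖ζ‖)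
  refine le_integral_of_forall_continuous_majorant (fun t y hy => hcont.continuousAt.eventually (hu _ y hy)) (M := M) (B := B)
    (fun t => hM _) (fun t => hB ⟨_, by simp [dist_eq_norm], rfl⟩) fun φ hφ hfφ => ?_
  have := hmean c ‖ζ‖ (norm_pos_iff.2 hζ) (subset_univ _) φ hφ fun θ =>
    EReal.coe_le_coe_iff.2 (hfφ θ)
  have h2 : r c ≤ (2 * π)⁻¹ * ∫ θ in (0 : ℝ)..2 * π, φ θ :=
    EReal.coe_le_coe_iff.1 this
  rwa [inv_mul_eq_div, le_div_iff₀ (by positivity)] at h2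

end SupConvolution

noncomputable section ConstantWeight

lemma eq_zero_of_integrable_norm_sq {f : ℂ → ℂ} (hf : Differentiable ℂ f)
    (hfi : Integrable fun z => ‖f z‖ ^ 2) : f = 0 := by
  set m : ℝ := ∫ ζ, radialBump 1 ζ with hm
  have hm0 : 0 < m := integral_radialBump_pos one_pos
  set A : ℝ := 1 + ∫ z, ‖f z‖ ^ 2 with hA
  have hI : 0 ≤ ∫ z, ‖f z‖ ^ 2 := integral_nonneg fun z => by positivity
  have hA0 : 0 < A := by positivity
  set s : ℝ := (√A)⁻¹ with hs
  have hs0 : 0 < s := by positivity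
  have hs2 : s ^ 2 = A⁻¹ := by rw [hs, inv_pow, Real.sq_sqrt hA0.le]
  have hunit : IsUnitCoefficient (fun _ => 0) 0 (fun z => (s : ℂ) * f z) := by
    have h1 : (fun z => ‖(s : ℂ) * f z‖ ^ 2 *
        Real.exp (-((2 * ((0 : ℕ) + 1) : ℝ) * 0))) = fun z => A⁻¹ * ‖f z‖ ^ 2 := by
      ext z
      rw [norm_mul, mul_pow, Complex.norm_real, Real.norm_of_nonneg hs0.le, hs2]
      simp
    refine ⟨hf.const_mul _, ?_, ?_⟩
    · rw [h1]; exact hfi.const_mul _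
    · rw [h1, integral_const_mul, inv_mul_le_iff₀ hA0]
      linarith
  have hb : ∀ z, ‖f z‖ ≤ 1 + A / m := fun z => by
    have h2 := norm_sq_le_of_unitCoefficient hunit (z := z) (lam := 0) one_pos fun _ _ => le_rfl
    rw [← hm, norm_mul, mul_pow, Complex.norm_real, Real.norm_of_nonneg hs0.le, hs2,
      mul_zero, Real.exp_zero] at h2
    have h3 : ‖f z‖ ^ 2 ≤ A / m := by
      rw [le_div_iff₀ hm0]
      calc ‖f z‖ ^ 2 * m = A * (m * (A⁻¹ * ‖f z‖ ^ 2)) := by field_simp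
        _ ≤ A * 1 := by gcongr
        _ = A := mul_one A
    nlinarith [norm_nonneg (f z), sq_nonneg (‖f z‖ - 1)]
  have hbd : Bornology.IsBounded (range f) :=
    (isBounded_iff_forall_norm_le).2 ⟨_, by rintro _ ⟨z, rfl⟩; exact hb z⟩
  have hconst : ∀ z, f z = f 0 := fun z => hf.apply_eq_apply_of_bounded hbd z 0
  simp_rw [hconst] at hfi
  rw [integrable_const_iff] at hfi
  have h0 : f 0 = 0 := by
    rcases hfi with h | h
    · simpa using h
    · rw [isFiniteMeasure_iff] at h
      simp at h
  ext z
  rw [hconst z, h0, Pi.zero_apply]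

lemma eqOn_zero_of_mem_L2h_univ_prod_ball {R : ℝ} {f : ℂ × ℂ → ℂ}
    (hf : f ∈ L2h ((univ : Set ℂ) ×ˢ ball (0 : ℂ) R)) :
    EqOn f 0 ((univ : Set ℂ) ×ˢ ball (0 : ℂ) R) := by
  obtain ⟨hd, hi⟩ := hf
  have hi' : Integrable (fun p : ℂ × ℂ => ‖f p‖ ^ 2)
      ((volume : Measure ℂ).prod (volume.restrict (ball (0 : ℂ) R))) := by
    rwa [IntegrableOn, Measure.volume_eq_prod, ← Measure.prod_restrict,
      Measure.restrict_univ] at hi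
  have hz : ∀ᵐ w ∂(volume : Measure ℂ).restrict (ball (0 : ℂ) R), ∀ z, f (z, w) = 0 := by
    filter_upwards [hi'.prod_left_ae, ae_restrict_mem measurableSet_ball] with w hw hwb z
    have hdw : Differentiable ℂ fun z => f (z, w) := by
      rw [← differentiableOn_univ]
      exact hd.comp (by fun_prop) fun z _ => ⟨mem_univ z, hwb⟩
    exact congrFun (eq_zero_of_integrable_norm_sq hdw hw) z
  rintro ⟨z, w⟩ ⟨-, hw⟩
  have hc : ContinuousOn (fun w => f (z, w)) (ball 0 R) :=
    hd.continuousOn.comp (by fun_prop) fun w hw => ⟨mem_univ z, hw⟩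
  exact Measure.eqOn_open_of_ae_eq (g := fun _ => 0) (hz.mono fun w hw => hw z) isOpen_ball hc
    continuousOn_const hw

lemma not_isL2hDomainOfHolomorphy_univ_prod_ball {R : ℝ} (hR : 0 < R) :
    ¬ IsL2hDomainOfHolomorphy ((univ : Set ℂ) ×ˢ ball (0 : ℂ) R) := by
  refine not_not.2 ⟨univ ×ˢ ball 0 R, univ, isOpen_univ.prod isOpen_ball, ?_, isOpen_univ,
    isConnected_univ, fun p hp => ⟨mem_univ p, hp⟩, fun h => ?_, fun f hf =>
      ⟨0, differentiableOn_const 0, (eqOn_zero_of_mem_L2h_univ_prod_ball hf).symm⟩⟩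
  · exact isConnected_univ.prod ((convex_ball 0 R).isConnected ⟨0, mem_ball_self hR⟩)
  · have := (h (mem_univ ((0 : ℂ), (R : ℂ)))).2
    simp [abs_of_pos hR] at this

end ConstantWeight

lemma elog_lt_coe_iff {x y : ℝ} (hx : 0 ≤ x) : elog x < (y : EReal) ↔ x < Real.exp y := by
  obtain rfl | hx := hx.eq_or_lt
  · simp [elog, Real.exp_pos]
  · rw [elog, if_neg hx.not_ge, EReal.coe_lt_coe_iff, Real.log_lt_iff_lt_exp hx]

lemma hartogs_univ_coe (r : ℂ → ℝ) :
    hartogs univ (fun z => (r z : EReal)) = realHartogs r := by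
  ext p
  have := elog_lt_coe_iff (norm_nonneg p.2) (y := -r p.1)
  rw [EReal.coe_neg] at this
  simpa [hartogs, realHartogs] using this

/-- For subharmonic `ρ : ℂ → [-∞,∞)` bounded from below, `G_{ℂ,ρ}` is an
`L²ₕ`-domain of holomorphy iff `ρ` is not constant. -/
theorem hartogs_univ_L2h_domain_iff (ρ : ℂ → EReal) (hρ : SubharmonicOn ρ Set.univ)
    (hbd : ∃ M : ℝ, ∀ z : ℂ, (M : EReal) ≤ ρ z) :
    IsL2hDomainOfHolomorphy (hartogs Set.univ ρ) ↔ ¬ ∃ c : EReal, ∀ z : ℂ, ρ z = c := by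
  obtain ⟨M, hM⟩ := hbd
  obtain ⟨r, rfl⟩ : ∃ r : ℂ → ℝ, ρ = fun z => (r z : EReal) :=
    ⟨fun z => (ρ z).toReal, funext fun z => (EReal.coe_toReal (hρ.2.2.1 z (mem_univ z))
      ((EReal.bot_lt_coe M).trans_le (hM z)).ne').symm⟩
  have hr := bddSubharmonic_of_subharmonicOn hρ ⟨M, fun z => EReal.coe_le_coe_iff.1 (hM z)⟩
  rw [hartogs_univ_coe]
  constructor
  · rintro h ⟨c, hc⟩
    have hr0 : ∀ z, r z = r 0 := fun z => EReal.coe_injective ((hc z).trans (hc 0).symm)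
    refine not_isL2hDomainOfHolomorphy_univ_prod_ball (Real.exp_pos (-r 0)) ?_
    have : realHartogs r = univ ×ˢ ball (0 : ℂ) (Real.exp (-r 0)) := by
      ext p
      simp [realHartogs, hr0 p.1]
    rwa [← this]
  · intro h
    refine isL2hDomainOfHolomorphy_realHartogs hr fun ⟨c, hc⟩ => h ⟨(c : EReal), fun z =>
      congrArg _ (hc z)⟩
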